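/- Korn's inequality for p ∈ (1, ∞): let d ≥ 1 and p ∈ (1, ∞). There exists a constant C > 0 such that for every C^∞ map u : ℝ^d → ℝ^d, ∫_{B₁} |Du(x)|^p dx ≤ C ( ∫_{B₁} |u(x)|^p dx + ∫_{B₁} |𝓔u(x)|^p dx ), where B₁ is the open unit ball of ℝ^d, |·| denotes the Euclidean norm on vectors and the Frobenius norm on matrices. -/

import Mathlib

open MeasureTheory

/-- The Jacobian matrix `(Du)_{ij} = ∂_j u_i` of a map on Euclidean space. -/
noncomputable def jacob {d : ℕ} (u : EuclideanSpace ℝ (Fin d) → EuclideanSpace ℝ (Fin d))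
    (x : EuclideanSpace ℝ (Fin d)) : Matrix (Fin d) (Fin d) ℝ :=
  fun i j => fderiv ℝ u x (EuclideanSpace.single j 1) i

/-- The Frobenius norm of a real matrix. -/
noncomputable def frob {d : ℕ} (M : Matrix (Fin d) (Fin d) ℝ) : ℝ :=
  Real.sqrt (∑ i, ∑ j, (M i j) ^ 2)

section

open ENNReal
open scoped FourierTransform RealInnerProductSpace

/-- The elementary trigonometric inequality behind M. Riesz' theorem. -/
lemma norm_rpow_le_re_rpow_sub {p : ℝ} (hp : 1 < p) (hp2 : p ≤ 2) :
    ∃ A B : ℝ, 0 ≤ A ∧ 0 ≤ B ∧ ∀ z : ℂ, 0 < z.re →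
      ‖z‖ ^ p ≤ A * z.re ^ p - B * (z ^ (p : ℂ)).re := by
  have hpi := Real.pi_pos
  set φ₀ : ℝ := (Real.pi / 2 + Real.pi / (2 * p)) / 2 with hφ₀
  have hp0 : 0 < p := by linarith
  have h1 : Real.pi / (2 * p) < Real.pi / 2 := by
    apply div_lt_div_of_pos_left hpi (by norm_num) (by linarith)
  have h1' : 0 < Real.pi / (2 * p) := by positivity
  have hφlt : φ₀ < Real.pi / 2 := by rw [hφ₀]; linarith
  have hφpos : 0 < φ₀ := by rw [hφ₀]; linarith
  have hpφ : p * φ₀ = p * Real.pi / 4 + Real.pi / 4 := by rw [hφ₀]; field_simp; norm_num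
  have hpφ1 : Real.pi / 2 < p * φ₀ := by rw [hpφ]; nlinarith
  have hpφ2 : p * φ₀ < Real.pi := by rw [hpφ]; nlinarith
  have hc : Real.cos (p * φ₀) < 0 := Real.cos_neg_of_pi_div_two_lt_of_lt hpφ1 (by linarith)
  have hcos0 : 0 < Real.cos φ₀ := Real.cos_pos_of_mem_Ioo ⟨by linarith, hφlt⟩
  set B : ℝ := -(Real.cos (p * φ₀))⁻¹ with hB
  have hBpos : 0 < B := by rw [hB]; simpa using inv_lt_zero.2 hc
  refine ⟨(1 + B) / Real.cos φ₀ ^ p, B, by positivity, hBpos.le, fun z hz => ?_⟩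
  have hz0 : z ≠ 0 := by rintro rfl; simp at hz
  have hzn : 0 < ‖z‖ := norm_pos_iff.2 hz0
  rw [Complex.cpow_ofReal_re]
  have hre : z.re = ‖z‖ * Real.cos |z.arg| := by
    rw [Real.cos_abs, Complex.norm_mul_cos_arg]
  have harg : |z.arg| ≤ Real.pi / 2 := Complex.abs_arg_le_pi_div_two_iff.2 hz.le
  have harg0 := abs_nonneg z.arg
  have hcos : Real.cos (z.arg * p) = Real.cos (p * |z.arg|) := by
    rw [← Real.cos_abs, abs_mul, abs_of_pos hp0, mul_comm]
  rw [hcos, hre]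
  set φ := |z.arg|
  have hcp : 0 ≤ Real.cos φ := Real.cos_nonneg_of_mem_Icc ⟨by linarith, harg⟩
  rw [Real.mul_rpow hzn.le hcp]
  have key : 1 ≤ (1 + B) / Real.cos φ₀ ^ p * Real.cos φ ^ p - B * Real.cos (p * φ) := by
    rcases le_total φ φ₀ with h | h
    · have h2 : Real.cos φ₀ ≤ Real.cos φ :=
        Real.cos_le_cos_of_nonneg_of_le_pi harg0 (by linarith) h
      have h3 : Real.cos φ₀ ^ p ≤ Real.cos φ ^ p := Real.rpow_le_rpow hcos0.le h2 hp0.le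
      have h4 : 0 < Real.cos φ₀ ^ p := Real.rpow_pos_of_pos hcos0 p
      have h5 : 1 + B ≤ (1 + B) / Real.cos φ₀ ^ p * Real.cos φ ^ p := by
        rw [div_mul_eq_mul_div, le_div_iff₀ h4]
        exact mul_le_mul_of_nonneg_left h3 (by linarith)
      nlinarith [Real.cos_le_one (p * φ)]
    · have h2 : Real.cos (p * φ) ≤ Real.cos (p * φ₀) :=
        Real.cos_le_cos_of_nonneg_of_le_pi (by linarith) (by nlinarith)
          (mul_le_mul_of_nonneg_left h hp0.le)
      have h3 : B * Real.cos (p * φ) ≤ B * Real.cos (p * φ₀) :=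
        mul_le_mul_of_nonneg_left h2 hBpos.le
      have h4 : B * Real.cos (p * φ₀) = -1 := by
        rw [hB, neg_mul, inv_mul_cancel₀ hc.ne]
      have h5 : 0 ≤ (1 + B) / Real.cos φ₀ ^ p * Real.cos φ ^ p := by positivity
      linarith
  nlinarith [Real.rpow_pos_of_pos hzn p]

/-- The Cauchy integral of `f`, normalised so that its real part is the Poisson extension. -/
noncomputable def cauchyExt (f : ℝ → ℝ) (z : ℂ) : ℂ :=
  ((Real.pi⁻¹ : ℝ) * Complex.I : ℂ) * ∫ t : ℝ, (f t : ℂ) * (z - t)⁻¹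

lemma im_le_norm_sub_ofReal {z : ℂ} (t : ℝ) : z.im ≤ ‖z - t‖ := by
  have := Complex.abs_im_le_norm (z - t)
  simp at this
  exact (le_abs_self _).trans this

lemma continuous_inv_sub_ofReal {z : ℂ} (hz : 0 < z.im) :
    Continuous fun t : ℝ => (z - t)⁻¹ := by
  refine Continuous.inv₀ (by fun_prop) fun t h => ?_
  have := im_le_norm_sub_ofReal (z := z) t
  rw [h, norm_zero] at this
  linarith

lemma norm_inv_sub_ofReal_le {z : ℂ} (hz : 0 < z.im) (t : ℝ) : ‖(z - t)⁻¹‖ ≤ z.im⁻¹ := by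
  rw [norm_inv]
  exact inv_anti₀ hz (im_le_norm_sub_ofReal t)

lemma integrable_cauchyExt {f : ℝ → ℝ} (hf : Integrable f) {z : ℂ} (hz : 0 < z.im) :
    Integrable fun t : ℝ => (f t : ℂ) * (z - t)⁻¹ :=
  hf.ofReal.mul_bdd (c := z.im⁻¹) (continuous_inv_sub_ofReal hz).aestronglyMeasurable
    (Filter.Eventually.of_forall (norm_inv_sub_ofReal_le hz))

lemma differentiableAt_cauchyExt {f : ℝ → ℝ} (hf : Integrable f) {z : ℂ} (hz : 0 < z.im) :
    DifferentiableAt ℂ (cauchyExt f) z := by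
  have hs : {w : ℂ | z.im / 2 < w.im} ∈ nhds z :=
    (isOpen_lt continuous_const Complex.continuous_im).mem_nhds (by simp; linarith)
  have hne : ∀ w ∈ {w : ℂ | z.im / 2 < w.im}, 0 < w.im := fun w hw => by
    have : z.im / 2 < w.im := hw
    linarith
  have := (hasDerivAt_integral_of_dominated_loc_of_deriv_le (μ := volume) (𝕜 := ℂ)
    (F := fun (w : ℂ) (t : ℝ) => (f t : ℂ) * (w - t)⁻¹)
    (F' := fun (w : ℂ) (t : ℝ) => (f t : ℂ) * (-((w - t)⁻¹ * (w - t)⁻¹))) (x₀ := z)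
    (bound := fun t => |f t| * ((z.im / 2)⁻¹ * (z.im / 2)⁻¹)) hs ?_ ?_ ?_ ?_ ?_ ?_).2
  · exact (this.differentiableAt.const_mul _)
  · filter_upwards [hs] with w hw
    exact (integrable_cauchyExt hf (hne w hw)).aestronglyMeasurable
  · exact integrable_cauchyExt hf hz
  · exact hf.ofReal.aestronglyMeasurable.mul
      ((continuous_inv_sub_ofReal hz).mul (continuous_inv_sub_ofReal hz)).neg.aestronglyMeasurable
  · refine Filter.Eventually.of_forall fun t w hw => ?_
    have h1 : ‖(w - t)⁻¹‖ ≤ (z.im / 2)⁻¹ :=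
      (norm_inv_sub_ofReal_le (hne w hw) t).trans (inv_anti₀ (by linarith) (le_of_lt hw))
    rw [norm_mul, norm_neg, norm_mul, Complex.norm_real, Real.norm_eq_abs]
    gcongr
  · exact hf.abs.mul_const _
  · refine Filter.Eventually.of_forall fun t w hw => ?_
    have hw0 : w - t ≠ 0 := by
      intro h
      have := im_le_norm_sub_ofReal (z := w) t
      rw [h, norm_zero] at this
      linarith [hne w hw]
    have := (((hasDerivAt_id w).sub_const (t : ℂ)).inv hw0).const_mul (f t : ℂ)
    refine this.congr_deriv ?_
    rw [id, neg_div, one_div, pow_two, mul_inv]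

lemma norm_cauchyExt_le {f : ℝ → ℝ} {S : ℝ} (hS : ∀ t, S < |t| → f t = 0)
    (hf : Integrable f) {z : ℂ} (hz0 : 0 < z.im) (hz : 2 * S ≤ ‖z‖) :
    ‖cauchyExt f z‖ ≤ (∫ t, |f t|) / ‖z‖ := by
  have hzn : 0 < ‖z‖ := by
    have := Complex.abs_im_le_norm z
    exact lt_of_lt_of_le hz0 ((le_abs_self _).trans this)
  have hpi := Real.pi_gt_three
  have h1 : ‖∫ t : ℝ, (f t : ℂ) * (z - t)⁻¹‖ ≤ ∫ t, |f t| * (2 / ‖z‖) := by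
    refine norm_integral_le_of_norm_le (hf.abs.mul_const _) (Filter.Eventually.of_forall ?_)
    intro t
    rw [norm_mul, Complex.norm_real, Real.norm_eq_abs]
    by_cases ht : S < |t|
    · simp [hS t ht]
    · push Not at ht
      refine mul_le_mul_of_nonneg_left ?_ (abs_nonneg _)
      have h2 : ‖z‖ / 2 ≤ ‖z - t‖ := by
        have := norm_sub_norm_le z (t : ℂ)
        rw [Complex.norm_real, Real.norm_eq_abs] at this
        linarith
      rw [norm_inv, show 2 / ‖z‖ = (‖z‖ / 2)⁻¹ by field_simp]
      exact inv_anti₀ (by positivity) h2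
  rw [integral_mul_const] at h1
  rw [cauchyExt, norm_mul, norm_mul, Complex.norm_I, Complex.norm_real, Real.norm_eq_abs,
    abs_of_pos (inv_pos.2 Real.pi_pos), mul_one]
  have h0 : 0 ≤ ∫ t, |f t| := integral_nonneg fun t => abs_nonneg _
  have hpi' : Real.pi⁻¹ ≤ 2⁻¹ := inv_anti₀ (by norm_num) (by linarith)
  calc Real.pi⁻¹ * ‖∫ t : ℝ, (f t : ℂ) * (z - t)⁻¹‖
      ≤ 2⁻¹ * ((∫ t, |f t|) * (2 / ‖z‖)) := by gcongr
    _ = _ := by field_simp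

lemma re_cauchyExt {f : ℝ → ℝ} (hf : Integrable f) {x y : ℝ} (hy : 0 < y) :
    (cauchyExt f (x + y * Complex.I)).re
      = ∫ t, f t * (Real.pi⁻¹ * (y / ((x - t) ^ 2 + y ^ 2))) := by
  have h := integrable_cauchyExt hf (z := x + y * Complex.I) (by simpa using hy)
  rw [cauchyExt, ← integral_const_mul]
  rw [show ∀ w : ℂ, w.re = RCLike.re w from fun _ => rfl, ← integral_re (h.const_mul _)]
  refine integral_congr_ae (Filter.Eventually.of_forall fun t => ?_)
  have : ((x - t) ^ 2 + y ^ 2) ≠ 0 := by positivity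
  simp [-Complex.ofReal_inv, Complex.normSq, div_eq_mul_inv, ← pow_two]
  ring

lemma im_cauchyExt {f : ℝ → ℝ} (hf : Integrable f) {x y : ℝ} (hy : 0 < y) :
    (cauchyExt f (x + y * Complex.I)).im
      = ∫ t, f t * (Real.pi⁻¹ * ((x - t) / ((x - t) ^ 2 + y ^ 2))) := by
  have h := integrable_cauchyExt hf (z := x + y * Complex.I) (by simpa using hy)
  rw [cauchyExt, ← integral_const_mul]
  rw [show ∀ w : ℂ, w.im = RCLike.im w from fun _ => rfl, ← integral_im (h.const_mul _)]
  refine integral_congr_ae (Filter.Eventually.of_forall fun t => ?_)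
  have : ((x - t) ^ 2 + y ^ 2) ≠ 0 := by positivity
  simp [-Complex.ofReal_inv, Complex.normSq, div_eq_mul_inv, ← pow_two]
  ring

/-- Jensen's inequality for powers, on a measure space of arbitrary mass. -/
lemma lintegral_rpow_le_rpow_mul_lintegral {α : Type*} [MeasurableSpace α] (μ : Measure α)
    {p : ℝ} (hp : 1 < p) {F : α → ℝ≥0∞} (hF : AEMeasurable F μ) :
    (∫⁻ a, F a ∂μ) ^ p ≤ (μ Set.univ) ^ (p - 1) * ∫⁻ a, F a ^ p ∂μ := by
  have hp0 : 0 < p := by linarith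
  have hpq := Real.HolderConjugate.conjExponent hp
  have h := ENNReal.lintegral_mul_le_Lp_mul_Lq μ hpq hF (aemeasurable_const (b := (1 : ℝ≥0∞)))
  simp only [Pi.mul_apply, mul_one, ENNReal.one_rpow, lintegral_const, one_mul] at h
  calc (∫⁻ a, F a ∂μ) ^ p
      ≤ ((∫⁻ a, F a ^ p ∂μ) ^ (1 / p) * (μ Set.univ) ^ (1 / p.conjExponent)) ^ p :=
        ENNReal.rpow_le_rpow h hp0.le
    _ = _ := by
      rw [ENNReal.mul_rpow_of_nonneg _ _ hp0.le, ← ENNReal.rpow_mul, ← ENNReal.rpow_mul,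
        one_div_mul_cancel hp0.ne', ENNReal.rpow_one, mul_comm]
      congr 2
      rw [Real.conjExponent]
      field_simp

/-- A weighted form of Jensen's inequality for powers. -/
lemma lintegral_mul_rpow_le {α : Type*} [MeasurableSpace α] (μ : Measure α)
    {p : ℝ} (hp : 1 < p) {F k : α → ℝ≥0∞} (hF : Measurable F) (hk : Measurable k) :
    (∫⁻ a, k a * F a ∂μ) ^ p ≤ (∫⁻ a, k a ∂μ) ^ (p - 1) * ∫⁻ a, k a * F a ^ p ∂μ := by
  have h := lintegral_rpow_le_rpow_mul_lintegral (μ.withDensity k) hp hF.aemeasurable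
  rw [lintegral_withDensity_eq_lintegral_mul _ hk hF,
    lintegral_withDensity_eq_lintegral_mul _ hk (hF.pow_const p),
    withDensity_apply _ MeasurableSet.univ, Measure.restrict_univ] at h
  exact h

/-- Young's inequality `‖k * F‖_p ≤ ‖k‖_1 ‖F‖_p`. -/
lemma lintegral_conv_rpow_le {p : ℝ} (hp : 1 < p) {F k : ℝ → ℝ≥0∞} (hF : Measurable F)
    (hk : Measurable k) :
    ∫⁻ x, (∫⁻ t, k (x - t) * F t) ^ p ≤ (∫⁻ s, k s) ^ p * ∫⁻ t, F t ^ p := by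
  have hsub : ∀ x, ∫⁻ t, k (x - t) = ∫⁻ s, k s := fun x => lintegral_sub_left_eq_self k x
  have hsub' : ∀ t, ∫⁻ x, k (x - t) = ∫⁻ s, k s := fun t => lintegral_sub_right_eq_self k t
  calc ∫⁻ x, (∫⁻ t, k (x - t) * F t) ^ p
      ≤ ∫⁻ x, (∫⁻ s, k s) ^ (p - 1) * ∫⁻ t, k (x - t) * F t ^ p := by
        refine lintegral_mono fun x => ?_
        have := lintegral_mul_rpow_le volume hp hF (k := fun t => k (x - t)) (by fun_prop)
        rwa [hsub] at this
    _ = (∫⁻ s, k s) ^ (p - 1) * ∫⁻ t, ∫⁻ x, k (x - t) * F t ^ p := by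
        rw [lintegral_const_mul]
        · rw [lintegral_lintegral_swap]
          exact Measurable.aemeasurable (by fun_prop)
        · exact Measurable.lintegral_prod_right' (f := fun z : ℝ × ℝ => k (z.1 - z.2) * F z.2 ^ p)
            (by fun_prop)
    _ = (∫⁻ s, k s) ^ (p - 1) * ((∫⁻ s, k s) * ∫⁻ t, F t ^ p) := by
        rw [← lintegral_const_mul (∫⁻ s, k s) (hF.pow_const p)]
        congr 1
        refine lintegral_congr fun t => ?_
        rw [lintegral_mul_const _ (by fun_prop), hsub']
    _ = _ := by
        rw [← mul_assoc]
        congr 1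
        nth_rewrite 2 [← ENNReal.rpow_one (∫⁻ s, k s)]
        rw [← ENNReal.rpow_add_of_nonneg _ _ (by linarith) (by norm_num), sub_add_cancel]

lemma lintegral_poisson {y : ℝ} (hy : 0 < y) :
    ∫⁻ s : ℝ, ENNReal.ofReal (Real.pi⁻¹ * (y / (s ^ 2 + y ^ 2))) = 1 := by
  have h := ProbabilityTheory.lintegral_cauchyPDF_eq_one 0 (γ := y.toNNReal)
    (by simpa using hy)
  rw [← h]
  refine lintegral_congr fun s => ?_
  rw [ProbabilityTheory.cauchyPDF_def, ProbabilityTheory.cauchyPDFReal_def]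
  congr 1
  simp [div_eq_mul_inv, mul_assoc, hy.le]

lemma norm_integral_cauchyExt_cpow_le {f : ℝ → ℝ} {S p : ℝ} (hp : 1 < p)
    (hS : ∀ t, S < |t| → f t = 0) (hf : Integrable f)
    (hre : ∀ z : ℂ, 0 < z.im → 0 < (cauchyExt f z).re) {y R : ℝ} (hy : 0 < y) (hR : 0 < R)
    (hR2 : 2 * S ≤ R) :
    ‖∫ x in (-R)..R, cauchyExt f (x + y * Complex.I) ^ (p : ℂ)‖
      ≤ 4 * R * ((∫ t, |f t|) / R) ^ p := by
  have hp0 : 0 < p := by linarith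
  set g : ℂ → ℂ := fun z => cauchyExt f z ^ (p : ℂ) with hg
  have hM : 0 ≤ ∫ t, |f t| := integral_nonneg fun t => abs_nonneg _
  have hbound : ∀ z : ℂ, 0 < z.im → R ≤ ‖z‖ → ‖g z‖ ≤ ((∫ t, |f t|) / R) ^ p := by
    intro z hz hRz
    rw [hg]
    simp only
    rw [Complex.norm_cpow_real]
    refine Real.rpow_le_rpow (norm_nonneg _) ?_ hp0.le
    refine (norm_cauchyExt_le hS hf hz (hR2.trans hRz)).trans ?_
    gcongr
  have hdiff : ∀ z : ℂ, 0 < z.im → DifferentiableAt ℂ g z := fun z hz =>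
    (differentiableAt_cauchyExt hf hz).cpow_const (Or.inl (hre z hz))
  have hrect := Complex.integral_boundary_rect_eq_zero_of_differentiableOn g
    (⟨-R, y⟩ : ℂ) ⟨R, y + R⟩ (by
      intro z hz
      rw [Complex.mem_reProdIm] at hz
      have h2 := hz.2
      simp only at h2
      rw [Set.uIcc_of_le (by linarith)] at h2
      exact (hdiff z (lt_of_lt_of_le hy h2.1)).differentiableWithinAt)
  simp only [smul_eq_mul] at hrect
  have e1 : ‖∫ x in (-R)..R, g (x + ((y + R : ℝ) : ℂ) * Complex.I)‖
      ≤ ((∫ t, |f t|) / R) ^ p * |R - (-R)| := by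
    refine intervalIntegral.norm_integral_le_of_norm_le_const fun x _ => hbound _ ?_ ?_
    · simp; linarith
    · have := Complex.abs_im_le_norm (x + ((y + R : ℝ) : ℂ) * Complex.I)
      simp at this
      rw [abs_of_pos (by linarith)] at this
      simp
      linarith
  have e2 : ∀ c : ℝ, |c| = R → ‖∫ x in y..(y + R), g ((c : ℂ) + x * Complex.I)‖
      ≤ ((∫ t, |f t|) / R) ^ p * |y + R - y| := by
    intro c hc
    refine intervalIntegral.norm_integral_le_of_norm_le_const fun x hx => hbound _ ?_ ?_
    · rw [Set.uIoc_of_le (by linarith)] at hx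
      simp
      linarith [hx.1]
    · have := Complex.abs_re_le_norm (c + (x : ℂ) * Complex.I)
      simp at this
      rw [← hc]
      exact this
  have e3 := e2 R (abs_of_pos hR)
  have e4 := e2 (-R) (by rw [abs_neg, abs_of_pos hR])
  rw [show |R - -R| = 2 * R by rw [abs_of_pos (by linarith)]; ring] at e1
  rw [show |y + R - y| = R by rw [abs_of_pos (by linarith)]; ring] at e3 e4
  set a := ∫ x in (-R)..R, g (x + (y : ℂ) * Complex.I)
  set b := ∫ x in (-R)..R, g (x + ((y + R : ℝ) : ℂ) * Complex.I)
  set c := ∫ x in y..(y + R), g ((R : ℂ) + x * Complex.I)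
  set e := ∫ x in y..(y + R), g (((-R : ℝ) : ℂ) + x * Complex.I)
  have ha : a = b - Complex.I * c + Complex.I * e := by linear_combination hrect
  calc ‖a‖ = ‖b - Complex.I * c + Complex.I * e‖ := by rw [ha]
    _ ≤ ‖b‖ + ‖Complex.I * c‖ + ‖Complex.I * e‖ :=
      (norm_add_le _ _).trans (by gcongr; exact norm_sub_le _ _)
    _ = ‖b‖ + ‖c‖ + ‖e‖ := by simp
    _ ≤ _ := by linarith

/-- M. Riesz' theorem for nonnegative compactly supported functions and `1 < p ≤ 2`. -/
lemma lintegral_norm_cauchyExt_le {p : ℝ} (hp : 1 < p) {A B : ℝ} (hA : 0 ≤ A) (hB : 0 ≤ B)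
    (hAB : ∀ z : ℂ, 0 < z.re → ‖z‖ ^ p ≤ A * z.re ^ p - B * (z ^ (p : ℂ)).re)
    {f : ℝ → ℝ} {S : ℝ} (hS : ∀ t, S < |t| → f t = 0) (hf : Integrable f) (hfm : Measurable f)
    (hf0 : ∀ t, 0 ≤ f t) {y : ℝ} (hy : 0 < y) :
    ∫⁻ x : ℝ, ‖cauchyExt f (x + y * Complex.I)‖ₑ ^ p
      ≤ ENNReal.ofReal A * ∫⁻ t, ‖f t‖ₑ ^ p := by
  have hp0 : 0 < p := by linarith
  by_cases hz : f =ᵐ[volume] 0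
  · have : ∀ z, cauchyExt f z = 0 := by
      intro z
      rw [cauchyExt, integral_eq_zero_of_ae, mul_zero]
      filter_upwards [hz] with t ht
      simp [ht]
    simp [this, hp0]
  have hpos : ∀ z : ℂ, 0 < z.im → 0 < (cauchyExt f z).re := by
    intro z hzim
    have h := re_cauchyExt hf (x := z.re) hzim
    rw [Complex.re_add_im] at h
    have hk : ∀ t, 0 < Real.pi⁻¹ * (z.im / ((z.re - t) ^ 2 + z.im ^ 2)) := fun t => by
      have := Real.pi_pos
      positivity
    have h_int : Integrable fun t => f t * (Real.pi⁻¹ * (z.im / ((z.re - t) ^ 2 + z.im ^ 2))) := by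
      refine hf.mul_bdd (c := Real.pi⁻¹ * z.im⁻¹) ?_ (Filter.Eventually.of_forall fun t => ?_)
      · exact Measurable.aestronglyMeasurable (by fun_prop)
      · rw [Real.norm_eq_abs, abs_of_pos (hk t)]
        refine mul_le_mul_of_nonneg_left ?_ (inv_nonneg.2 Real.pi_pos.le)
        rw [div_le_iff₀ (by positivity), inv_mul_eq_div, le_div_iff₀ hzim]
        nlinarith [sq_nonneg (z.re - t)]
    rw [h, integral_pos_iff_support_of_nonneg (fun t => mul_nonneg (hf0 t) (hk t).le) h_int]
    rw [pos_iff_ne_zero]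
    intro h0
    apply hz
    have : Function.support (fun t => f t * (Real.pi⁻¹ * (z.im / ((z.re - t) ^ 2 + z.im ^ 2))))
        = Function.support f := by
      ext t
      simp only [Function.mem_support, ne_eq, mul_eq_zero, (hk t).ne', or_false]
    rw [this] at h0
    exact ae_iff.2 h0
  set G : ℝ → ℂ := fun x => cauchyExt f (x + y * Complex.I) with hG
  have hGpos : ∀ x, 0 < (G x).re := fun x => hpos _ (by simpa using hy)
  have hGc : Continuous G := by
    rw [continuous_iff_continuousAt]
    intro x
    have h1 : ContinuousAt (cauchyExt f) (x + y * Complex.I) :=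
      (differentiableAt_cauchyExt hf (by simpa using hy)).continuousAt
    exact ContinuousAt.comp (f := fun x : ℝ => (x : ℂ) + y * Complex.I) (x := x) h1
      (by fun_prop)
  have hGre : ∫⁻ x, ENNReal.ofReal ((G x).re ^ p) ≤ ∫⁻ t, ‖f t‖ₑ ^ p := by
    have hY := lintegral_conv_rpow_le hp (F := fun t => ENNReal.ofReal (f t))
      (k := fun s => ENNReal.ofReal (Real.pi⁻¹ * (y / (s ^ 2 + y ^ 2)))) (by fun_prop)
      (by fun_prop)
    rw [lintegral_poisson hy, ENNReal.one_rpow, one_mul] at hY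
    refine (lintegral_mono fun x => ?_).trans (hY.trans_eq (lintegral_congr fun t => ?_))
    · rw [← ENNReal.ofReal_rpow_of_nonneg (hGpos x).le hp0.le]
      refine ENNReal.rpow_le_rpow ?_ hp0.le
      rw [hG]
      simp only
      rw [re_cauchyExt hf hy]
      refine (Real.ofReal_le_enorm _).trans
        ((enorm_integral_le_lintegral_enorm _).trans_eq (lintegral_congr fun t => ?_))
      have hk : 0 ≤ Real.pi⁻¹ * (y / ((x - t) ^ 2 + y ^ 2)) := by
        have := Real.pi_pos
        positivity
      rw [enorm_mul, Real.enorm_eq_ofReal (hf0 t), Real.enorm_eq_ofReal hk, mul_comm]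
    · rw [Real.enorm_eq_ofReal (hf0 t)]
  have hGcp : Continuous fun x => G x ^ (p : ℂ) :=
    hGc.cpow continuous_const fun x => Or.inl (hGpos x)
  set M := ∫ t, |f t|
  have hmain : ∀ R : ℝ, 0 < R → 2 * S ≤ R → ∫⁻ x in Set.Ioc (-R) R, ‖G x‖ₑ ^ p
      ≤ ENNReal.ofReal A * (∫⁻ t, ‖f t‖ₑ ^ p) + ENNReal.ofReal (B * (4 * R * (M / R) ^ p)) := by
    intro R hR hR2
    have hcont := norm_integral_cauchyExt_cpow_le hp hS hf hpos hy hR hR2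
    have hc1 : Continuous fun x => ‖G x‖ ^ p := hGc.norm.rpow_const fun x => Or.inr hp0.le
    have hc2 : Continuous fun x => (G x).re ^ p :=
      (Complex.continuous_re.comp hGc).rpow_const fun x => Or.inr hp0.le
    have hle : -R ≤ R := by linarith
    have h1 : ∫ x in (-R)..R, ‖G x‖ ^ p ≤
        A * (∫ x in (-R)..R, (G x).re ^ p) - B * (∫ x in (-R)..R, G x ^ (p : ℂ)).re := by
      have hr : (∫ x in (-R)..R, G x ^ (p : ℂ)).re = ∫ x in (-R)..R, (G x ^ (p : ℂ)).re :=
        (Complex.reCLM.intervalIntegral_comp_comm (hGcp.intervalIntegrable _ _)).symm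
      rw [hr, ← intervalIntegral.integral_const_mul, ← intervalIntegral.integral_const_mul,
        ← intervalIntegral.integral_sub]
      · refine intervalIntegral.integral_mono hle (hc1.intervalIntegrable _ _) ?_
          fun x => hAB _ (hGpos x)
        exact Continuous.intervalIntegrable (by fun_prop) _ _
      · exact Continuous.intervalIntegrable (by fun_prop) _ _
      · exact Continuous.intervalIntegrable (by fun_prop) _ _
    have h2 : ∫ x in (-R)..R, ‖G x‖ ^ p ≤
        A * (∫ x in (-R)..R, (G x).re ^ p) + B * (4 * R * (M / R) ^ p) := by
      have h3 := (Complex.abs_re_le_norm (∫ x in (-R)..R, G x ^ (p : ℂ))).trans hcont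
      have h4 := (abs_le.1 h3).1
      nlinarith
    rw [intervalIntegral.integral_of_le hle, intervalIntegral.integral_of_le hle] at h2
    have e1 : ∫⁻ x in Set.Ioc (-R) R, ‖G x‖ₑ ^ p
        = ENNReal.ofReal (∫ x in Set.Ioc (-R) R, ‖G x‖ ^ p) := by
      rw [ofReal_integral_eq_lintegral_ofReal
        ((hc1.continuousOn.integrableOn_Icc).mono_set Set.Ioc_subset_Icc_self)
        (Filter.Eventually.of_forall fun x => by positivity)]
      refine lintegral_congr fun x => ?_
      rw [← ENNReal.ofReal_rpow_of_nonneg (norm_nonneg _) hp0.le, ofReal_norm]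
    have e2 : ENNReal.ofReal (∫ x in Set.Ioc (-R) R, (G x).re ^ p) ≤ ∫⁻ t, ‖f t‖ₑ ^ p := by
      rw [ofReal_integral_eq_lintegral_ofReal
        ((hc2.continuousOn.integrableOn_Icc).mono_set Set.Ioc_subset_Icc_self)
        (Filter.Eventually.of_forall fun x => Real.rpow_nonneg (hGpos x).le _)]
      exact (setLIntegral_le_lintegral _ _).trans hGre
    rw [e1]
    refine (ENNReal.ofReal_le_ofReal h2).trans (ENNReal.ofReal_add_le.trans ?_)
    rw [ENNReal.ofReal_mul hA]
    gcongr
  have hlim1 : Filter.Tendsto (fun R : ℝ => ∫⁻ x in Set.Ioc (-R) R, ‖G x‖ₑ ^ p) Filter.atTop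
      (nhds (∫⁻ x, ‖G x‖ₑ ^ p)) :=
    (aecover_Ioc Filter.tendsto_neg_atTop_atBot
        Filter.tendsto_id).lintegral_tendsto_of_countably_generated
      (Measurable.aemeasurable (hGc.measurable.enorm.pow_const p))
  have hlim2 : Filter.Tendsto (fun R : ℝ => B * (4 * R * (M / R) ^ p)) Filter.atTop (nhds 0) := by
    have hM : 0 ≤ M := integral_nonneg fun t => abs_nonneg _
    have h := (tendsto_rpow_neg_atTop (show 0 < p - 1 by linarith)).const_mul (B * (4 * M ^ p))
    rw [mul_zero] at h
    refine h.congr' ?_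
    filter_upwards [Filter.eventually_gt_atTop 0] with R hR
    rw [Real.div_rpow hM hR.le, Real.rpow_neg hR.le, Real.rpow_sub_one hR.ne']
    field_simp
  have hlim3 := (ENNReal.tendsto_ofReal hlim2).const_add (ENNReal.ofReal A * ∫⁻ t, ‖f t‖ₑ ^ p)
  rw [ENNReal.ofReal_zero, add_zero] at hlim3
  refine le_of_tendsto_of_tendsto hlim1 hlim3 ?_
  filter_upwards [Filter.eventually_gt_atTop 0, Filter.eventually_ge_atTop (2 * S)] with R h1 h2
  exact hmain R h1 h2

/-- The conjugate Poisson kernel of the upper half plane. -/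
noncomputable def conjPoisson (y s : ℝ) : ℝ := Real.pi⁻¹ * (s / (s ^ 2 + y ^ 2))

/-- An integrable approximation of the kernel `1 / (π s)` of the Hilbert transform. -/
noncomputable def hilbertKernel (ε N s : ℝ) : ℝ := conjPoisson ε s - conjPoisson N s

@[fun_prop]
lemma measurable_conjPoisson (y : ℝ) : Measurable (conjPoisson y) := by
  unfold conjPoisson
  fun_prop

@[fun_prop]
lemma measurable_hilbertKernel (ε N : ℝ) : Measurable (hilbertKernel ε N) := by
  unfold hilbertKernel
  fun_prop

lemma hilbertKernel_neg (ε N s : ℝ) : hilbertKernel ε N (-s) = -hilbertKernel ε N s := by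
  simp only [hilbertKernel, conjPoisson, neg_sq]
  ring

lemma abs_conjPoisson_le {y : ℝ} (hy : 0 < y) (s : ℝ) :
    |conjPoisson y s| ≤ Real.pi⁻¹ * (2 * y)⁻¹ := by
  rw [conjPoisson, abs_mul, abs_of_pos (inv_pos.2 Real.pi_pos), abs_div,
    abs_of_pos (show 0 < s ^ 2 + y ^ 2 by positivity)]
  refine mul_le_mul_of_nonneg_left ?_ (inv_nonneg.2 Real.pi_pos.le)
  rw [div_le_iff₀ (by positivity), inv_mul_eq_div, le_div_iff₀ (by positivity), ← sq_abs s]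
  nlinarith [sq_nonneg (|s| - y)]

lemma integrable_hilbertKernel {ε N : ℝ} (hε : 0 < ε) (hN : 0 < N) :
    Integrable (hilbertKernel ε N) := by
  have hP : Integrable fun s : ℝ => Real.pi⁻¹ * (N / (s ^ 2 + N ^ 2)) := by
    refine ⟨Measurable.aestronglyMeasurable (by fun_prop), ?_⟩
    rw [hasFiniteIntegral_iff_ofReal (Filter.Eventually.of_forall fun s => by
      have := Real.pi_pos
      simp only [Pi.zero_apply]
      positivity), lintegral_poisson hN]
    simp
  have hb := hP.mul_bdd (c := Real.pi⁻¹ * (2 * ε)⁻¹)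
    (measurable_conjPoisson ε).aestronglyMeasurable
    (Filter.Eventually.of_forall fun s => (Real.norm_eq_abs _).trans_le (abs_conjPoisson_le hε s))
  refine (hb.const_mul (Real.pi * ((N ^ 2 - ε ^ 2) / N))).congr
    (Filter.Eventually.of_forall fun s => ?_)
  have h1 : s ^ 2 + ε ^ 2 ≠ 0 := by positivity
  have h2 : s ^ 2 + N ^ 2 ≠ 0 := by positivity
  have := Real.pi_ne_zero
  simp only [hilbertKernel, conjPoisson]
  field_simp
  ring

lemma integral_eq_zero_of_odd {g : ℝ → ℝ} (h : ∀ s, g (-s) = -g s) : ∫ s, g s = 0 := by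
  have h1 := integral_neg_eq_self g volume
  simp only [h, integral_neg] at h1
  linarith

lemma enorm_sub_rpow_le {p : ℝ} (hp : 1 ≤ p) (a b : ℝ) :
    ‖a - b‖ₑ ^ p ≤ 2 ^ (p - 1) * (‖a‖ₑ ^ p + ‖b‖ₑ ^ p) := by
  refine (ENNReal.rpow_le_rpow (enorm_sub_le) (by linarith)).trans ?_
  exact ENNReal.rpow_add_le_mul_rpow_add_rpow _ _ hp

lemma integrable_of_bdd_of_support {f : ℝ → ℝ} (hfm : Measurable f) {M S : ℝ}
    (hM : ∀ t, |f t| ≤ M) (hS : ∀ t, S < |t| → f t = 0) : Integrable f := by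
  have : IntegrableOn f (Set.Icc (-S) S) :=
    Measure.integrableOn_of_bounded (M := M) (by simp) hfm.aestronglyMeasurable
      (Filter.Eventually.of_forall fun t => by simpa using hM t)
  rw [← integrableOn_iff_integrable_of_support_subset (s := Set.Icc (-S) S)]
  · exact this
  · intro t ht
    by_contra h
    apply ht
    apply hS
    by_contra h2
    exact h (abs_le.1 (not_lt.1 h2))

lemma lintegral_conjPoisson_le {p : ℝ} (hp : 1 < p) (hp2 : p ≤ 2) : ∃ C : NNReal,
    ∀ y : ℝ, 0 < y → ∀ f : ℝ → ℝ, Measurable f → (∃ M, ∀ t, |f t| ≤ M) →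
      (∃ S, ∀ t, S < |t| → f t = 0) →
      ∫⁻ x, ‖∫ t, conjPoisson y (x - t) * f t‖ₑ ^ p ≤ C * ∫⁻ t, ‖f t‖ₑ ^ p := by
  obtain ⟨A, B, hA, hB, hAB⟩ := norm_rpow_le_re_rpow_sub hp hp2
  have hp0 : 0 < p := by linarith
  refine ⟨2 ^ (p - 1) * (A.toNNReal + A.toNNReal), ?_⟩
  rintro y hy f hfm ⟨M, hM⟩ ⟨S, hS⟩
  set f₁ : ℝ → ℝ := fun t => max (f t) 0
  set f₂ : ℝ → ℝ := fun t => max (-f t) 0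
  have hf1m : Measurable f₁ := hfm.max measurable_const
  have hf2m : Measurable f₂ := hfm.neg.max measurable_const
  have hf1S : ∀ t, S < |t| → f₁ t = 0 := fun t ht => by simp [f₁, hS t ht]
  have hf2S : ∀ t, S < |t| → f₂ t = 0 := fun t ht => by simp [f₂, hS t ht]
  have hf1M : ∀ t, |f₁ t| ≤ |f t| := fun t => by
    rw [abs_of_nonneg (le_max_right _ _)]
    exact max_le (le_abs_self _) (abs_nonneg _)
  have hf2M : ∀ t, |f₂ t| ≤ |f t| := fun t => by
    rw [abs_of_nonneg (le_max_right _ _)]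
    exact max_le (neg_le_abs _) (abs_nonneg _)
  have hf1i := integrable_of_bdd_of_support hf1m (fun t => (hf1M t).trans (hM t)) hf1S
  have hf2i := integrable_of_bdd_of_support hf2m (fun t => (hf2M t).trans (hM t)) hf2S
  have hb1 := lintegral_norm_cauchyExt_le hp hA hB hAB hf1S hf1i hf1m (fun t => le_max_right _ _) hy
  have hb2 := lintegral_norm_cauchyExt_le hp hA hB hAB hf2S hf2i hf2m (fun t => le_max_right _ _) hy
  have hmono : ∀ g : ℝ → ℝ, (∀ t, |g t| ≤ |f t|) → ∫⁻ t, ‖g t‖ₑ ^ p ≤ ∫⁻ t, ‖f t‖ₑ ^ p :=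
    fun g hg => lintegral_mono fun t => ENNReal.rpow_le_rpow
      (by simpa only [enorm_le_iff_norm_le, Real.norm_eq_abs] using hg t) hp0.le
  have h_int : ∀ g : ℝ → ℝ, Integrable g → ∀ x, Integrable fun t => conjPoisson y (x - t) * g t :=
    fun g hg x => hg.bdd_mul (c := Real.pi⁻¹ * (2 * y)⁻¹)
      (Measurable.aestronglyMeasurable (by fun_prop))
      (Filter.Eventually.of_forall fun t => by
        rw [Real.norm_eq_abs]; exact abs_conjPoisson_le hy _)
  have him : ∀ g : ℝ → ℝ, Integrable g → ∀ x : ℝ,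
      ‖∫ t, conjPoisson y (x - t) * g t‖ₑ ^ p ≤ ‖cauchyExt g (x + y * Complex.I)‖ₑ ^ p := by
    intro g hg x
    refine ENNReal.rpow_le_rpow ?_ hp0.le
    rw [enorm_le_iff_norm_le]
    refine le_trans (le_of_eq ?_) (Complex.abs_im_le_norm _)
    rw [im_cauchyExt hg hy, Real.norm_eq_abs]
    congr 1
    refine integral_congr_ae (Filter.Eventually.of_forall fun t => ?_)
    simp only [conjPoisson]
    ring
  have hms : ∀ g : ℝ → ℝ, Measurable g → Measurable fun x => ∫ t, conjPoisson y (x - t) * g t := by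
    intro g hg
    refine StronglyMeasurable.measurable ?_
    refine StronglyMeasurable.integral_prod_right
      (f := fun x t => conjPoisson y (x - t) * g t) ?_
    exact Measurable.stronglyMeasurable (by fun_prop)
  calc ∫⁻ x, ‖∫ t, conjPoisson y (x - t) * f t‖ₑ ^ p
      = ∫⁻ x, ‖(∫ t, conjPoisson y (x - t) * f₁ t) - ∫ t, conjPoisson y (x - t) * f₂ t‖ₑ ^ p := by
        refine lintegral_congr fun x => ?_
        rw [← integral_sub (h_int _ hf1i x) (h_int _ hf2i x)]
        congr 3
        funext t
        rw [← mul_sub]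
        congr 1
        simp only [f₁, f₂]
        rcases le_total (f t) 0 with h | h
        · rw [max_eq_right h, max_eq_left (by linarith)]; ring
        · rw [max_eq_left h, max_eq_right (by linarith)]; ring
    _ ≤ ∫⁻ x, 2 ^ (p - 1) * (‖∫ t, conjPoisson y (x - t) * f₁ t‖ₑ ^ p
          + ‖∫ t, conjPoisson y (x - t) * f₂ t‖ₑ ^ p) :=
        lintegral_mono fun x => enorm_sub_rpow_le hp.le _ _
    _ = 2 ^ (p - 1) * ((∫⁻ x, ‖∫ t, conjPoisson y (x - t) * f₁ t‖ₑ ^ p)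
          + ∫⁻ x, ‖∫ t, conjPoisson y (x - t) * f₂ t‖ₑ ^ p) := by
        have h1 := hms f₁ hf1m
        have h2 := hms f₂ hf2m
        rw [lintegral_const_mul _ (by fun_prop), lintegral_add_left (by fun_prop)]
    _ ≤ 2 ^ (p - 1) * (ENNReal.ofReal A * (∫⁻ t, ‖f t‖ₑ ^ p)
          + ENNReal.ofReal A * ∫⁻ t, ‖f t‖ₑ ^ p) := by
        gcongr
        · refine (lintegral_mono fun x => him _ hf1i x).trans (hb1.trans ?_)
          exact mul_le_mul' le_rfl (hmono _ hf1M)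
        · refine (lintegral_mono fun x => him _ hf2i x).trans (hb2.trans ?_)
          exact mul_le_mul' le_rfl (hmono _ hf2M)
    _ = _ := by
        rw [ENNReal.coe_mul, ENNReal.coe_rpow_of_nonneg _ (by linarith), ENNReal.coe_add]
        simp only [ENNReal.ofReal, ENNReal.coe_ofNat]
        ring

/-- Convolution with the truncated Hilbert kernel. -/
noncomputable def hilbertConv (ε N : ℝ) (f : ℝ → ℝ) (x : ℝ) : ℝ :=
  ∫ t, hilbertKernel ε N (x - t) * f t

lemma measurable_hilbertConv {ε N : ℝ} {f : ℝ → ℝ} (hf : Measurable f) :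
    Measurable (hilbertConv ε N f) := by
  refine StronglyMeasurable.measurable ?_
  refine StronglyMeasurable.integral_prod_right
    (f := fun x t => hilbertKernel ε N (x - t) * f t) ?_
  exact Measurable.stronglyMeasurable (by fun_prop)

lemma abs_hilbertConv_le {ε N : ℝ} (hε : 0 < ε) (hN : 0 < N) {f : ℝ → ℝ} {M : ℝ}
    (hM : ∀ t, |f t| ≤ M) (x : ℝ) :
    |hilbertConv ε N f x| ≤ (∫ s, |hilbertKernel ε N s|) * M := by
  have hk : Integrable fun t => |hilbertKernel ε N (x - t)| :=
    ((integrable_hilbertKernel hε hN).comp_sub_left x).abs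
  rw [← Real.norm_eq_abs]
  refine (norm_integral_le_of_norm_le (hk.mul_const M) (Filter.Eventually.of_forall fun t =>
      ?_)).trans
    (le_of_eq ?_)
  · rw [norm_mul, Real.norm_eq_abs, Real.norm_eq_abs]
    exact mul_le_mul_of_nonneg_left (hM t) (abs_nonneg _)
  · rw [integral_mul_const, integral_sub_left_eq_self (fun s => |hilbertKernel ε N s|)]

lemma lintegral_hilbertConv_le_of_le_two {p : ℝ} (hp : 1 < p) (hp2 : p ≤ 2) : ∃ C : NNReal,
    ∀ ε N : ℝ, 0 < ε → 0 < N → ∀ f : ℝ → ℝ, Measurable f → (∃ M, ∀ t, |f t| ≤ M) →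
      (∃ S, ∀ t, S < |t| → f t = 0) →
      ∫⁻ x, ‖hilbertConv ε N f x‖ₑ ^ p ≤ C * ∫⁻ t, ‖f t‖ₑ ^ p := by
  obtain ⟨C, hC⟩ := lintegral_conjPoisson_le hp hp2
  refine ⟨2 ^ (p - 1) * (C + C), fun ε N hε hN f hfm hfM hfS => ?_⟩
  have h1 := hC ε hε f hfm hfM hfS
  have h2 := hC N hN f hfm hfM hfS
  obtain ⟨M, hM⟩ := hfM
  obtain ⟨S, hS⟩ := hfS
  have hfi := integrable_of_bdd_of_support hfm hM hS
  have h_int : ∀ y : ℝ, 0 < y → ∀ x, Integrable fun t => conjPoisson y (x - t) * f t :=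
    fun y hy x => hfi.bdd_mul (c := Real.pi⁻¹ * (2 * y)⁻¹)
      (Measurable.aestronglyMeasurable (by fun_prop))
      (Filter.Eventually.of_forall fun t => by
        rw [Real.norm_eq_abs]; exact abs_conjPoisson_le hy _)
  have hms : ∀ y, Measurable fun x => ∫ t, conjPoisson y (x - t) * f t := by
    intro y
    refine StronglyMeasurable.measurable ?_
    refine StronglyMeasurable.integral_prod_right
      (f := fun x t => conjPoisson y (x - t) * f t) ?_
    exact Measurable.stronglyMeasurable (by fun_prop)
  have hm1 := hms ε
  have hm2 := hms N
  calc ∫⁻ x, ‖hilbertConv ε N f x‖ₑ ^ p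
      ≤ ∫⁻ x, 2 ^ (p - 1) * (‖∫ t, conjPoisson ε (x - t) * f t‖ₑ ^ p
          + ‖∫ t, conjPoisson N (x - t) * f t‖ₑ ^ p) := by
        refine lintegral_mono fun x => ?_
        have : hilbertConv ε N f x
            = (∫ t, conjPoisson ε (x - t) * f t) - ∫ t, conjPoisson N (x - t) * f t := by
          rw [← integral_sub (h_int ε hε x) (h_int N hN x), hilbertConv]
          congr 1
          funext t
          rw [hilbertKernel, sub_mul]
        rw [this]
        exact enorm_sub_rpow_le hp.le _ _
    _ = 2 ^ (p - 1) * ((∫⁻ x, ‖∫ t, conjPoisson ε (x - t) * f t‖ₑ ^ p)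
          + ∫⁻ x, ‖∫ t, conjPoisson N (x - t) * f t‖ₑ ^ p) := by
        rw [lintegral_const_mul _ (by fun_prop), lintegral_add_left (by fun_prop)]
    _ ≤ 2 ^ (p - 1) * (C * (∫⁻ t, ‖f t‖ₑ ^ p) + C * ∫⁻ t, ‖f t‖ₑ ^ p) := by
        gcongr
    _ = _ := by
        rw [ENNReal.coe_mul, ENNReal.coe_rpow_of_nonneg _ (by linarith), ENNReal.coe_add]
        simp only [ENNReal.coe_ofNat]
        ring

lemma integral_hilbertConv_mul {ε N : ℝ} (hε : 0 < ε) (hN : 0 < N) {f g : ℝ → ℝ}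
    (hf : Integrable f) (hgm : Measurable g) {M : ℝ} (hM : ∀ t, |g t| ≤ M) :
    ∫ x, hilbertConv ε N f x * g x = -∫ t, f t * hilbertConv ε N g t := by
  have h_int : Integrable (fun z : ℝ × ℝ => hilbertKernel ε N (z.1 - z.2) * f z.2 * g z.1)
      (volume.prod volume) := by
    have h1 : Integrable (fun z : ℝ × ℝ => f z.2 * hilbertKernel ε N (z.1 - z.2))
        (volume.prod volume) :=
      hf.convolution_integrand (ContinuousLinearMap.mul ℝ ℝ) (integrable_hilbertKernel hε hN)
    have h2 := h1.mul_bdd (c := M) (g := fun z : ℝ × ℝ => g z.1)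
      (Measurable.aestronglyMeasurable (by fun_prop))
      (Filter.Eventually.of_forall fun z => by simpa using hM z.1)
    exact h2.congr (Filter.Eventually.of_forall fun z => by ring)
  calc ∫ x, hilbertConv ε N f x * g x
      = ∫ x, ∫ t, hilbertKernel ε N (x - t) * f t * g x := by
        simp only [hilbertConv, integral_mul_const]
    _ = ∫ t, ∫ x, hilbertKernel ε N (x - t) * f t * g x := integral_integral_swap h_int
    _ = ∫ t, -(f t * hilbertConv ε N g t) := by
        refine integral_congr_ae (Filter.Eventually.of_forall fun t => ?_)
        simp only [hilbertConv]
        rw [← integral_const_mul, ← integral_neg]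
        congr 1
        funext x
        rw [← neg_sub t x, hilbertKernel_neg]
        ring
    _ = _ := integral_neg _

/-- The `L^p` bound for compactly supported functions when `p > 2`, by duality. -/
lemma lintegral_hilbertConv_le_of_two_lt {p : ℝ} (hp2 : 2 < p) : ∃ C : NNReal,
    ∀ ε N : ℝ, 0 < ε → 0 < N → ∀ f : ℝ → ℝ, Measurable f → (∃ M, ∀ t, |f t| ≤ M) →
      (∃ S, ∀ t, S < |t| → f t = 0) →
      ∫⁻ x, ‖hilbertConv ε N f x‖ₑ ^ p ≤ C * ∫⁻ t, ‖f t‖ₑ ^ p := by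
  have hp0 : 0 < p := by linarith
  have hpq := Real.HolderConjugate.conjExponent (show 1 < p by linarith)
  set q := p.conjExponent with hq
  have hq1 : 1 < q := hpq.symm.lt
  have hq0 : 0 < q := by linarith
  have hq2 : q ≤ 2 := by
    rw [hq, Real.conjExponent, div_le_iff₀ (by linarith)]
    linarith
  have hpq1 : (p - 1) * q = p := by
    rw [hq, Real.conjExponent]
    have : p - 1 ≠ 0 := by linarith
    field_simp
  obtain ⟨C, hC⟩ := lintegral_hilbertConv_le_of_le_two hq1 hq2
  refine ⟨C ^ (p / q), ?_⟩
  rintro ε N hε hN f hfm ⟨M, hM⟩ ⟨S, hS⟩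
  have hfi := integrable_of_bdd_of_support hfm hM hS
  set u := hilbertConv ε N f with hu
  have hum : Measurable u := measurable_hilbertConv hfm
  set L := (∫ s, |hilbertKernel ε N s|) * M
  have huL : ∀ x, |u x| ≤ L := abs_hilbertConv_le hε hN hM
  have hL : 0 ≤ L := (abs_nonneg _).trans (huL 0)
  have hR : ∀ R : ℝ, ∫⁻ x in Set.Ioc (-R) R, ‖u x‖ₑ ^ p ≤ (C ^ (p / q) : NNReal) *
      ∫⁻ t, ‖f t‖ₑ ^ p := by
    intro R
    set h : ℝ → ℝ := (Set.Ioc (-R) R).indicator fun x => SignType.sign (u x) * |u x| ^ (p - 1)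
      with hh
    have hsm : Measurable fun x => ((SignType.sign (u x) : SignType) : ℝ) := by
      have : (fun x => ((SignType.sign (u x) : SignType) : ℝ)) = fun x => Real.sign (u x) := by
        funext x
        rcases lt_trichotomy (u x) 0 with h | h | h
        · simp [h, Real.sign_of_neg]
        · simp [h]
        · simp [h, Real.sign_of_pos]
      rw [this]
      unfold Real.sign
      exact Measurable.ite (measurableSet_lt hum measurable_const) measurable_const
        (Measurable.ite (measurableSet_lt measurable_const hum) measurable_const measurable_const)
    have hhm : Measurable h := by
      refine Measurable.indicator ?_ measurableSet_Ioc
      exact hsm.mul ((continuous_abs.measurable.comp hum).pow_const _)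
    have hsign : ∀ a : ℝ, |((SignType.sign a : SignType) : ℝ)| ≤ 1 := by
      intro a
      rcases lt_trichotomy a 0 with h | h | h <;> simp [h]
    have hhM : ∀ x, |h x| ≤ L ^ (p - 1) := by
      intro x
      rw [hh, Set.indicator_apply]
      split_ifs
      · rw [abs_mul, abs_of_nonneg (Real.rpow_nonneg (abs_nonneg _) _)]
        refine (mul_le_of_le_one_left (Real.rpow_nonneg (abs_nonneg _) _) (hsign _)).trans ?_
        exact Real.rpow_le_rpow (abs_nonneg _) (huL x) (by linarith)
      · rw [abs_zero]; positivity
    have hhS : ∀ x, |R| < |x| → h x = 0 := by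
      intro x hx
      rw [hh, Set.indicator_of_notMem]
      intro hxR
      have : |x| ≤ |R| := (abs_le.2 ⟨by linarith [hxR.1], hxR.2⟩).trans (le_abs_self R)
      linarith
    have hhq : ∫⁻ x, ‖h x‖ₑ ^ q ≤ ∫⁻ x in Set.Ioc (-R) R, ‖u x‖ₑ ^ p := by
      rw [← lintegral_indicator measurableSet_Ioc]
      refine lintegral_mono fun x => ?_
      rw [hh]
      simp only [Set.indicator_apply]
      split_ifs
      · have : ‖((SignType.sign (u x) : SignType) : ℝ) * |u x| ^ (p - 1)‖ₑ ≤ ‖u x‖ₑ ^ (p - 1) := by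
          rw [enorm_mul, Real.enorm_rpow_of_nonneg (abs_nonneg _) (by linarith),
            show ‖|u x|‖ₑ = ‖u x‖ₑ by rw [Real.enorm_eq_ofReal_abs, Real.enorm_eq_ofReal_abs,
                abs_abs]]
          refine mul_le_of_le_one_left' ?_
          rw [← enorm_one (G := ℝ), enorm_le_iff_norm_le]
          simpa using hsign (u x)
        refine (ENNReal.rpow_le_rpow this hq0.le).trans_eq ?_
        rw [← ENNReal.rpow_mul, hpq1]
      · simp [hq0]
    have hX : ∫⁻ x in Set.Ioc (-R) R, ‖u x‖ₑ ^ p ≠ ∞ := by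
      have : ∫⁻ x in Set.Ioc (-R) R, ‖u x‖ₑ ^ p ≤ ∫⁻ x in Set.Ioc (-R) R, ENNReal.ofReal L ^ p := by
        refine lintegral_mono fun x => ENNReal.rpow_le_rpow ?_ hp0.le
        rw [Real.enorm_eq_ofReal_abs]
        exact ENNReal.ofReal_le_ofReal (huL x)
      refine ne_top_of_le_ne_top ?_ this
      rw [lintegral_const]
      exact ENNReal.mul_ne_top (ENNReal.rpow_ne_top_of_nonneg hp0.le ENNReal.ofReal_ne_top)
        (by simp)
    have hXeq : ∫⁻ x in Set.Ioc (-R) R, ‖u x‖ₑ ^ p ≤ ∫⁻ t, ‖f t‖ₑ * ‖hilbertConv ε N h t‖ₑ := by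
      have e1 : ∀ x, u x * h x = (Set.Ioc (-R) R).indicator (fun x => |u x| ^ p) x := by
        intro x
        simp only [hh, Set.indicator_apply]
        split_ifs
        · rw [← mul_assoc, mul_comm (u x), sign_mul_self]
          by_cases h0 : u x = 0
          · simp [h0, hp0.ne']
          · rw [Real.rpow_sub_one (abs_ne_zero.2 h0)]
            field_simp
        · simp
      have e2 := integral_hilbertConv_mul hε hN hfi hhm hhM
      calc ∫⁻ x in Set.Ioc (-R) R, ‖u x‖ₑ ^ p
          = ENNReal.ofReal (∫ x, u x * h x) := by
            simp only [e1]
            rw [integral_indicator measurableSet_Ioc, ofReal_integral_eq_lintegral_ofReal]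
            · refine lintegral_congr fun x => ?_
              rw [← ENNReal.ofReal_rpow_of_nonneg (abs_nonneg _) hp0.le, Real.enorm_eq_ofReal_abs]
            · refine Measure.integrableOn_of_bounded (M := L ^ p) (by simp)
                ((continuous_abs.measurable.comp hum).pow_const _).aestronglyMeasurable ?_
              refine Filter.Eventually.of_forall fun x => ?_
              rw [Real.norm_eq_abs, abs_of_nonneg (Real.rpow_nonneg (abs_nonneg _) _)]
              exact Real.rpow_le_rpow (abs_nonneg _) (huL x) hp0.le
            · exact Filter.Eventually.of_forall fun x => Real.rpow_nonneg (abs_nonneg _) _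
        _ ≤ ‖∫ t, f t * hilbertConv ε N h t‖ₑ := by
            rw [e2, ← enorm_neg]
            exact Real.ofReal_le_enorm _
        _ ≤ ∫⁻ t, ‖f t * hilbertConv ε N h t‖ₑ := enorm_integral_le_lintegral_enorm _
        _ = _ := by simp only [enorm_mul]
    set X := ∫⁻ x in Set.Ioc (-R) R, ‖u x‖ₑ ^ p
    set a := ∫⁻ t, ‖f t‖ₑ ^ p
    have hhol := ENNReal.lintegral_mul_le_Lp_mul_Lq volume hpq (f := fun t => ‖f t‖ₑ)
      (g := fun t => ‖hilbertConv ε N h t‖ₑ) (by fun_prop)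
      (measurable_hilbertConv hhm).enorm.aemeasurable
    simp only [Pi.mul_apply] at hhol
    have h1 : X ≤ a ^ (1 / p) * (C * X) ^ (1 / q) := by
      refine hXeq.trans (hhol.trans ?_)
      gcongr
      exact (hC ε N hε hN h hhm ⟨_, hhM⟩ ⟨_, hhS⟩).trans (mul_le_mul' le_rfl hhq)
    by_cases hX0 : X = 0
    · rw [hX0]; exact zero_le
    have hXq : X ^ (1 / q) ≠ 0 := by
      simp [ENNReal.rpow_eq_zero_iff, hX0, hX]
    have hXq' : X ^ (1 / q) ≠ ∞ := ENNReal.rpow_ne_top_of_nonneg (by positivity) hX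
    have h2 : X ^ (1 / p) ≤ a ^ (1 / p) * (C : ℝ≥0∞) ^ (1 / q) := by
      rw [← ENNReal.mul_le_mul_iff_left hXq hXq', ← ENNReal.rpow_add_of_nonneg _ _ (by positivity)
          (by positivity)]
      have : 1 / p + 1 / q = 1 := by
        have := hpq.inv_add_inv_eq_one
        simpa [one_div] using this
      rw [this, ENNReal.rpow_one]
      rwa [ENNReal.mul_rpow_of_nonneg _ _ (by positivity), ← mul_assoc] at h1
    have h3 := ENNReal.rpow_le_rpow h2 hp0.le
    rw [ENNReal.mul_rpow_of_nonneg _ _ hp0.le, ← ENNReal.rpow_mul, ← ENNReal.rpow_mul,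
      ← ENNReal.rpow_mul, one_div_mul_cancel hp0.ne', ENNReal.rpow_one, ENNReal.rpow_one,
      mul_comm a, one_div_mul_eq_div] at h3
    rwa [ENNReal.coe_rpow_of_nonneg _ (by positivity)]
  have hlim1 : Filter.Tendsto (fun R : ℝ => ∫⁻ x in Set.Ioc (-R) R, ‖u x‖ₑ ^ p) Filter.atTop
      (nhds (∫⁻ x, ‖u x‖ₑ ^ p)) :=
    (aecover_Ioc Filter.tendsto_neg_atTop_atBot
        Filter.tendsto_id).lintegral_tendsto_of_countably_generated
      (Measurable.aemeasurable (hum.enorm.pow_const p))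
  exact le_of_tendsto' hlim1 hR

/-- `L^p` boundedness of the truncated Hilbert transforms, uniformly in the truncation. -/
lemma lintegral_hilbertConv_le {p : ℝ} (hp : 1 < p) : ∃ C : NNReal,
    ∀ ε N : ℝ, 0 < ε → 0 < N → ∀ f : ℝ → ℝ, Measurable f → (∃ M, ∀ t, |f t| ≤ M) →
      ∫⁻ x, ‖∫ s, hilbertKernel ε N s * f (x - s)‖ₑ ^ p ≤ C * ∫⁻ t, ‖f t‖ₑ ^ p := by
  have : ∃ C : NNReal,
    ∀ ε N : ℝ, 0 < ε → 0 < N → ∀ f : ℝ → ℝ, Measurable f → (∃ M, ∀ t, |f t| ≤ M) →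
      (∃ S, ∀ t, S < |t| → f t = 0) →
      ∫⁻ x, ‖hilbertConv ε N f x‖ₑ ^ p ≤ C * ∫⁻ t, ‖f t‖ₑ ^ p := by
    rcases le_or_gt p 2 with h | h
    · exact lintegral_hilbertConv_le_of_le_two hp h
    · exact lintegral_hilbertConv_le_of_two_lt h
  have hp0 : 0 < p := by linarith
  obtain ⟨C, hC⟩ := this
  refine ⟨C, ?_⟩
  rintro ε N hε hN f hfm ⟨M, hM⟩
  have hconv : ∀ x, ∫ s, hilbertKernel ε N s * f (x - s) = hilbertConv ε N f x := by
    intro x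
    rw [hilbertConv, ← integral_sub_left_eq_self _ volume x]
    simp
  simp only [hconv]
  set F : ℕ → ℝ → ℝ := fun n => (Set.Icc (-(n : ℝ)) n).indicator f with hF
  have hFm : ∀ n, Measurable (F n) := fun n => hfm.indicator measurableSet_Icc
  have hFle : ∀ n t, |F n t| ≤ |f t| := by
    intro n t
    simp only [hF, Set.indicator_apply]
    split_ifs <;> simp
  have hFS : ∀ (n : ℕ) (t : ℝ), (n : ℝ) < |t| → F n t = 0 := by
    intro n t ht
    rw [hF]
    simp only
    rw [Set.indicator_of_notMem]
    intro h
    linarith [abs_le.2 (show -(n : ℝ) ≤ t ∧ t ≤ n from ⟨h.1, h.2⟩)]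
  have hlim : ∀ x, Filter.Tendsto (fun n => hilbertConv ε N (F n) x) Filter.atTop
      (nhds (hilbertConv ε N f x)) := by
    intro x
    have hk := (integrable_hilbertKernel hε hN).comp_sub_left x
    refine tendsto_integral_of_dominated_convergence
      (fun t => |hilbertKernel ε N (x - t)| * M) (fun n => ?_) (hk.abs.mul_const M) (fun n => ?_) ?_
    · have := hFm n
      exact Measurable.aestronglyMeasurable (by fun_prop)
    · refine Filter.Eventually.of_forall fun t => ?_
      rw [norm_mul, Real.norm_eq_abs, Real.norm_eq_abs]
      exact mul_le_mul_of_nonneg_left ((hFle n t).trans (hM t)) (abs_nonneg _)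
    · refine Filter.Eventually.of_forall fun t => ?_
      refine tendsto_const_nhds.congr' ?_
      obtain ⟨n₀, hn₀⟩ := exists_nat_ge |t|
      filter_upwards [Filter.eventually_ge_atTop n₀] with n hn
      have : |t| ≤ n := hn₀.trans (by exact_mod_cast hn)
      rw [hF]
      simp only
      rw [Set.indicator_of_mem (show t ∈ Set.Icc (-(n : ℝ)) n from abs_le.1 this)]
  calc ∫⁻ x, ‖hilbertConv ε N f x‖ₑ ^ p
      = ∫⁻ x, Filter.liminf (fun n => ‖hilbertConv ε N (F n) x‖ₑ ^ p) Filter.atTop := by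
        refine lintegral_congr fun x => ?_
        exact (((ENNReal.continuous_rpow_const).tendsto _).comp (hlim x).enorm).liminf_eq.symm
    _ ≤ Filter.liminf (fun n => ∫⁻ x, ‖hilbertConv ε N (F n) x‖ₑ ^ p) Filter.atTop :=
        lintegral_liminf_le fun n => (measurable_hilbertConv (hFm n)).enorm.pow_const p
    _ ≤ C * ∫⁻ t, ‖f t‖ₑ ^ p := by
        refine Filter.liminf_le_of_le (by isBoundedDefault) fun b hb => ?_
        obtain ⟨n, hn⟩ := hb.exists
        refine hn.trans ((hC ε N hε hN (F n) (hFm n) ⟨M, fun t => (hFle n t).trans (hM t)⟩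
          ⟨n, hFS n⟩).trans ?_)
        refine mul_le_mul' le_rfl (lintegral_mono fun t => ENNReal.rpow_le_rpow ?_ hp0.le)
        rw [enorm_le_iff_norm_le]
        exact hFle n t

section Directional

variable {E : Type*} [NormedAddCommGroup E] [InnerProductSpace ℝ E] [FiniteDimensional ℝ E]
  [MeasurableSpace E] [BorelSpace E]

/-- Truncated Hilbert transform in the direction `θ`. -/
noncomputable def dirHilbert (ε N : ℝ) (θ : E) (g : E → ℝ) (x : E) : ℝ :=
  ∫ s, hilbertKernel ε N s * g (x - s • θ)

lemma exists_lintegral_eq_line {θ : E} (hθ : θ ≠ 0) :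
    ∃ (W : Submodule ℝ E) (c : ℝ≥0∞), ∀ F : E → ℝ≥0∞, Measurable F →
      ∫⁻ x, F x = c * ∫⁻ w : W, ∫⁻ t : ℝ, F (t • θ + w) := by
  obtain ⟨W, hW⟩ := Submodule.exists_isCompl (Submodule.span ℝ {θ})
  set A₀ : (ℝ × W) ≃ₗ[ℝ] E :=
    ((LinearEquiv.toSpanNonzeroSingleton ℝ E θ hθ).prodCongr (LinearEquiv.refl ℝ W)).trans
      (Submodule.prodEquivOfIsCompl _ W hW) with hA₀
  set A : (ℝ × W) ≃L[ℝ] E := A₀.toContinuousLinearEquiv with hA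
  have hAv : ∀ t : ℝ, ∀ w : W, A (t, w) = t • θ + w := by
    intro t w
    simp [hA, hA₀]
  have hvol : (volume : Measure (ℝ × W)).IsAddHaarMeasure := by
    rw [Measure.volume_eq_prod]; infer_instance
  have : (Measure.map A (volume : Measure (ℝ × W))).IsAddHaarMeasure :=
    A.isAddHaarMeasure_map volume
  refine ⟨W, Measure.addHaarScalarFactor (volume : Measure E)
      (Measure.map A (volume : Measure (ℝ × W))),
    fun F hF => ?_⟩
  have hmap : Measurable A := A.continuous.measurable
  conv_lhs => rw [Measure.isAddLeftInvariant_eq_smul (volume : Measure E)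
      (Measure.map A (volume : Measure (ℝ × W)))]
  rw [ENNReal.smul_def, lintegral_smul_measure, smul_eq_mul, lintegral_map hF hmap]
  refine congrArg _ ?_
  rw [Measure.volume_eq_prod, lintegral_prod_symm (fun a => F (A a)) (hF.comp hmap).aemeasurable]
  simp only [hAv]

lemma measurable_dirHilbert_uncurry {ε N : ℝ} {g : E → ℝ} (hg : Measurable g) :
    Measurable fun z : E × E => dirHilbert ε N z.1 g z.2 := by
  refine StronglyMeasurable.measurable ?_
  refine StronglyMeasurable.integral_prod_right
    (f := fun (z : E × E) s => hilbertKernel ε N s * g (z.2 - s • z.1)) ?_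
  exact Measurable.stronglyMeasurable (by fun_prop)

lemma lintegral_dirHilbert_le {p : ℝ} (hp : 1 < p) : ∃ C : NNReal,
    ∀ ε N : ℝ, 0 < ε → 0 < N → ∀ (θ : E) (g : E → ℝ), Measurable g → (∃ M, ∀ x, |g x| ≤ M) →
      ∫⁻ x, ‖dirHilbert ε N θ g x‖ₑ ^ p ≤ C * ∫⁻ x, ‖g x‖ₑ ^ p := by
  obtain ⟨C, hC⟩ := lintegral_hilbertConv_le hp
  have hp0 : 0 < p := by linarith
  refine ⟨C, ?_⟩
  rintro ε N hε hN θ g hg ⟨M, hM⟩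
  by_cases hθ : θ = 0
  · have : ∀ x, dirHilbert ε N θ g x = 0 := by
      intro x
      apply integral_eq_zero_of_odd
      intro s
      simp [hθ, hilbertKernel_neg]
    simp [this, hp0]
  obtain ⟨W, c, hc⟩ := exists_lintegral_eq_line hθ
  have hmd : Measurable fun x => ‖dirHilbert ε N θ g x‖ₑ ^ p :=
    ((measurable_dirHilbert_uncurry hg).comp (measurable_const.prodMk
        measurable_id)).enorm.pow_const p
  rw [hc _ hmd, hc _ (hg.enorm.pow_const p), mul_left_comm]
  refine mul_le_mul' le_rfl ?_
  rw [← lintegral_const_mul]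
  · refine lintegral_mono fun w => ?_
    have := hC ε N hε hN (fun t => g (t • θ + w)) (by fun_prop) ⟨M, fun t => hM _⟩
    refine le_trans (le_of_eq ?_) this
    refine lintegral_congr fun t => ?_
    simp only [dirHilbert]
    congr 3
    funext s
    congr 2
    module
  · exact Measurable.lintegral_prod_right (f := fun (w : W) (t : ℝ) => ‖g (t • θ + w)‖ₑ ^ p)
      ((hg.comp (by fun_prop : Measurable fun z : W × ℝ => z.2 • θ + (z.1 : E))).enorm.pow_const p)

end Directional

/-- `i` times the Fourier transform of `hilbertKernel ε N`. -/
noncomputable def hilbertSymbol (ε N τ : ℝ) : ℝ :=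
  if 0 ≤ τ then Real.exp (-(2 * Real.pi * ε) * τ) - Real.exp (-(2 * Real.pi * N) * τ)
  else -(Real.exp (2 * Real.pi * ε * τ) - Real.exp (2 * Real.pi * N * τ))

lemma hilbertSymbol_of_nonneg {ε N τ : ℝ} (h : 0 ≤ τ) : hilbertSymbol ε N τ =
    Real.exp (-(2 * Real.pi * ε) * τ) - Real.exp (-(2 * Real.pi * N) * τ) := if_pos h

lemma hilbertSymbol_of_nonpos {ε N τ : ℝ} (h : τ ≤ 0) : hilbertSymbol ε N τ =
    -(Real.exp (2 * Real.pi * ε * τ) - Real.exp (2 * Real.pi * N * τ)) := by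
  rcases h.lt_or_eq with h | rfl
  · exact if_neg (not_le.2 h)
  · simp [hilbertSymbol]

lemma hilbertSymbol_neg (ε N τ : ℝ) : hilbertSymbol ε N (-τ) = -hilbertSymbol ε N τ := by
  rcases le_total 0 τ with h | h
  · rw [hilbertSymbol_of_nonneg h, hilbertSymbol_of_nonpos (by linarith)]
    simp
  · rw [hilbertSymbol_of_nonpos h, hilbertSymbol_of_nonneg (by linarith)]
    simp

lemma continuous_hilbertSymbol (ε N : ℝ) : Continuous (hilbertSymbol ε N) := by
  unfold hilbertSymbol
  refine Continuous.if_le (by fun_prop) (by fun_prop) continuous_const continuous_id ?_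
  rintro x rfl
  simp

lemma abs_hilbertSymbol_le {ε N : ℝ} (hε : 0 < ε) (hN : 0 < N) (τ : ℝ) :
    |hilbertSymbol ε N τ| ≤ 1 := by
  have key : ∀ t : ℝ, 0 ≤ t → |hilbertSymbol ε N t| ≤ 1 := by
    intro t ht
    rw [hilbertSymbol_of_nonneg ht]
    have h1 : ∀ a : ℝ, 0 < a → 0 < Real.exp (-(2 * Real.pi * a) * t) ∧
        Real.exp (-(2 * Real.pi * a) * t) ≤ 1 := fun a ha =>
      ⟨Real.exp_pos _, Real.exp_le_one_iff.2 (by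
        have : 0 ≤ 2 * Real.pi * a * t := by have := Real.pi_pos; positivity
        linarith)⟩
    have h2 := h1 ε hε
    have h3 := h1 N hN
    rw [abs_le]
    constructor <;> linarith [h2.1, h2.2, h3.1, h3.2]
  rcases le_total 0 τ with h | h
  · exact key τ h
  · rw [← abs_neg, ← hilbertSymbol_neg]
    exact key _ (by linarith)

lemma fourier_hilbertKernel {ε N : ℝ} (hε : 0 < ε) (hN : 0 < N) :
    𝓕 (fun s => (hilbertKernel ε N s : ℂ)) = fun τ => -Complex.I * hilbertSymbol ε N τ := by
  have hpi := Real.pi_pos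
  set m : ℝ → ℂ := fun τ => -Complex.I * hilbertSymbol ε N τ with hm
  have hmc : Continuous m :=
    continuous_const.mul (Complex.continuous_ofReal.comp (continuous_hilbertSymbol ε N))
  have hpos : ∀ s : ℝ, Set.EqOn
      (fun τ : ℝ => Complex.exp ((2 * Real.pi * (τ * s) : ℝ) * Complex.I) • m τ)
      (fun τ : ℝ => -Complex.I * (Complex.exp ((2 * Real.pi * (s * Complex.I - ε)) * τ)
        - Complex.exp ((2 * Real.pi * (s * Complex.I - N)) * τ))) (Set.Ioi 0) := by
    intro s τ hτ
    simp only [hm, smul_eq_mul]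
    rw [hilbertSymbol_of_nonneg (le_of_lt hτ)]
    push_cast
    rw [mul_left_comm, mul_sub (Complex.exp _), ← Complex.exp_add, ← Complex.exp_add]
    congr 3 <;> ring_nf
  have hneg : ∀ s : ℝ, Set.EqOn
      (fun τ : ℝ => Complex.exp ((2 * Real.pi * (τ * s) : ℝ) * Complex.I) • m τ)
      (fun τ : ℝ => Complex.I * (Complex.exp ((2 * Real.pi * (s * Complex.I + ε)) * τ)
        - Complex.exp ((2 * Real.pi * (s * Complex.I + N)) * τ))) (Set.Iic 0) := by
    intro s τ hτ
    simp only [hm, smul_eq_mul]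
    rw [hilbertSymbol_of_nonpos hτ]
    push_cast
    rw [mul_neg, neg_mul, neg_neg, mul_left_comm, mul_sub (Complex.exp _), ← Complex.exp_add,
        ← Complex.exp_add]
    congr 3 <;> ring_nf
  have hre1 : ∀ s a : ℝ, 0 < a → (2 * Real.pi * (s * Complex.I - a) : ℂ).re < 0 := by
    intro s a ha
    have : (2 * Real.pi * (s * Complex.I - a) : ℂ) =
        ((2 * Real.pi : ℝ) : ℂ) * (s * Complex.I - a) := by
      push_cast; ring
    rw [this, Complex.re_ofReal_mul]
    simp
    positivity
  have hre2 : ∀ s a : ℝ, 0 < a → 0 < (2 * Real.pi * (s * Complex.I + a) : ℂ).re := by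
    intro s a ha
    have : (2 * Real.pi * (s * Complex.I + a) : ℂ) =
        ((2 * Real.pi : ℝ) : ℂ) * (s * Complex.I + a) := by
      push_cast; ring
    rw [this, Complex.re_ofReal_mul]
    simp
    positivity
  have hi1 : ∀ s : ℝ, IntegrableOn (fun τ : ℝ => Complex.exp ((2 * Real.pi * (τ * s) : ℝ) *
      Complex.I) • m τ) (Set.Ioi 0) := by
    intro s
    rw [integrableOn_congr_fun (hpos s) measurableSet_Ioi]
    exact ((integrableOn_exp_mul_complex_Ioi (hre1 s ε hε) 0).sub
      (integrableOn_exp_mul_complex_Ioi (hre1 s N hN) 0)).const_mul _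
  have hi2 : ∀ s : ℝ, IntegrableOn (fun τ : ℝ => Complex.exp ((2 * Real.pi * (τ * s) : ℝ) *
      Complex.I) • m τ) (Set.Iic 0) := by
    intro s
    rw [integrableOn_congr_fun (hneg s) measurableSet_Iic]
    exact ((integrableOn_exp_mul_complex_Iic (hre2 s ε hε) 0).sub
      (integrableOn_exp_mul_complex_Iic (hre2 s N hN) 0)).const_mul _
  have hmi : Integrable m := by
    rw [← integrableOn_univ, ← Set.Iic_union_Ioi (a := (0 : ℝ))]
    simpa using (hi2 0).union (hi1 0)
  have hinv : 𝓕⁻ m = fun s => (hilbertKernel ε N s : ℂ) := by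
    funext s
    rw [Real.fourierInv_eq']
    have : ∀ v : ℝ, ⟪v, s⟫ = v * s := fun v => by simp [mul_comm]
    simp only [this]
    rw [← intervalIntegral.integral_Iic_add_Ioi (hi2 s) (hi1 s),
      setIntegral_congr_fun measurableSet_Iic (hneg s),
      setIntegral_congr_fun measurableSet_Ioi (hpos s), integral_const_mul, integral_const_mul,
      integral_sub (integrableOn_exp_mul_complex_Ioi (hre1 s ε hε) 0)
        (integrableOn_exp_mul_complex_Ioi (hre1 s N hN) 0),
      integral_sub (integrableOn_exp_mul_complex_Iic (hre2 s ε hε) 0)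
        (integrableOn_exp_mul_complex_Iic (hre2 s N hN) 0),
      integral_exp_mul_complex_Ioi (hre1 s ε hε), integral_exp_mul_complex_Ioi (hre1 s N hN),
      integral_exp_mul_complex_Iic (hre2 s ε hε), integral_exp_mul_complex_Iic (hre2 s N hN)]
    have hne : ∀ a : ℝ, 0 < a → ((s : ℂ) * Complex.I - a ≠ 0) ∧ ((s : ℂ) * Complex.I + a ≠ 0) ∧
        ((s : ℂ) ^ 2 + a ^ 2 ≠ 0) := by
      intro a ha
      refine ⟨fun h => ?_, fun h => ?_, ?_⟩
      · have := congrArg Complex.re h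
        simp at this
        linarith
      · have := congrArg Complex.re h
        simp at this
        linarith
      · exact_mod_cast (by positivity : s ^ 2 + a ^ 2 ≠ 0)
    have hfrac : ∀ a : ℝ, 0 < a → Complex.I * (1 / (2 * Real.pi * (s * Complex.I + a)))
        + Complex.I * (1 / (2 * Real.pi * (s * Complex.I - a)))
          = (Real.pi : ℂ)⁻¹ * (s / (s ^ 2 + a ^ 2)) := by
      intro a ha
      obtain ⟨h1, h2, h3⟩ := hne a ha
      rw [mul_comm (s : ℂ)] at h1 h2
      have hpi' : (Real.pi : ℂ) ≠ 0 := by exact_mod_cast hpi.ne'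
      field_simp
      linear_combination (2 * s * a ^ 2 : ℂ) * Complex.I_sq
    simp only [hilbertKernel, conjPoisson]
    push_cast
    rw [← hfrac ε hε, ← hfrac N hN]
    simp only [mul_zero, Complex.exp_zero]
    ring
  have hmF : Integrable (𝓕 m) := by
    have h1 : 𝓕 m = fun s => (hilbertKernel ε N (-s) : ℂ) := by
      funext s
      rw [← neg_neg s, ← Real.fourierInv_eq_fourier_neg, hinv, neg_neg]
    rw [h1]
    exact (integrable_hilbertKernel hε hN).comp_neg.ofReal
  rw [← hinv]
  exact hmc.fourier_fourierInv_eq hmi hmF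

lemma tendsto_hilbertSymbol (τ : ℝ) :
    Filter.Tendsto (fun n : ℕ => hilbertSymbol ((n : ℝ) + 1)⁻¹ ((n : ℝ) + 1) τ) Filter.atTop
      (nhds (SignType.sign τ : ℝ)) := by
  have hpi := Real.pi_pos
  have key : ∀ t : ℝ, 0 < t →
      Filter.Tendsto (fun n : ℕ => hilbertSymbol ((n : ℝ) + 1)⁻¹ ((n : ℝ) + 1) t) Filter.atTop
      (nhds 1) := by
    intro t ht
    simp only [hilbertSymbol_of_nonneg ht.le]
    have hn : Filter.Tendsto (fun n : ℕ => (n : ℝ) + 1) Filter.atTop Filter.atTop :=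
      Filter.tendsto_atTop_add_const_right _ _ tendsto_natCast_atTop_atTop
    have h1 : Filter.Tendsto (fun n : ℕ => Real.exp (-(2 * Real.pi * ((n : ℝ) + 1)⁻¹) * t))
        Filter.atTop (nhds 1) := by
      have := ((((tendsto_inv_atTop_zero.comp hn).const_mul (2 * Real.pi)).neg).mul_const t)
      simp only [mul_zero, neg_zero, zero_mul] at this
      simpa [Function.comp_def] using (Real.continuous_exp.tendsto _).comp this
    have h2 : Filter.Tendsto (fun n : ℕ => Real.exp (-(2 * Real.pi * ((n : ℝ) + 1)) * t))
        Filter.atTop (nhds 0) := by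
      refine Real.tendsto_exp_neg_atTop_nhds_zero.comp
        ((hn.const_mul_atTop (show 0 < 2 * Real.pi * t by positivity))) |>.congr fun n => ?_
      simp only [Function.comp]
      congr 1
      ring
    simpa using h1.sub h2
  rcases lt_trichotomy τ 0 with h | rfl | h
  · have := (key (-τ) (by linarith)).neg
    simp only [hilbertSymbol_neg, neg_neg] at this
    simpa [h] using this
  · simp [hilbertSymbol]
  · simpa [h] using key τ h

section Inner

variable {E : Type*} [NormedAddCommGroup E] [InnerProductSpace ℝ E]

lemma abs_dirHilbert_le {ε N : ℝ} (hε : 0 < ε) (hN : 0 < N) {g : E → ℝ} {M : ℝ}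
    (hM : ∀ x, |g x| ≤ M) (θ x : E) :
    |dirHilbert ε N θ g x| ≤ (∫ s, |hilbertKernel ε N s|) * M := by
  have hk := (integrable_hilbertKernel hε hN).abs
  rw [← Real.norm_eq_abs]
  refine (norm_integral_le_of_norm_le (hk.mul_const M) (Filter.Eventually.of_forall fun t =>
      ?_)).trans
    (le_of_eq ?_)
  · rw [norm_mul, Real.norm_eq_abs, Real.norm_eq_abs]
    exact mul_le_mul_of_nonneg_left (hM _) (abs_nonneg _)
  · rw [integral_mul_const]

lemma abs_inner_le_norm_of_mem_ball {θ : E} (hθ : θ ∈ Metric.ball (0 : E) 1) (v : E) :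
    |⟪θ, v⟫| ≤ ‖v‖ := by
  refine (abs_real_inner_le_norm θ v).trans ?_
  rw [mem_ball_zero_iff] at hθ
  exact mul_le_of_le_one_left (norm_nonneg _) hθ.le

end Inner

section RieszTrunc

variable {E : Type*} [NormedAddCommGroup E] [InnerProductSpace ℝ E] [FiniteDimensional ℝ E]
  [MeasurableSpace E] [BorelSpace E]

/-- Truncated Riesz transform in the direction `v`, up to a constant factor, as an average of
directional truncated Hilbert transforms. -/
noncomputable def rieszTrunc (ε N : ℝ) (v : E) (g : E → ℝ) (x : E) : ℝ :=
  ∫ θ in Metric.ball (0 : E) 1, ⟪θ, v⟫ * dirHilbert ε N θ g x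

/-- `i` times the Fourier multiplier of `rieszTrunc ε N v`. -/
noncomputable def rieszSymbol (ε N : ℝ) (v ξ : E) : ℝ :=
  ∫ θ in Metric.ball (0 : E) 1, ⟪θ, v⟫ * hilbertSymbol ε N ⟪θ, ξ⟫

lemma measurable_rieszTrunc {ε N : ℝ} {v : E} {g : E → ℝ} (hg : Measurable g) :
    Measurable (rieszTrunc ε N v g) := by
  refine StronglyMeasurable.measurable ?_
  refine StronglyMeasurable.integral_prod_right
    (f := fun x θ => ⟪θ, v⟫ * dirHilbert ε N θ g x) ?_
  refine Measurable.stronglyMeasurable (Measurable.mul (by fun_prop) ?_)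
  exact (measurable_dirHilbert_uncurry hg).comp measurable_swap

lemma exists_abs_rieszTrunc_le {ε N : ℝ} (hε : 0 < ε) (hN : 0 < N) (v : E) {g : E → ℝ}
    (hM : ∃ M, ∀ x, |g x| ≤ M) : ∃ M, ∀ x, |rieszTrunc ε N v g x| ≤ M := by
  obtain ⟨M, hM⟩ := hM
  refine ⟨‖v‖ * ((∫ s, |hilbertKernel ε N s|) * M) * volume.real (Metric.ball (0 : E) 1),
      fun x => ?_⟩
  rw [← Real.norm_eq_abs]
  refine norm_setIntegral_le_of_norm_le_const measure_ball_lt_top fun θ hθ => ?_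
  rw [norm_mul]
  exact mul_le_mul (abs_inner_le_norm_of_mem_ball hθ v) (abs_dirHilbert_le hε hN hM θ x)
    (norm_nonneg _) (norm_nonneg _)

lemma lintegral_rieszTrunc_le {p : ℝ} (hp : 1 < p) : ∃ C : NNReal,
    ∀ ε N : ℝ, 0 < ε → 0 < N → ∀ (v : E) (g : E → ℝ), ‖v‖ ≤ 1 → Measurable g →
      (∃ M, ∀ x, |g x| ≤ M) →
      ∫⁻ x, ‖rieszTrunc ε N v g x‖ₑ ^ p ≤ C * ∫⁻ x, ‖g x‖ₑ ^ p := by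
  obtain ⟨C, hC⟩ := lintegral_dirHilbert_le (E := E) hp
  have hp0 : 0 < p := by linarith
  set B := volume (Metric.ball (0 : E) 1)
  have hB : B ≠ ∞ := measure_ball_lt_top.ne
  have hC' : B ^ (p - 1) * (B * C) ≠ ∞ :=
    ENNReal.mul_ne_top (ENNReal.rpow_ne_top_of_nonneg (by linarith) hB)
      (ENNReal.mul_ne_top hB ENNReal.coe_ne_top)
  refine ⟨(B ^ (p - 1) * (B * C)).toNNReal, fun ε N hε hN v g hv hg hgM => ?_⟩
  rw [ENNReal.coe_toNNReal hC']
  have hm := measurable_dirHilbert_uncurry (ε := ε) (N := N) hg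
  have hmθ : ∀ x, Measurable fun θ => ‖dirHilbert ε N θ g x‖ₑ := fun x =>
    (hm.comp (measurable_id.prodMk measurable_const)).enorm
  calc ∫⁻ x, ‖rieszTrunc ε N v g x‖ₑ ^ p
      ≤ ∫⁻ x, B ^ (p - 1) * ∫⁻ θ in Metric.ball (0 : E) 1, ‖dirHilbert ε N θ g x‖ₑ ^ p := by
        refine lintegral_mono fun x => ?_
        have h1 : ‖rieszTrunc ε N v g x‖ₑ ≤
            ∫⁻ θ in Metric.ball (0 : E) 1, ‖dirHilbert ε N θ g x‖ₑ := by
          refine (enorm_integral_le_lintegral_enorm _).trans ?_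
          refine setLIntegral_mono' measurableSet_ball fun θ hθ => ?_
          rw [enorm_mul]
          refine mul_le_of_le_one_left' ?_
          rw [← enorm_one (G := ℝ), enorm_le_iff_norm_le, norm_one]
          exact (abs_inner_le_norm_of_mem_ball hθ v).trans hv
        refine (ENNReal.rpow_le_rpow h1 hp0.le).trans ?_
        refine (lintegral_rpow_le_rpow_mul_lintegral _ hp (hmθ x).aemeasurable).trans_eq ?_
        rw [Measure.restrict_apply_univ]
    _ = B ^ (p - 1) * ∫⁻ θ in Metric.ball (0 : E) 1, ∫⁻ x, ‖dirHilbert ε N θ g x‖ₑ ^ p := by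
        rw [lintegral_const_mul' _ _ (ENNReal.rpow_ne_top_of_nonneg (by linarith) hB),
          lintegral_lintegral_swap]
        exact ((hm.comp measurable_swap).enorm.pow_const p).aemeasurable
    _ ≤ B ^ (p - 1) * ∫⁻ θ in Metric.ball (0 : E) 1, C * ∫⁻ x, ‖g x‖ₑ ^ p := by
        gcongr with θ
        exact hC ε N hε hN θ g hg hgM
    _ = _ := by
        rw [lintegral_const, Measure.restrict_apply_univ]
        ring

lemma ofReal_dirHilbert_eq {ε N : ℝ} (hε : 0 < ε) (hN : 0 < N) (θ : E) {g : E → ℝ} {F : E → ℂ}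
    (hF : Integrable F) (hg : ∀ x, (g x : ℂ) = 𝓕⁻ F x) (x : E) :
    (dirHilbert ε N θ g x : ℂ)
      = 𝓕⁻ (fun ξ => -Complex.I * hilbertSymbol ε N ⟪θ, ξ⟫ * F ξ) x := by
  have h_int : Integrable (Function.uncurry fun (s : ℝ) (ξ : E) =>
      ((𝐞 ⟪ξ, x - s • θ⟫ : Circle) : ℂ) * ((hilbertKernel ε N s : ℂ) * F ξ))
      (volume.prod volume) := by
    refine Integrable.bdd_mul (c := 1)
      ((integrable_hilbertKernel hε hN).ofReal.mul_prod hF) ?_ ?_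
    · refine Continuous.aestronglyMeasurable ?_
      have := Real.continuous_fourierChar
      fun_prop
    · exact Filter.Eventually.of_forall fun z => (Circle.norm_coe _).le
  have hk := fun τ => congrFun (fourier_hilbertKernel hε hN) τ
  rw [dirHilbert, ← integral_complex_ofReal, Real.fourierInv_eq]
  calc ∫ s, ((hilbertKernel ε N s * g (x - s • θ) : ℝ) : ℂ)
      = ∫ s, ∫ ξ : E, ((𝐞 ⟪ξ, x - s • θ⟫ : Circle) : ℂ) * ((hilbertKernel ε N s : ℂ) * F ξ) := by
        congr 1
        funext s
        push_cast
        rw [hg, Real.fourierInv_eq, ← integral_const_mul]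
        congr 1
        funext ξ
        rw [Circle.smul_def, smul_eq_mul]
        ring
    _ = ∫ ξ : E, ∫ s, ((𝐞 ⟪ξ, x - s • θ⟫ : Circle) : ℂ) * ((hilbertKernel ε N s : ℂ) * F ξ) :=
        integral_integral_swap h_int
    _ = _ := by
        congr 1
        funext ξ
        rw [← hk, Real.fourier_real_eq, Circle.smul_def, smul_eq_mul, ← integral_mul_const,
          ← integral_const_mul]
        congr 1
        funext s
        rw [inner_sub_right, inner_smul_right, sub_eq_add_neg, AddChar.map_add_eq_mul,
          real_inner_comm θ ξ, Circle.smul_def, smul_eq_mul, Circle.coe_mul]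
        ring

lemma continuous_rieszSymbol (ε N : ℝ) (hε : 0 < ε) (hN : 0 < N) (v : E) :
    Continuous (rieszSymbol ε N v) := by
  have hc := continuous_hilbertSymbol ε N
  have := isFiniteMeasure_restrict.2 (measure_ball_lt_top (μ := volume) (x := (0 : E)) (r := 1)).ne
  refine continuous_of_dominated (bound := fun _ => ‖v‖) (fun ξ => ?_) (fun ξ => ?_) ?_ ?_
  · exact Continuous.aestronglyMeasurable (by fun_prop)
  · refine (ae_restrict_iff' measurableSet_ball).2 (Filter.Eventually.of_forall fun θ hθ => ?_)
    rw [norm_mul]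
    calc _ ≤ ‖v‖ * 1 := mul_le_mul (abs_inner_le_norm_of_mem_ball hθ v)
          (abs_hilbertSymbol_le hε hN _) (abs_nonneg _) (norm_nonneg _)
      _ = _ := mul_one _
  · exact integrable_const _
  · exact Filter.Eventually.of_forall fun θ => by fun_prop

lemma abs_rieszSymbol_le {ε N : ℝ} (hε : 0 < ε) (hN : 0 < N) (v ξ : E) :
    |rieszSymbol ε N v ξ| ≤ ‖v‖ * volume.real (Metric.ball (0 : E) 1) := by
  rw [← Real.norm_eq_abs]
  refine norm_setIntegral_le_of_norm_le_const measure_ball_lt_top fun θ hθ => ?_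
  rw [norm_mul]
  calc _ ≤ ‖v‖ * 1 := mul_le_mul (abs_inner_le_norm_of_mem_ball hθ v)
        (abs_hilbertSymbol_le hε hN _) (abs_nonneg _) (norm_nonneg _)
    _ = _ := mul_one _

lemma ofReal_rieszTrunc_eq {ε N : ℝ} (hε : 0 < ε) (hN : 0 < N) (v : E) {g : E → ℝ} {F : E → ℂ}
    (hF : Integrable F) (hg : ∀ x, (g x : ℂ) = 𝓕⁻ F x) (x : E) :
    (rieszTrunc ε N v g x : ℂ)
      = 𝓕⁻ (fun ξ => -Complex.I * rieszSymbol ε N v ξ * F ξ) x := by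
  have hc := continuous_hilbertSymbol ε N
  have := Real.continuous_fourierChar
  have := isFiniteMeasure_restrict.2 (measure_ball_lt_top (μ := volume) (x := (0 : E)) (r := 1)).ne
  have h_int : Integrable (Function.uncurry fun (θ ξ : E) =>
      ((⟪θ, v⟫ : ℂ) * ((𝐞 ⟪ξ, x⟫ : Circle) : ℂ) * (-Complex.I * hilbertSymbol ε N ⟪θ, ξ⟫)) * F ξ)
      ((volume.restrict (Metric.ball (0 : E) 1)).prod volume) := by
    refine Integrable.bdd_mul (c := ‖v‖) (hF.comp_snd _) ?_ ?_
    · exact Continuous.aestronglyMeasurable (by fun_prop)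
    · have h1 : ∀ᵐ z ∂((volume.restrict (Metric.ball (0 : E) 1)).prod (volume : Measure E)),
          z.1 ∈ Metric.ball (0 : E) 1 :=
        Measure.quasiMeasurePreserving_fst.ae (ae_restrict_mem measurableSet_ball)
      filter_upwards [h1] with z hz
      simp only [norm_mul, Circle.norm_coe, mul_one, norm_neg, Complex.norm_I, one_mul,
        Complex.norm_real]
      calc _ ≤ ‖v‖ * 1 := mul_le_mul (abs_inner_le_norm_of_mem_ball hz v)
            (abs_hilbertSymbol_le hε hN _) (abs_nonneg _) (norm_nonneg _)
        _ = _ := mul_one _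
  rw [rieszTrunc, ← integral_complex_ofReal, Real.fourierInv_eq]
  calc ∫ θ in Metric.ball (0 : E) 1, ((⟪θ, v⟫ * dirHilbert ε N θ g x : ℝ) : ℂ)
      = ∫ θ in Metric.ball (0 : E) 1, ∫ ξ : E, ((⟪θ, v⟫ : ℂ) * ((𝐞 ⟪ξ, x⟫ : Circle) : ℂ) *
          (-Complex.I * hilbertSymbol ε N ⟪θ, ξ⟫)) * F ξ := by
        congr 1
        funext θ
        push_cast
        rw [ofReal_dirHilbert_eq hε hN θ hF hg, Real.fourierInv_eq, ← integral_const_mul]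
        congr 1
        funext ξ
        rw [Circle.smul_def, smul_eq_mul]
        ring
    _ = ∫ ξ : E, ∫ θ in Metric.ball (0 : E) 1, ((⟪θ, v⟫ : ℂ) * ((𝐞 ⟪ξ, x⟫ : Circle) : ℂ) *
          (-Complex.I * hilbertSymbol ε N ⟪θ, ξ⟫)) * F ξ := integral_integral_swap h_int
    _ = _ := by
        congr 1
        funext ξ
        rw [Circle.smul_def, smul_eq_mul, rieszSymbol, ← integral_complex_ofReal,
            ← integral_const_mul,
          ← integral_mul_const, ← integral_const_mul]
        congr 1
        funext θ
        push_cast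
        ring

end RieszTrunc

section RieszSymbol

variable {E : Type*} [NormedAddCommGroup E] [InnerProductSpace ℝ E] [FiniteDimensional ℝ E]
  [MeasurableSpace E] [BorelSpace E]

lemma setIntegral_ball_comp_linearIsometryEquiv (σ : E ≃ₗᵢ[ℝ] E) (f : E → ℝ) :
    ∫ θ in Metric.ball (0 : E) 1, f (σ θ) = ∫ θ in Metric.ball (0 : E) 1, f θ := by
  have := σ.measurePreserving.setIntegral_preimage_emb
    σ.toHomeomorph.measurableEmbedding f (Metric.ball (0 : E) 1)
  rw [← this]
  congr 2
  ext θ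
  simp

lemma integrableOn_ball_of_continuous {f : E → ℝ} (hf : Continuous f) :
    IntegrableOn f (Metric.ball (0 : E) 1) :=
  (hf.continuousOn.integrableOn_compact (isCompact_closedBall 0 1)).mono_set
    Metric.ball_subset_closedBall

lemma integrableOn_inner_mul_sign (v ξ : E) :
    IntegrableOn (fun θ => ⟪θ, v⟫ * ((SignType.sign ⟪θ, ξ⟫ : SignType) : ℝ))
      (Metric.ball (0 : E) 1) := by
  have hm : Measurable fun θ : E => ((SignType.sign ⟪θ, ξ⟫ : SignType) : ℝ) := by
    have h1 : Measurable fun θ : E => ⟪θ, ξ⟫ := by fun_prop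
    refine measurable_of_tendsto_metrizable
      (f := fun (n : ℕ) (θ : E) => hilbertSymbol ((n : ℝ) + 1)⁻¹ ((n : ℝ) + 1) ⟪θ, ξ⟫)
      (fun n => ?_) ?_
    · exact (continuous_hilbertSymbol _ _).measurable.comp h1
    · exact tendsto_pi_nhds.2 fun θ => tendsto_hilbertSymbol _
  refine Integrable.mul_bdd (c := 1) (integrableOn_ball_of_continuous (by fun_prop))
    hm.aestronglyMeasurable (Filter.Eventually.of_forall fun θ => ?_)
  rcases lt_trichotomy ⟪θ, ξ⟫ 0 with h | h | h <;> simp [h]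

lemma setIntegral_abs_inner_eq {ξ e : E} (he : ‖e‖ = 1) :
    ∫ θ in Metric.ball (0 : E) 1, |⟪θ, ξ⟫| = ‖ξ‖ * ∫ θ in Metric.ball (0 : E) 1, |⟪θ, e⟫| := by
  have hn : ‖ξ‖ = ‖‖ξ‖ • e‖ := by rw [norm_smul, he, norm_norm, mul_one]
  set σ := Submodule.reflection (Submodule.span ℝ {ξ - ‖ξ‖ • e})ᗮ with hσ
  have h1 : σ ξ = ‖ξ‖ • e := Submodule.reflection_sub hn
  have h2 := setIntegral_ball_comp_linearIsometryEquiv σ (fun θ => |⟪θ, ‖ξ‖ • e⟫|)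
  simp only [← h1, σ.inner_map_map] at h2
  rw [h2, h1, ← integral_const_mul]
  simp only [inner_smul_right, abs_mul, abs_norm]

lemma setIntegral_inner_mul_sign {e : E} (he : ‖e‖ = 1) (v : E) {ξ : E} (hξ : ξ ≠ 0) :
    ∫ θ in Metric.ball (0 : E) 1, ⟪θ, v⟫ * ((SignType.sign ⟪θ, ξ⟫ : SignType) : ℝ)
      = (∫ θ in Metric.ball (0 : E) 1, |⟪θ, e⟫|) * (⟪v, ξ⟫ / ‖ξ‖) := by
  have hn : ‖ξ‖ ≠ 0 := norm_ne_zero_iff.2 hξ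
  set a := ⟪v, ξ⟫ / ‖ξ‖ ^ 2 with ha
  set w := v - a • ξ with hw
  have hwξ : ⟪w, ξ⟫ = 0 := by
    rw [hw, inner_sub_left, inner_smul_left, real_inner_self_eq_norm_sq, ha]
    simp
    field_simp
    simp
  have hv : v = a • ξ + w := by rw [hw]; module
  have h0 : ∫ θ in Metric.ball (0 : E) 1, ⟪θ, w⟫ * ((SignType.sign ⟪θ, ξ⟫ : SignType) : ℝ) = 0 := by
    set σ := Submodule.reflection (Submodule.span ℝ {ξ}) with hσ
    have h1 : σ ξ = ξ := Submodule.reflection_mem_subspace_eq_self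
        (Submodule.mem_span_singleton_self ξ)
    have h2 : σ w = -w := by
      apply Submodule.reflection_mem_subspace_orthogonalComplement_eq_neg
      rw [Submodule.mem_orthogonal_singleton_iff_inner_left]
      exact hwξ
    have h3 := setIntegral_ball_comp_linearIsometryEquiv σ
      (fun θ => ⟪θ, w⟫ * ((SignType.sign ⟪θ, ξ⟫ : SignType) : ℝ))
    have h4 : ∀ θ, ⟪σ θ, w⟫ = -⟪θ, w⟫ := by
      intro θ
      rw [← σ.inner_map_map θ w, h2, inner_neg_right, neg_neg]
    have h5 : ∀ θ, ⟪σ θ, ξ⟫ = ⟪θ, ξ⟫ := by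
      intro θ
      rw [← σ.inner_map_map θ ξ, h1]
    simp only [h4, h5, neg_mul, integral_neg] at h3
    linarith
  have h1 : ∀ θ : E, ⟪θ, ξ⟫ * ((SignType.sign ⟪θ, ξ⟫ : SignType) : ℝ) = |⟪θ, ξ⟫| := fun θ =>
    self_mul_sign _
  conv_lhs => rw [hv]
  simp only [inner_add_right, inner_smul_right, add_mul, mul_assoc]
  rw [integral_add ((integrableOn_inner_mul_sign ξ ξ).const_mul a)
      (integrableOn_inner_mul_sign w ξ),
    h0, integral_const_mul, add_zero]
  simp only [h1]
  rw [setIntegral_abs_inner_eq he, ha]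
  field_simp

lemma setIntegral_abs_inner_pos {e : E} (he : ‖e‖ = 1) :
    0 < ∫ θ in Metric.ball (0 : E) 1, |⟪θ, e⟫| := by
  have hc : Continuous fun θ : E => |⟪θ, e⟫| := by fun_prop
  rw [setIntegral_pos_iff_support_of_nonneg_ae (Filter.Eventually.of_forall fun _ => abs_nonneg _)
    (integrableOn_ball_of_continuous hc)]
  refine IsOpen.measure_pos _ (hc.isOpen_support.inter Metric.isOpen_ball) ⟨(1 / 2 : ℝ) • e, ?_, ?_⟩
  · rw [Function.mem_support, inner_smul_left, real_inner_self_eq_norm_sq, he]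
    norm_num
  · rw [mem_ball_zero_iff, norm_smul, he]
    norm_num

/-- The multipliers of the truncated Riesz transforms converge to those of the Riesz transforms. -/
lemma exists_tendsto_rieszSymbol : ∃ c : ℝ, 0 < c ∧ ∀ v ξ : E,
    Filter.Tendsto (fun n : ℕ => rieszSymbol ((n : ℝ) + 1)⁻¹ ((n : ℝ) + 1) v ξ) Filter.atTop
      (nhds (c * (⟪v, ξ⟫ / ‖ξ‖))) := by
  have hzero : ∀ (n : ℕ) (v : E), rieszSymbol ((n : ℝ) + 1)⁻¹ ((n : ℝ) + 1) v 0 = 0 := by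
    intro n v
    simp [rieszSymbol, hilbertSymbol]
  by_cases hE : ∃ e : E, ‖e‖ = 1
  swap
  · refine ⟨1, one_pos, fun v ξ => ?_⟩
    by_cases hξ : ξ = 0
    · simp [hξ, hzero]
    refine (hE ⟨‖ξ‖⁻¹ • ξ, ?_⟩).elim
    rw [norm_smul, norm_inv, norm_norm, inv_mul_cancel₀ (norm_ne_zero_iff.2 hξ)]
  obtain ⟨e, he⟩ := hE
  refine ⟨_, setIntegral_abs_inner_pos he, fun v ξ => ?_⟩
  by_cases hξ : ξ = 0
  · simp [hξ, hzero]
  rw [← setIntegral_inner_mul_sign he v hξ]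
  have := isFiniteMeasure_restrict.2 (measure_ball_lt_top (μ := volume) (x := (0 : E)) (r := 1)).ne
  refine tendsto_integral_of_dominated_convergence (fun _ => ‖v‖) (fun n => ?_)
    (integrable_const _) (fun n => ?_) ?_
  · have := continuous_hilbertSymbol ((n : ℝ) + 1)⁻¹ ((n : ℝ) + 1)
    exact Continuous.aestronglyMeasurable (by fun_prop)
  · refine (ae_restrict_iff' measurableSet_ball).2 (Filter.Eventually.of_forall fun θ hθ => ?_)
    rw [norm_mul]
    calc _ ≤ ‖v‖ * 1 := mul_le_mul (abs_inner_le_norm_of_mem_ball hθ v)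
          (abs_hilbertSymbol_le (by positivity) (by positivity) _) (abs_nonneg _) (norm_nonneg _)
      _ = _ := mul_one _
  · exact Filter.Eventually.of_forall fun θ => (tendsto_hilbertSymbol _).const_mul _

end RieszSymbol

section DirDeriv

variable {E F : Type*} [NormedAddCommGroup E] [NormedSpace ℝ E]
  [NormedAddCommGroup F] [NormedSpace ℝ F]

/-- The directional derivative of `f` along `a`, as a function. -/
noncomputable def dirDeriv (a : E) (f : E → F) : E → F := fun x => fderiv ℝ f x a

lemma ContDiff.dirDeriv {f : E → F} (hf : ContDiff ℝ (⊤ : ℕ∞) f) (a : E) :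
    ContDiff ℝ (⊤ : ℕ∞) (dirDeriv a f) :=
  (hf.fderiv_right (m := (⊤ : ℕ∞)) (by simp)).clm_apply contDiff_const

end DirDeriv

section RieszPairSymbol

variable {E : Type*} [NormedAddCommGroup E] [InnerProductSpace ℝ E]

/-- The symbol of the composition of two Riesz transforms, up to sign. -/
noncomputable def rieszPairSymbol (v w ξ : E) : ℝ := ⟪v, ξ⟫ * ⟪w, ξ⟫ / ‖ξ‖ ^ 2

lemma abs_rieszPairSymbol_le (v w ξ : E) : |rieszPairSymbol v w ξ| ≤ ‖v‖ * ‖w‖ := by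
  rw [rieszPairSymbol, abs_div, abs_mul, abs_of_nonneg (by positivity : 0 ≤ ‖ξ‖ ^ 2)]
  refine div_le_of_le_mul₀ (by positivity) (by positivity) ?_
  calc |⟪v, ξ⟫| * |⟪w, ξ⟫| ≤ (‖v‖ * ‖ξ‖) * (‖w‖ * ‖ξ‖) :=
        mul_le_mul (abs_real_inner_le_norm _ _) (abs_real_inner_le_norm _ _) (abs_nonneg _)
          (by positivity)
    _ = _ := by ring

end RieszPairSymbol

section RapidDecay

variable {E : Type*} [NormedAddCommGroup E] [InnerProductSpace ℝ E] [FiniteDimensional ℝ E]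
  [MeasurableSpace E] [BorelSpace E]

/-- Measurable functions all of whose moments are integrable. -/
structure RapidDecay (Ψ : E → ℂ) : Prop where
  aestronglyMeasurable : AEStronglyMeasurable Ψ
  integrable_pow_mul : ∀ n : ℕ, Integrable fun ξ => ‖ξ‖ ^ n * ‖Ψ ξ‖

lemma RapidDecay.integrable {Ψ : E → ℂ} (h : RapidDecay Ψ) : Integrable Ψ := by
  have := h.integrable_pow_mul 0
  simp only [pow_zero, one_mul] at this
  exact (integrable_norm_iff h.aestronglyMeasurable).1 this

lemma RapidDecay.bdd_mul {Ψ m : E → ℂ} (h : RapidDecay Ψ) (hm : Measurable m) {c : ℝ}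
    (hc : ∀ ξ, ‖m ξ‖ ≤ c) : RapidDecay fun ξ => m ξ * Ψ ξ := by
  refine ⟨hm.aestronglyMeasurable.mul h.aestronglyMeasurable, fun n => ?_⟩
  refine ((h.integrable_pow_mul n).const_mul c).mono' ?_ (Filter.Eventually.of_forall fun ξ => ?_)
  · exact (by fun_prop : AEStronglyMeasurable fun ξ : E => ‖ξ‖ ^ n).mul
      (hm.aestronglyMeasurable.mul h.aestronglyMeasurable).norm
  · rw [Real.norm_of_nonneg (by positivity), norm_mul]
    have := mul_le_mul_of_nonneg_right (hc ξ) (by positivity : 0 ≤ ‖ξ‖ ^ n * ‖Ψ ξ‖)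
    linarith

lemma RapidDecay.inner_mul {Ψ : E → ℂ} (h : RapidDecay Ψ) (a : E) :
    RapidDecay fun ξ => (2 * Real.pi * Complex.I * (⟪a, ξ⟫ : ℝ)) * Ψ ξ := by
  have hm : Continuous fun ξ : E => (2 * Real.pi * Complex.I * (⟪a, ξ⟫ : ℝ) : ℂ) := by fun_prop
  refine ⟨hm.aestronglyMeasurable.mul h.aestronglyMeasurable, fun n => ?_⟩
  refine ((h.integrable_pow_mul (n + 1)).const_mul (2 * Real.pi * ‖a‖)).mono' ?_
    (Filter.Eventually.of_forall fun ξ => ?_)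
  · exact (by fun_prop : AEStronglyMeasurable fun ξ : E => ‖ξ‖ ^ n).mul
      (hm.aestronglyMeasurable.mul h.aestronglyMeasurable).norm
  · rw [Real.norm_of_nonneg (by positivity)]
    simp only [norm_mul, Complex.norm_I, Complex.norm_real, Real.norm_eq_abs,
      abs_of_pos Real.pi_pos, Complex.norm_ofNat]
    have h1 := mul_le_mul_of_nonneg_right (abs_real_inner_le_norm a ξ)
      (by positivity : 0 ≤ 2 * Real.pi * ‖ξ‖ ^ n * ‖Ψ ξ‖)
    rw [pow_succ]
    nlinarith [h1]

lemma RapidDecay.comp_neg {Ψ : E → ℂ} (h : RapidDecay Ψ) : RapidDecay fun ξ => Ψ (-ξ) := by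
  refine ⟨h.aestronglyMeasurable.comp_quasiMeasurePreserving
    (Measure.measurePreserving_neg volume).quasiMeasurePreserving, fun n => ?_⟩
  simpa using (h.integrable_pow_mul n).comp_neg

lemma RapidDecay.contDiff_fourierInv {Ψ : E → ℂ} (h : RapidDecay Ψ) :
    ContDiff ℝ (⊤ : ℕ∞) (𝓕⁻ Ψ) := by
  rw [Real.fourierInv_eq_fourier_comp_neg]
  exact Real.contDiff_fourier fun n _ => h.comp_neg.integrable_pow_mul n

lemma RapidDecay.dirDeriv_fourierInv {Ψ : E → ℂ} (h : RapidDecay Ψ) (a : E) :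
    dirDeriv a (𝓕⁻ Ψ) = 𝓕⁻ (fun ξ => (2 * Real.pi * Complex.I * (⟪a, ξ⟫ : ℝ)) * Ψ ξ) := by
  have hn := h.comp_neg
  have h1 := hn.integrable_pow_mul 1
  simp only [pow_one] at h1
  funext x
  rw [dirDeriv, Real.fourierInv_eq_fourier_comp_neg,
    (Real.hasFDerivAt_fourier hn.integrable h1 x).fderiv, Real.fourierInv_eq_fourier_comp_neg]
  have h_int : Integrable (VectorFourier.fourierSMulRight (innerSL ℝ) fun ξ : E => Ψ (-ξ)) := by
    refine (h1.const_mul (2 * Real.pi * ‖innerSL (E := E) ℝ‖)).mono'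
      hn.aestronglyMeasurable.fourierSMulRight (Filter.Eventually.of_forall fun ξ => ?_)
    refine (VectorFourier.norm_fourierSMulRight_le _ _ _).trans_eq ?_
    ring
  rw [Real.fourier_eq, Real.fourier_eq,
    ContinuousLinearMap.integral_apply ((Real.fourierIntegral_convergent_iff x).2 h_int) a]
  congr 1
  funext ξ
  have hin : innerSL ℝ ξ a = ⟪a, ξ⟫ := real_inner_comm _ _
  simp only [Circle.smul_def, smul_apply, VectorFourier.fourierSMulRight_apply, hin,
    inner_neg_right, smul_eq_mul, Complex.real_smul]
  push_cast
  ring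

/-- The composition of two Riesz transforms, up to sign. -/
noncomputable def rieszPair (v w : E) (f : E → ℝ) (x : E) : ℝ :=
  (𝓕⁻ (fun ξ => (rieszPairSymbol v w ξ : ℂ) * 𝓕 (fun y => (f y : ℂ)) ξ) x).re

lemma measurable_rieszPairSymbol (v w : E) : Measurable (rieszPairSymbol v w) := by
  unfold rieszPairSymbol
  fun_prop

/-- Real functions whose complexification has a rapidly decreasing Fourier transform and satisfies
the Fourier inversion formula. -/
structure FourierNice (f : E → ℝ) : Prop where
  rapidDecay : RapidDecay (𝓕 fun y => (f y : ℂ))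
  inversion : 𝓕⁻ (𝓕 fun y => (f y : ℂ)) = fun y => (f y : ℂ)

lemma fourierNice_of_hasCompactSupport {f : E → ℝ} (hf : ContDiff ℝ (⊤ : ℕ∞) f)
    (hc : HasCompactSupport f) : FourierNice f := by
  have hf' : ContDiff ℝ (⊤ : ℕ∞) fun y => (f y : ℂ) := Complex.ofRealCLM.contDiff.comp hf
  have hc' : HasCompactSupport fun y => (f y : ℂ) := hc.comp_left Complex.ofReal_zero
  set g : SchwartzMap E ℂ := hc'.toSchwartzMap hf' with hg
  have hgf : (g : E → ℂ) = fun y => (f y : ℂ) := rfl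
  have hF : 𝓕 (fun y => (f y : ℂ)) = (𝓕 g : SchwartzMap E ℂ) := by
    rw [← hgf, SchwartzMap.fourier_coe]
  refine ⟨⟨?_, fun n => ?_⟩, ?_⟩
  · rw [hF]
    exact (𝓕 g : SchwartzMap E ℂ).continuous.aestronglyMeasurable
  · rw [hF]
    exact (𝓕 g : SchwartzMap E ℂ).integrable_pow_mul volume n
  · refine hf'.continuous.fourierInv_fourier_eq (hf'.continuous.integrable_of_hasCompactSupport
      hc') ?_
    rw [hF]
    exact (𝓕 g : SchwartzMap E ℂ).integrable

lemma FourierNice.rapidDecay_rieszPair {f : E → ℝ} (h : FourierNice f) (v w : E) :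
    RapidDecay fun ξ => (rieszPairSymbol v w ξ : ℂ) * 𝓕 (fun y => (f y : ℂ)) ξ :=
  h.rapidDecay.bdd_mul (c := ‖v‖ * ‖w‖) (by have := measurable_rieszPairSymbol v w; fun_prop)
    fun ξ => by rw [Complex.norm_real]; exact abs_rieszPairSymbol_le v w ξ

lemma FourierNice.contDiff_rieszPair {f : E → ℝ} (h : FourierNice f) (v w : E) :
    ContDiff ℝ (⊤ : ℕ∞) (rieszPair v w f) :=
  Complex.reCLM.contDiff.comp (h.rapidDecay_rieszPair v w).contDiff_fourierInv

lemma RapidDecay.dirDeriv_re_fourierInv {Ψ : E → ℂ} (h : RapidDecay Ψ) (a : E) :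
    dirDeriv a (fun x => (𝓕⁻ Ψ x).re)
      = fun x => (𝓕⁻ (fun ξ => (2 * Real.pi * Complex.I * (⟪a, ξ⟫ : ℝ)) * Ψ ξ) x).re := by
  rw [← h.dirDeriv_fourierInv a]
  funext x
  have hd : DifferentiableAt ℝ (𝓕⁻ Ψ) x :=
    h.contDiff_fourierInv.contDiffAt.differentiableAt (by simp)
  have := (Complex.reCLM.hasFDerivAt.comp x hd.hasFDerivAt).fderiv
  change fderiv ℝ (Complex.reCLM ∘ (𝓕⁻ Ψ)) x a = _
  rw [this]
  rfl

lemma FourierNice.dirDeriv_rieszPair_swap {f : E → ℝ} (h : FourierNice f) (v w a : E) :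
    dirDeriv a (rieszPair v w f) = dirDeriv w (rieszPair v a f) := by
  unfold rieszPair
  rw [(h.rapidDecay_rieszPair v w).dirDeriv_re_fourierInv,
    (h.rapidDecay_rieszPair v a).dirDeriv_re_fourierInv]
  congr! 4 with x ξ
  simp only [rieszPairSymbol]
  push_cast
  ring

lemma FourierNice.dirDeriv_dirDeriv {f : E → ℝ} (h : FourierNice f) (v w : E) :
    dirDeriv w (dirDeriv v f)
      = fun x => (𝓕⁻ (fun ξ => (2 * Real.pi * Complex.I * (⟪w, ξ⟫ : ℝ)) *
        ((2 * Real.pi * Complex.I * (⟪v, ξ⟫ : ℝ)) * 𝓕 (fun y => (f y : ℂ)) ξ)) x).re := by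
  have hf : f = fun x => (𝓕⁻ (𝓕 fun y => (f y : ℂ)) x).re := by
    rw [h.inversion]
    simp
  conv_lhs => rw [hf]
  rw [h.rapidDecay.dirDeriv_re_fourierInv, (h.rapidDecay.inner_mul v).dirDeriv_re_fourierInv]

lemma FourierNice.sum_dirDeriv_dirDeriv_rieszPair {ι : Type*} [Fintype ι]
    (b : OrthonormalBasis ι ℝ E)
    {f : E → ℝ} (h : FourierNice f) (v w x : E) :
    ∑ l, dirDeriv (b l) (dirDeriv (b l) (rieszPair v w f)) x = dirDeriv w (dirDeriv v f) x := by
  have hR := h.rapidDecay_rieszPair v w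
  have hR' := fun l => (hR.inner_mul (b l)).inner_mul (b l)
  have h1 : ∀ l, dirDeriv (b l) (dirDeriv (b l) (rieszPair v w f)) x
      = (𝓕⁻ (fun ξ => (2 * Real.pi * Complex.I * (⟪b l, ξ⟫ : ℝ)) *
        ((2 * Real.pi * Complex.I * (⟪b l, ξ⟫ : ℝ)) *
          ((rieszPairSymbol v w ξ : ℂ) * 𝓕 (fun y => (f y : ℂ)) ξ))) x).re := fun l => by
    unfold rieszPair
    rw [hR.dirDeriv_re_fourierInv, (hR.inner_mul _).dirDeriv_re_fourierInv]
  simp_rw [h1]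
  rw [h.dirDeriv_dirDeriv, ← Complex.re_sum]
  congr 1
  simp_rw [Real.fourierInv_eq]
  rw [← integral_finsetSum]
  · congr 1
    funext ξ
    rw [← Finset.smul_sum]
    congr 1
    have h2 : ((‖ξ‖ ^ 2 : ℝ) : ℂ) = ∑ l, ((⟪b l, ξ⟫ : ℝ) : ℂ) ^ 2 := by
      rw [← b.sum_sq_inner_right ξ]
      push_cast
      rfl
    have h3 : ((‖ξ‖ ^ 2 : ℝ) : ℂ) * (rieszPairSymbol v w ξ : ℂ) = (⟪v, ξ⟫ : ℝ) * (⟪w, ξ⟫ : ℝ) := by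
      rw [← Complex.ofReal_mul, ← Complex.ofReal_mul]
      congr 1
      rw [rieszPairSymbol]
      rcases eq_or_ne ξ 0 with rfl | hξ
      · simp
      · field_simp
    calc _ = (2 * Real.pi * Complex.I) ^ 2 * ((∑ l, ((⟪b l, ξ⟫ : ℝ) : ℂ) ^ 2) *
          (rieszPairSymbol v w ξ : ℂ)) * 𝓕 (fun y => (f y : ℂ)) ξ := by
          rw [Finset.sum_mul, Finset.mul_sum, Finset.sum_mul]
          refine Finset.sum_congr rfl fun l _ => ?_
          ring
      _ = _ := by
          rw [← h2, h3]
          ring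
  · intro l _
    have := (Real.fourierIntegral_convergent_iff (-x)).2 (hR' l).integrable
    simpa using this

end RapidDecay

section RieszPair

variable {E : Type*} [NormedAddCommGroup E] [InnerProductSpace ℝ E] [FiniteDimensional ℝ E]
  [MeasurableSpace E] [BorelSpace E]

lemma exists_tendsto_rieszTrunc_rieszTrunc : ∃ c : ℝ, 0 < c ∧ ∀ (v w : E) (f : E → ℝ),
    FourierNice f → ∀ x, Filter.Tendsto (fun n : ℕ => rieszTrunc ((n : ℝ) + 1)⁻¹ ((n : ℝ) + 1) v
      (rieszTrunc ((n : ℝ) + 1)⁻¹ ((n : ℝ) + 1) w f) x) Filter.atTop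
      (nhds (-(c * rieszPair v w f x))) := by
  obtain ⟨c, hc, hlim⟩ := exists_tendsto_rieszSymbol (E := E)
  refine ⟨c ^ 2, by positivity, fun v w f hf x => ?_⟩
  set F := 𝓕 (fun y => (f y : ℂ)) with hF
  set B := volume.real (Metric.ball (0 : E) 1)
  have hε : ∀ n : ℕ, 0 < ((n : ℝ) + 1)⁻¹ := fun n => by positivity
  have hN : ∀ n : ℕ, 0 < (n : ℝ) + 1 := fun n => by positivity
  have hcont := fun (n : ℕ) (v : E) => continuous_rieszSymbol _ _ (hε n) (hN n) v
  have hcF : AEStronglyMeasurable F := hf.rapidDecay.aestronglyMeasurable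
  have h1 : ∀ (n : ℕ) (y : E), (rieszTrunc ((n : ℝ) + 1)⁻¹ ((n : ℝ) + 1) w f y : ℂ) =
      𝓕⁻ (fun ξ => -Complex.I * rieszSymbol ((n : ℝ) + 1)⁻¹ ((n : ℝ) + 1) w ξ * F ξ) y := fun n =>
    ofReal_rieszTrunc_eq (hε n) (hN n) w hf.rapidDecay.integrable
      fun y => (congrFun hf.inversion y).symm
  have h_int : ∀ n : ℕ, Integrable
      fun ξ => -Complex.I * rieszSymbol ((n : ℝ) + 1)⁻¹ ((n : ℝ) + 1) w ξ * F ξ := fun n => by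
    refine hf.rapidDecay.integrable.bdd_mul (c := ‖w‖ * B) ?_
      (Filter.Eventually.of_forall fun ξ => ?_)
    · have := hcont n w
      exact Continuous.aestronglyMeasurable (by fun_prop)
    · simpa using abs_rieszSymbol_le (hε n) (hN n) w ξ
  have h2 : ∀ n : ℕ, (rieszTrunc ((n : ℝ) + 1)⁻¹ ((n : ℝ) + 1) v
      (rieszTrunc ((n : ℝ) + 1)⁻¹ ((n : ℝ) + 1) w f) x : ℂ) =
      𝓕⁻ (fun ξ => -Complex.I * rieszSymbol ((n : ℝ) + 1)⁻¹ ((n : ℝ) + 1) v ξ *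
        (-Complex.I * rieszSymbol ((n : ℝ) + 1)⁻¹ ((n : ℝ) + 1) w ξ * F ξ)) x := fun n =>
    ofReal_rieszTrunc_eq (hε n) (hN n) v (h_int n) (h1 n) x
  have h3 : Filter.Tendsto (fun n : ℕ => 𝓕⁻ (fun ξ => -Complex.I *
      rieszSymbol ((n : ℝ) + 1)⁻¹ ((n : ℝ) + 1) v ξ *
        (-Complex.I * rieszSymbol ((n : ℝ) + 1)⁻¹ ((n : ℝ) + 1) w ξ * F ξ)) x) Filter.atTop
      (nhds (-(c ^ 2 * 𝓕⁻ (fun ξ => (rieszPairSymbol v w ξ : ℂ) * F ξ) x))) := by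
    simp_rw [Real.fourierInv_eq]
    rw [← integral_const_mul, ← integral_neg]
    refine tendsto_integral_of_dominated_convergence
      (fun ξ => (‖v‖ * B) * ((‖w‖ * B) * ‖F ξ‖)) (fun n => ?_) ?_ (fun n => ?_) ?_
    · have := hcont n w
      have := hcont n v
      have := Real.continuous_fourierChar
      simp_rw [Circle.smul_def]
      have hexp : Continuous fun ξ : E => ((𝐞 ⟪ξ, x⟫ : Circle) : ℂ) := by fun_prop
      refine hexp.aestronglyMeasurable.smul ?_
      refine AEStronglyMeasurable.mul (Continuous.aestronglyMeasurable (by fun_prop)) ?_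
      exact AEStronglyMeasurable.mul (Continuous.aestronglyMeasurable (by fun_prop)) hcF
    · exact (hf.rapidDecay.integrable.norm.const_mul _).const_mul _
    · refine Filter.Eventually.of_forall fun ξ => ?_
      simp only [Circle.norm_smul, norm_mul, norm_neg, Complex.norm_I, one_mul, Complex.norm_real,
        Real.norm_eq_abs]
      gcongr
      · exact abs_rieszSymbol_le (hε n) (hN n) v ξ
      · exact abs_rieszSymbol_le (hε n) (hN n) w ξ
    · refine Filter.Eventually.of_forall fun ξ => ?_
      have hv := (Complex.continuous_ofReal.tendsto _).comp (hlim v ξ)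
      have hw := (Complex.continuous_ofReal.tendsto _).comp (hlim w ξ)
      have := ((hv.const_mul (-Complex.I)).mul
        ((hw.const_mul (-Complex.I)).mul_const (F ξ))).const_smul ((𝐞 ⟪ξ, x⟫ : Circle) : ℂ)
      refine this.trans_eq (congrArg nhds ?_)
      simp only [rieszPairSymbol, Circle.smul_def, smul_eq_mul]
      push_cast
      linear_combination (((𝐞 ⟪ξ, x⟫ : Circle) : ℂ) * c ^ 2 * ⟪v, ξ⟫ * ⟪w, ξ⟫ / ‖ξ‖ ^ 2 * F ξ) *
        Complex.I_sq
  have h4 := (Complex.continuous_re.tendsto _).comp h3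
  refine (h4.congr fun n => ?_).trans_eq ?_
  · rw [Function.comp, ← h2, Complex.ofReal_re]
  · congr 1
    rw [rieszPair, Complex.neg_re, ← Complex.ofReal_pow, Complex.re_ofReal_mul]

lemma lintegral_rieszPair_le {p : ℝ} (hp : 1 < p) : ∃ C : NNReal, ∀ (v w : E) (f : E → ℝ),
    ‖v‖ ≤ 1 → ‖w‖ ≤ 1 → FourierNice f → Measurable f → (∃ M, ∀ x, |f x| ≤ M) →
      ∫⁻ x, ‖rieszPair v w f x‖ₑ ^ p ≤ C * ∫⁻ x, ‖f x‖ₑ ^ p := by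
  obtain ⟨C, hC⟩ := lintegral_rieszTrunc_le (E := E) hp
  obtain ⟨c, hc, hlim⟩ := exists_tendsto_rieszTrunc_rieszTrunc (E := E)
  have hp0 : 0 < p := by linarith
  refine ⟨(‖c‖₊⁻¹) ^ p * (C * C), fun v w f hv hw hf hfm hfb => ?_⟩
  set h : ℕ → E → ℝ := fun n => rieszTrunc ((n : ℝ) + 1)⁻¹ ((n : ℝ) + 1) v
      (rieszTrunc ((n : ℝ) + 1)⁻¹ ((n : ℝ) + 1) w f) with hh
  have hε : ∀ n : ℕ, 0 < ((n : ℝ) + 1)⁻¹ := fun n => by positivity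
  have hN : ∀ n : ℕ, 0 < (n : ℝ) + 1 := fun n => by positivity
  have hm : ∀ n, Measurable (h n) := fun n => measurable_rieszTrunc (measurable_rieszTrunc hfm)
  have hle : ∀ n, ∫⁻ x, ‖h n x‖ₑ ^ p ≤ C * (C * ∫⁻ x, ‖f x‖ₑ ^ p) := fun n =>
    (hC _ _ (hε n) (hN n) v _ hv (measurable_rieszTrunc hfm)
      (exists_abs_rieszTrunc_le (hε n) (hN n) w hfb)).trans
      (mul_le_mul_right (hC _ _ (hε n) (hN n) w f hw hfm hfb) _)
  have hlim' : ∀ x, Filter.Tendsto (fun n => ‖c⁻¹ * h n x‖ₑ ^ p) Filter.atTop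
      (nhds (‖rieszPair v w f x‖ₑ ^ p)) := fun x => by
    have h1 := ((hlim v w f hf x).const_mul c⁻¹).enorm
    rw [mul_neg, inv_mul_cancel_left₀ hc.ne', enorm_neg] at h1
    exact (ENNReal.continuous_rpow_const.tendsto _).comp h1
  calc ∫⁻ x, ‖rieszPair v w f x‖ₑ ^ p
      = ∫⁻ x, Filter.liminf (fun n => ‖c⁻¹ * h n x‖ₑ ^ p) Filter.atTop :=
        lintegral_congr fun x => (hlim' x).liminf_eq.symm
    _ ≤ Filter.liminf (fun n => ∫⁻ x, ‖c⁻¹ * h n x‖ₑ ^ p) Filter.atTop :=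
        lintegral_liminf_le fun n => ((hm n).const_mul _).enorm.pow_const p
    _ ≤ _ := by
        refine Filter.liminf_le_of_le (by isBoundedDefault) fun b hb => ?_
        obtain ⟨n, hn⟩ := hb.exists
        refine hn.trans ?_
        simp_rw [enorm_mul, ENNReal.mul_rpow_of_nonneg _ _ hp0.le]
        rw [lintegral_const_mul' _ _ (ENNReal.rpow_ne_top_of_nonneg hp0.le enorm_ne_top)]
        rw [ENNReal.coe_mul, ENNReal.coe_mul, mul_assoc, mul_assoc]
        refine mul_le_mul (le_of_eq ?_) (hle n) zero_le zero_le
        rw [ENNReal.coe_rpow_of_nonneg _ hp0.le, ← nnnorm_inv]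
        rfl

end RieszPair

section DirDerivCalculus

variable {E : Type*} [NormedAddCommGroup E] [NormedSpace ℝ E]

lemma dirDeriv_comm {f : E → ℝ} (hf : ContDiff ℝ (⊤ : ℕ∞) f) (a b : E) :
    dirDeriv a (dirDeriv b f) = dirDeriv b (dirDeriv a f) := by
  have hd : Differentiable ℝ (fderiv ℝ f) :=
    (hf.fderiv_right (m := (⊤ : ℕ∞)) (by simp)).differentiable (by simp)
  have key : ∀ (a b x : E), dirDeriv a (dirDeriv b f) x = fderiv ℝ (fderiv ℝ f) x a b := by
    intro a b x
    have h := (hd x).hasFDerivAt.clm_apply (hasFDerivAt_const b x)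
    change fderiv ℝ (fun y => fderiv ℝ f y b) x a = _
    rw [h.fderiv]
    simp
  funext x
  rw [key, key]
  exact hf.contDiffAt.isSymmSndFDerivAt (by
    rw [minSmoothness_of_isRCLikeNormedField]
    exact WithTop.coe_le_coe.2 (le_top : (2 : ℕ∞) ≤ ⊤)) a b

lemma dirDeriv_congr_of_isOpen {f g : E → ℝ} {s : Set E} (hs : IsOpen s) (h : ∀ x ∈ s, f x = g x)
    (a : E) {x : E} (hx : x ∈ s) : dirDeriv a f x = dirDeriv a g x := by
  have : f =ᶠ[nhds x] g := Filter.eventuallyEq_of_mem (hs.mem_nhds hx) h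
  rw [dirDeriv, this.fderiv_eq, dirDeriv]

lemma dirDeriv_add {f g : E → ℝ} (hf : ContDiff ℝ (⊤ : ℕ∞) f) (hg : ContDiff ℝ (⊤ : ℕ∞) g) (a : E) :
    dirDeriv a (fun x => f x + g x) = fun x => dirDeriv a f x + dirDeriv a g x := by
  funext x
  have h1 := (hf.differentiable (by simp) x).hasFDerivAt
  have h2 := (hg.differentiable (by simp) x).hasFDerivAt
  simp only [dirDeriv]
  rw [(h1.fun_add h2).fderiv]
  rfl

lemma dirDeriv_const_mul {f : E → ℝ} (hf : ContDiff ℝ (⊤ : ℕ∞) f) (c : ℝ) (a : E) :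
    dirDeriv a (fun x => c * f x) = fun x => c * dirDeriv a f x := by
  funext x
  simp only [dirDeriv]
  rw [((hf.differentiable (by simp) x).hasFDerivAt.const_mul c).fderiv]
  rfl

lemma dirDeriv_sub {f g : E → ℝ} (hf : ContDiff ℝ (⊤ : ℕ∞) f) (hg : ContDiff ℝ (⊤ : ℕ∞) g) (a : E) :
    dirDeriv a (fun x => f x - g x) = fun x => dirDeriv a f x - dirDeriv a g x := by
  funext x
  have h1 := (hf.differentiable (by simp) x).hasFDerivAt
  have h2 := (hg.differentiable (by simp) x).hasFDerivAt
  simp only [dirDeriv]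
  rw [(h1.fun_sub h2).fderiv]
  rfl

lemma dirDeriv_sum {ι : Type*} (s : Finset ι) {f : ι → E → ℝ}
    (hf : ∀ i, ContDiff ℝ (⊤ : ℕ∞) (f i)) (a : E) :
    dirDeriv a (fun x => ∑ i ∈ s, f i x) = fun x => ∑ i ∈ s, dirDeriv a (f i) x := by
  funext x
  simp only [dirDeriv]
  rw [(HasFDerivAt.fun_sum fun i _ => ((hf i).differentiable (by simp) x).hasFDerivAt).fderiv]
  simp

end DirDerivCalculus

section MeanValue

variable {E : Type*} [NormedAddCommGroup E] [InnerProductSpace ℝ E] [FiniteDimensional ℝ E]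
  [MeasurableSpace E] [BorelSpace E]

lemma mul_integral_dirDeriv_comp_mul {g ψ : E → ℝ} (hg : ContDiff ℝ (⊤ : ℕ∞) g)
    (hψ : ContDiff ℝ (⊤ : ℕ∞) ψ) (hc : HasCompactSupport ψ) (a x : E) (t : ℝ) :
    t * ∫ z, dirDeriv a g (x + t • z) * ψ z = -∫ z, g (x + t • z) * dirDeriv a ψ z := by
  have hgt : ContDiff ℝ (⊤ : ℕ∞) fun z => g (x + t • z) := by fun_prop
  have hd : ∀ z, fderiv ℝ (fun z => g (x + t • z)) z a = t * dirDeriv a g (x + t • z) := by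
    intro z
    have h1 : HasFDerivAt (fun z : E => x + t • z) (t • ContinuousLinearMap.id ℝ E) z :=
      ((hasFDerivAt_id z).const_smul t).const_add x
    have h2 := ((hg.differentiable (by simp) (x + t • z)).hasFDerivAt.comp z h1).fderiv
    change fderiv ℝ (g ∘ fun z => x + t • z) z a = _
    rw [h2]
    simp [dirDeriv]
  have hψ' : HasCompactSupport (dirDeriv a ψ) := hc.fderiv_apply (𝕜 := ℝ) a
  have hcg := hgt.continuous
  have hcd : Continuous fun z => dirDeriv a g (x + t • z) :=
    (hg.dirDeriv a).continuous.comp (by fun_prop)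
  have h := integral_mul_fderiv_eq_neg_fderiv_mul_of_integrable (μ := (volume : Measure E)) (𝕜 := ℝ)
    (f := fun z => g (x + t • z)) (g := ψ) (v := a) ?_ ?_ ?_
    (fun z _ => hgt.differentiable (by simp) z) (fun z _ => hψ.differentiable (by simp) z)
  · change _ = -∫ z, g (x + t • z) * fderiv ℝ ψ z a
    rw [h, neg_neg, ← integral_const_mul]
    congr 1
    funext z
    rw [hd, mul_assoc]
  · refine Continuous.integrable_of_hasCompactSupport ?_ hc.mul_left
    simp_rw [hd]
    exact (continuous_const.mul hcd).mul hψ.continuous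
  · exact (hcg.mul (hψ.dirDeriv a).continuous).integrable_of_hasCompactSupport hψ'.mul_left
  · exact (hcg.mul hψ.continuous).integrable_of_hasCompactSupport hc.mul_left

lemma hasDerivAt_integral_comp_mul {g η : E → ℝ} (hg : ContDiff ℝ (⊤ : ℕ∞) g) (hη : Continuous η)
    (hη1 : ∀ z, 1 ≤ ‖z‖ → η z = 0) (hc : HasCompactSupport η) (x : E) (t : ℝ) :
    HasDerivAt (fun t : ℝ => ∫ z, g (x + t • z) * η z)
      (∫ z, fderiv ℝ g (x + t • z) z * η z) t := by
  have hcg := hg.continuous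
  have hcd : Continuous (fderiv ℝ g) := hg.continuous_fderiv (by simp)
  obtain ⟨M, hM⟩ := (isCompact_closedBall (0 : E) (‖x‖ + (|t| + 1))).exists_bound_of_continuousOn
    hcd.continuousOn
  have h_int : ∀ t : ℝ, Integrable fun z => g (x + t • z) * η z := fun t =>
    (Continuous.mul (by fun_prop) hη).integrable_of_hasCompactSupport hc.mul_left
  have hcF : Continuous fun z => fderiv ℝ g (x + t • z) z * η z :=
    ((hcd.comp (by fun_prop)).clm_apply continuous_id).mul hη
  refine (hasDerivAt_integral_of_dominated_loc_of_deriv_le (bound := fun z => M * ‖η z‖)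
    (F' := fun t z => fderiv ℝ g (x + t • z) z * η z)
    (Metric.ball_mem_nhds t one_pos) (Filter.Eventually.of_forall fun t =>
      (h_int t).aestronglyMeasurable) (h_int t) hcF.aestronglyMeasurable
    (Filter.Eventually.of_forall fun z t' ht' => ?_)
    ((hη.integrable_of_hasCompactSupport hc).norm.const_mul M)
    (Filter.Eventually.of_forall fun z t' _ => ?_)).2
  · rcases le_or_gt 1 ‖z‖ with hz | hz
    · simp [hη1 z hz]
    · rw [norm_mul]
      refine mul_le_mul_of_nonneg_right ?_ (norm_nonneg _)
      have hmem : x + t' • z ∈ Metric.closedBall (0 : E) (‖x‖ + (|t| + 1)) := by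
        rw [mem_closedBall_zero_iff]
        refine (norm_add_le _ _).trans (add_le_add_right ?_ _)
        rw [norm_smul, Real.norm_eq_abs]
        have h1 : |t'| ≤ |t| + 1 := by
          have h2 : |t' - t| < 1 := ht'
          have := abs_sub_abs_le_abs_sub t' t
          linarith
        calc |t'| * ‖z‖ ≤ |t'| * 1 := by gcongr
          _ ≤ _ := by linarith
      calc ‖fderiv ℝ g (x + t' • z) z‖ ≤ ‖fderiv ℝ g (x + t' • z)‖ * ‖z‖ :=
            ContinuousLinearMap.le_opNorm _ _
        _ ≤ ‖fderiv ℝ g (x + t' • z)‖ * 1 := by gcongr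
        _ ≤ M := by rw [mul_one]; exact hM _ hmem
  · have h1 : HasDerivAt (fun t : ℝ => x + t • z) z t' := by
      simpa using ((hasDerivAt_id t').smul_const z).const_add x
    exact ((hg.differentiable (by simp) (x + t' • z)).hasFDerivAt.comp_hasDerivAt t' h1).mul_const _

end MeanValue

section MeanValueKernel

variable {E : Type*} [NormedAddCommGroup E]

/-- A smooth radial bump function supported in the unit ball. -/
noncomputable def bumpPotential (z : E) : ℝ := expNegInvGlue (1 - ‖z‖ ^ 2)

/-- The radial function `η` with `∇ bumpPotential z = -η z • z`. -/
noncomputable def bumpKernel (z : E) : ℝ := 2 * deriv expNegInvGlue (1 - ‖z‖ ^ 2)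

lemma deriv_expNegInvGlue_of_nonpos {s : ℝ} (hs : s ≤ 0) : deriv expNegInvGlue s = 0 := by
  refine IsLocalMin.deriv_eq_zero (Filter.Eventually.of_forall fun t => ?_)
  rw [expNegInvGlue.zero_of_nonpos hs]
  exact expNegInvGlue.nonneg t

lemma deriv_expNegInvGlue_of_pos {s : ℝ} (hs : 0 < s) :
    deriv expNegInvGlue s = Real.exp (-s⁻¹) * (s ^ 2)⁻¹ := by
  have h : expNegInvGlue =ᶠ[nhds s] fun s => Real.exp (-s⁻¹) := by
    filter_upwards [lt_mem_nhds hs] with t ht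
    simp [expNegInvGlue, ht.not_ge]
  rw [h.deriv_eq, ((hasDerivAt_inv hs.ne').fun_neg.exp).deriv]
  ring

lemma contDiff_deriv_expNegInvGlue : ContDiff ℝ (⊤ : ℕ∞) (deriv expNegInvGlue) :=
  (contDiff_infty_iff_deriv.1 (expNegInvGlue.contDiff (n := ⊤))).2

lemma bumpKernel_eq_zero {z : E} (hz : 1 ≤ ‖z‖) : bumpKernel z = 0 := by
  rw [bumpKernel, deriv_expNegInvGlue_of_nonpos (by nlinarith), mul_zero]

lemma bumpPotential_eq_zero {z : E} (hz : 1 ≤ ‖z‖) : bumpPotential z = 0 :=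
  expNegInvGlue.zero_of_nonpos (by nlinarith)

lemma bumpKernel_nonneg (z : E) : 0 ≤ bumpKernel z := by
  rcases le_or_gt 1 ‖z‖ with hz | hz
  · rw [bumpKernel_eq_zero hz]
  · rw [bumpKernel, deriv_expNegInvGlue_of_pos (by nlinarith [norm_nonneg z])]
    positivity

lemma bumpKernel_zero_pos : 0 < bumpKernel (0 : E) := by
  rw [bumpKernel, deriv_expNegInvGlue_of_pos (by simp)]
  simp only [norm_zero]
  positivity

variable [InnerProductSpace ℝ E]

lemma contDiff_bumpPotential : ContDiff ℝ (⊤ : ℕ∞) (bumpPotential : E → ℝ) :=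
  expNegInvGlue.contDiff.comp (contDiff_const.sub (contDiff_norm_sq ℝ))

lemma contDiff_bumpKernel : ContDiff ℝ (⊤ : ℕ∞) (bumpKernel : E → ℝ) :=
  contDiff_const.mul (contDiff_deriv_expNegInvGlue.comp (contDiff_const.sub (contDiff_norm_sq ℝ)))

lemma dirDeriv_bumpPotential (a z : E) : dirDeriv a bumpPotential z = -(⟪a, z⟫ * bumpKernel z) := by
  have h1 : HasFDerivAt (fun z : E => 1 - ‖z‖ ^ 2) (-(2 • innerSL ℝ z)) z :=
    (hasStrictFDerivAt_norm_sq z).hasFDerivAt.const_sub 1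
  have h2 := (((expNegInvGlue.contDiff (n := ⊤)).differentiable (by simp)
    (1 - ‖z‖ ^ 2)).hasDerivAt.comp_hasFDerivAt z h1).fderiv
  change fderiv ℝ (expNegInvGlue ∘ fun z : E => 1 - ‖z‖ ^ 2) z a = _
  rw [h2, bumpKernel, real_inner_comm]
  simp
  ring

lemma hasCompactSupport_of_forall_one_le [FiniteDimensional ℝ E] {f : E → ℝ}
    (hf : ∀ z, 1 ≤ ‖z‖ → f z = 0) : HasCompactSupport f :=
  HasCompactSupport.intro (isCompact_closedBall 0 1) fun z hz => hf z (by simp at hz; exact hz.le)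

variable [FiniteDimensional ℝ E] [MeasurableSpace E] [BorelSpace E]

lemma integral_bumpKernel_pos : 0 < ∫ z : E, bumpKernel z := by
  refine (contDiff_bumpKernel (E := E)).continuous.integral_pos_of_hasCompactSupport_nonneg_nonzero
    (hasCompactSupport_of_forall_one_le fun z => bumpKernel_eq_zero) bumpKernel_nonneg
    bumpKernel_zero_pos.ne'

lemma integral_comp_mul_bumpKernel {ι : Type*} [Fintype ι] (b : OrthonormalBasis ι ℝ E)
    {g : E → ℝ} (hg : ContDiff ℝ (⊤ : ℕ∞) g) {r s : ℝ} {x : E} (hs : 0 ≤ s) (hr : ‖x‖ + s ≤ r)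
    (hΔ : ∀ y ∈ Metric.ball (0 : E) r, ∑ l, dirDeriv (b l) (dirDeriv (b l) g) y = 0) :
    ∫ z, g (x + s • z) * bumpKernel z = g x * ∫ z : E, bumpKernel z := by
  have hcη : HasCompactSupport (bumpKernel : E → ℝ) :=
    hasCompactSupport_of_forall_one_le fun z => bumpKernel_eq_zero
  have hcΞ : HasCompactSupport (bumpPotential : E → ℝ) :=
    hasCompactSupport_of_forall_one_le fun z => bumpPotential_eq_zero
  have hη := (contDiff_bumpKernel (E := E)).continuous
  have hΞ := contDiff_bumpPotential (E := E)
  have hder := fun t => hasDerivAt_integral_comp_mul hg hη (fun z => bumpKernel_eq_zero) hcη x t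
  have hzero : ∀ t ∈ Set.Ico 0 s, ∫ z, fderiv ℝ g (x + t • z) z * bumpKernel z = 0 := by
    intro t ht
    have h1 : ∀ z, fderiv ℝ g (x + t • z) z * bumpKernel z =
        -∑ l, dirDeriv (b l) g (x + t • z) * dirDeriv (b l) bumpPotential z := by
      intro z
      conv_lhs => rw [← b.sum_repr' z]
      rw [map_sum, Finset.sum_mul, b.sum_repr' z, ← Finset.sum_neg_distrib]
      refine Finset.sum_congr rfl fun l _ => ?_
      rw [dirDeriv_bumpPotential, map_smul, smul_eq_mul, dirDeriv]
      ring
    have hcont : ∀ l, Continuous fun z => dirDeriv (b l) (dirDeriv (b l) g) (x + t • z) := fun l =>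
      ((hg.dirDeriv (b l)).dirDeriv (b l)).continuous.comp (by fun_prop)
    have hcont1 : ∀ l, Continuous fun z => dirDeriv (b l) g (x + t • z) := fun l =>
      (hg.dirDeriv (b l)).continuous.comp (by fun_prop)
    simp_rw [h1]
    rw [integral_neg, integral_finsetSum]
    · rw [← Finset.sum_neg_distrib]
      simp_rw [← mul_integral_dirDeriv_comp_mul (hg.dirDeriv _) hΞ hcΞ]
      rw [← Finset.mul_sum, ← integral_finsetSum]
      · rw [integral_eq_zero_of_ae, mul_zero]
        refine Filter.Eventually.of_forall fun z => ?_
        simp only [Pi.zero_apply]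
        rw [← Finset.sum_mul]
        rcases le_or_gt 1 ‖z‖ with hz | hz
        · rw [bumpPotential_eq_zero hz, mul_zero]
        · rw [hΔ _ ?_, zero_mul]
          rw [mem_ball_zero_iff]
          refine (norm_add_le _ _).trans_lt ?_
          rw [norm_smul, Real.norm_of_nonneg ht.1]
          nlinarith [ht.1, ht.2]
      · exact fun l _ => ((hcont l).mul hΞ.continuous).integrable_of_hasCompactSupport hcΞ.mul_left
    · exact fun l _ => ((hcont1 l).mul (hΞ.dirDeriv _).continuous).integrable_of_hasCompactSupport
        (hcΞ.fderiv_apply (𝕜 := ℝ) (b l)).mul_left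
  have h := constant_of_has_deriv_right_zero (a := 0) (b := s)
    (fun t _ => (hder t).continuousAt.continuousWithinAt)
    (fun t ht => by rw [← hzero t ht]; exact (hder t).hasDerivWithinAt) s (Set.right_mem_Icc.2 hs)
  rw [h]
  simp [integral_const_mul]

/-- There is a smooth kernel supported in the unit ball with respect to which harmonic functions
satisfy the mean value property. -/
lemma exists_meanValue_kernel {ι : Type*} [Fintype ι] (b : OrthonormalBasis ι ℝ E) :
    ∃ η : E → ℝ, ContDiff ℝ (⊤ : ℕ∞) η ∧ HasCompactSupport η ∧ (∀ z, 1 ≤ ‖z‖ → η z = 0) ∧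
      ∀ g : E → ℝ, ContDiff ℝ (⊤ : ℕ∞) g → ∀ (r s : ℝ) (x : E), 0 ≤ s → ‖x‖ + s ≤ r →
        (∀ y ∈ Metric.ball (0 : E) r, ∑ l, dirDeriv (b l) (dirDeriv (b l) g) y = 0) →
        ∫ z, g (x + s • z) * η z = g x := by
  have hpos := integral_bumpKernel_pos (E := E)
  have h0 : ∀ z : E, 1 ≤ ‖z‖ → bumpKernel z * (∫ z : E, bumpKernel z)⁻¹ = 0 := fun z hz => by
    rw [bumpKernel_eq_zero hz, zero_mul]
  refine ⟨fun z => bumpKernel z * (∫ z : E, bumpKernel z)⁻¹, contDiff_bumpKernel.mul contDiff_const,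
    hasCompactSupport_of_forall_one_le h0, h0, fun g hg r s x hs hr hΔ => ?_⟩
  simp_rw [← mul_assoc]
  rw [integral_mul_const, integral_comp_mul_bumpKernel b hg hs hr hΔ,
      mul_inv_cancel_right₀ hpos.ne']

end MeanValueKernel

section HardyWeight

/-- The derivative of `τ ↦ τ * expNegInvGlue τ`. -/
noncomputable def hardyWeight (τ : ℝ) : ℝ := expNegInvGlue τ + τ * deriv expNegInvGlue τ

lemma continuous_hardyWeight : Continuous hardyWeight :=
  (expNegInvGlue.contDiff (n := 0)).continuous.add
    (continuous_id.mul contDiff_deriv_expNegInvGlue.continuous)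

lemma hardyWeight_of_nonpos {τ : ℝ} (h : τ ≤ 0) : hardyWeight τ = 0 := by
  rw [hardyWeight, expNegInvGlue.zero_of_nonpos h, deriv_expNegInvGlue_of_nonpos h]
  simp

lemma hardyWeight_of_pos {τ : ℝ} (h : 0 < τ) : hardyWeight τ = (1 + τ⁻¹) * Real.exp (-τ⁻¹) := by
  rw [hardyWeight, deriv_expNegInvGlue_of_pos h, expNegInvGlue, if_neg h.not_ge]
  field_simp

lemma hardyWeight_nonneg (τ : ℝ) : 0 ≤ hardyWeight τ := by
  rcases le_or_gt τ 0 with h | h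
  · rw [hardyWeight_of_nonpos h]
  · rw [hardyWeight_of_pos h]
    positivity

lemma hardyWeight_le_one (τ : ℝ) : hardyWeight τ ≤ 1 := by
  rcases le_or_gt τ 0 with h | h
  · rw [hardyWeight_of_nonpos h]
    exact zero_le_one
  · rw [hardyWeight_of_pos h]
    calc _ ≤ Real.exp τ⁻¹ * Real.exp (-τ⁻¹) := by
          gcongr
          linarith [Real.add_one_le_exp τ⁻¹]
      _ = 1 := by rw [← Real.exp_add, add_neg_cancel, Real.exp_zero]

lemma exp_neg_one_le_hardyWeight {τ : ℝ} (h : 1 ≤ τ) : Real.exp (-1) ≤ hardyWeight τ := by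
  have h0 : 0 < τ := by linarith
  rw [hardyWeight_of_pos h0]
  have h1 : τ⁻¹ ≤ 1 := inv_le_one_of_one_le₀ h
  have h2 : 0 < τ⁻¹ := by positivity
  calc Real.exp (-1) ≤ Real.exp (-τ⁻¹) := by gcongr
    _ ≤ _ := le_mul_of_one_le_left (Real.exp_pos _).le (by linarith)

lemma expNegInvGlue_le_hardyWeight (τ : ℝ) : expNegInvGlue τ ≤ hardyWeight τ := by
  rcases le_or_gt τ 0 with h | h
  · rw [hardyWeight_of_nonpos h, expNegInvGlue.zero_of_nonpos h]
  · rw [hardyWeight, deriv_expNegInvGlue_of_pos h]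
    have : 0 ≤ τ * (Real.exp (-τ⁻¹) * (τ ^ 2)⁻¹) := by positivity
    linarith

lemma mul_rpow_mul_le {p : ℝ} (hp : 1 < p) {ε a b : ℝ} (hε : 0 < ε) (ha : 0 ≤ a) (hb : 0 ≤ b) :
    a ^ (p - 1) * b ≤ ε * a ^ p + ε ^ (1 - p) * b ^ p := by
  rcases le_or_gt b (ε * a) with h | h
  · have h1 : a ^ p = a ^ (p - 1) * a := by
      rcases ha.eq_or_lt with rfl | ha
      · rw [Real.zero_rpow (by linarith), mul_zero]
      · rw [← Real.rpow_add_one ha.ne', sub_add_cancel]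
    have h2 : 0 ≤ ε ^ (1 - p) * b ^ p := by positivity
    calc a ^ (p - 1) * b ≤ a ^ (p - 1) * (ε * a) := by gcongr
      _ = ε * a ^ p := by rw [h1]; ring
      _ ≤ _ := by linarith
  · have hb' : 0 < b := lt_of_le_of_lt (by positivity) h
    have h1 : a ≤ b / ε := by rw [le_div_iff₀ hε]; linarith
    have h2 : 0 ≤ ε * a ^ p := by positivity
    calc a ^ (p - 1) * b ≤ (b / ε) ^ (p - 1) * b := by
          gcongr
      _ = ε ^ (1 - p) * b ^ p := by
          rw [Real.div_rpow hb hε.le, show 1 - p = -(p - 1) by ring, Real.rpow_neg hε.le,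
            show b ^ p = b ^ (p - 1) * b by rw [← Real.rpow_add_one hb'.ne', sub_add_cancel]]
          ring
      _ ≤ _ := by linarith

lemma hardyWeight_mul_le_of_pos {E : Type*} [NormedAddCommGroup E] [InnerProductSpace ℝ E]
    {d p : ℝ} (hd : 0 ≤ d) (hp : 1 < p) {r σ : ℝ}
    (hr : 1 / 2 ≤ r) (hr1 : r ≤ 1) (h : E → ℝ) {x : E} (hx : ‖x‖ < r) :
    hardyWeight ((r ^ 2 - ‖x‖ ^ 2) / σ) * |h x| ^ p / 8 ≤
      (2 * ‖x‖ ^ 2 * hardyWeight ((r ^ 2 - ‖x‖ ^ 2) / σ) * |h x| ^ p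
      - (r ^ 2 - ‖x‖ ^ 2) * expNegInvGlue ((r ^ 2 - ‖x‖ ^ 2) / σ) *
        (p * |h x| ^ (p - 2) * h x * fderiv ℝ h x x + d * |h x| ^ p)) +
      ((1 / 8) ^ (1 - p) * (2 * p) ^ p * ((r - ‖x‖) * ‖fderiv ℝ h x‖) ^ p +
        if ‖x‖ < (1 - 1 / (2 * (d + 2))) * r then (d + 1) * |h x| ^ p else 0) := by
  have hx0 := norm_nonneg x
  set s := r ^ 2 - ‖x‖ ^ 2 with hs
  have hs0 : 0 < s := by nlinarith
  set T := hardyWeight (s / σ)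
  set G := expNegInvGlue (s / σ)
  have hT0 : 0 ≤ T := hardyWeight_nonneg _
  have hT1 : T ≤ 1 := hardyWeight_le_one _
  have hG0 : 0 ≤ G := expNegInvGlue.nonneg _
  have hGT : G ≤ T := expNegInvGlue_le_hardyWeight _
  set A := |h x| ^ p with hA
  have hA0 : 0 ≤ A := by positivity
  set D := ‖fderiv ℝ h x‖
  have hD0 : 0 ≤ D := norm_nonneg _
  have h1 : p * |h x| ^ (p - 2) * h x * fderiv ℝ h x x ≤ p * (|h x| ^ (p - 1) * D) := by
    have e1 : |h x| ^ (p - 2) * |h x| ≤ |h x| ^ (p - 1) := by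
      rcases (abs_nonneg (h x)).eq_or_lt with h0 | h0
      · rw [← h0, mul_zero]
        positivity
      · rw [← Real.rpow_add_one h0.ne']
        apply le_of_eq
        congr 1
        ring
    have e2 : |fderiv ℝ h x x| ≤ D := by
      calc |fderiv ℝ h x x| ≤ D * ‖x‖ := (fderiv ℝ h x).le_opNorm x
        _ ≤ D * 1 := by gcongr; linarith
        _ = D := mul_one _
    calc p * |h x| ^ (p - 2) * h x * fderiv ℝ h x x
        ≤ |p * |h x| ^ (p - 2) * h x * fderiv ℝ h x x| := le_abs_self _
      _ = p * ((|h x| ^ (p - 2) * |h x|) * |fderiv ℝ h x x|) := by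
        rw [abs_mul, abs_mul, abs_mul, abs_of_pos (by linarith : 0 < p),
          abs_of_nonneg (by positivity : 0 ≤ |h x| ^ (p - 2))]
        ring
      _ ≤ _ := by gcongr
  set B := (1 / 8 : ℝ) ^ (1 - p) * (2 * p) ^ p * ((r - ‖x‖) * D) ^ p with hB
  have hB0 : 0 ≤ B := by
    have : 0 ≤ r - ‖x‖ := by linarith
    positivity
  have h2 : s * (p * (|h x| ^ (p - 1) * D)) ≤ 1 / 8 * A + B := by
    have e1 : s ≤ 2 * (r - ‖x‖) := by nlinarith
    have e3 : 0 ≤ r - ‖x‖ := by linarith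
    calc s * (p * (|h x| ^ (p - 1) * D))
        ≤ (2 * (r - ‖x‖)) * (p * (|h x| ^ (p - 1) * D)) := by gcongr
      _ = |h x| ^ (p - 1) * ((2 * p) * ((r - ‖x‖) * D)) := by ring
      _ ≤ 1 / 8 * |h x| ^ p + (1 / 8) ^ (1 - p) * ((2 * p) * ((r - ‖x‖) * D)) ^ p :=
        mul_rpow_mul_le hp (by norm_num) (abs_nonneg _) (by positivity)
      _ = _ := by
        rw [Real.mul_rpow (by positivity) (by positivity), hB, hA]
        ring
  have h3 : s * G * (p * |h x| ^ (p - 2) * h x * fderiv ℝ h x x + d * A) ≤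
      T * (1 / 8 * A + B + s * d * A) := by
    calc _ ≤ s * G * (p * (|h x| ^ (p - 1) * D) + d * A) := by gcongr
      _ ≤ s * T * (p * (|h x| ^ (p - 1) * D) + d * A) := by gcongr
      _ = T * (s * (p * (|h x| ^ (p - 1) * D)) + s * d * A) := by ring
      _ ≤ _ := by gcongr
  have h4 : T * B ≤ B := mul_le_of_le_one_left hB0 hT1
  have h5 : T * A / 8 ≤ T * A * (2 * ‖x‖ ^ 2 - 1 / 8 - s * d) +
      if ‖x‖ < (1 - 1 / (2 * (d + 2))) * r then (d + 1) * A else 0 := by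
    have hTA : 0 ≤ T * A := by positivity
    split_ifs with hin
    · have e1 : s * d ≤ d := mul_le_of_le_one_left hd (by nlinarith)
      have e2 : T * A * (d + 1) ≤ (d + 1) * A := by
        have := mul_le_of_le_one_left hA0 hT1
        nlinarith
      have e3 : T * A * (1 / 8) ≤ T * A * (2 * ‖x‖ ^ 2 - 1 / 8 - s * d + (d + 1)) := by
        gcongr
        nlinarith [sq_nonneg ‖x‖]
      linarith
    · set θ := 1 - 1 / (2 * (d + 2)) with hθ
      push Not at hin
      have hθ1 : (d + 2) * (1 - θ) = 1 / 2 := by rw [hθ]; field_simp; ring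
      have hθ0 : 0 ≤ θ := by nlinarith
      have e1 : (θ * r) ^ 2 ≤ ‖x‖ ^ 2 := by gcongr
      have e2 : (d + 1) ≤ (d + 2) * θ ^ 2 := by
        have : (d + 2) * θ ^ 2 = d + 2 - 2 * ((d + 2) * (1 - θ)) + (d + 2) * (1 - θ) ^ 2 := by ring
        have : 0 ≤ (d + 2) * (1 - θ) ^ 2 := by positivity
        linarith
      have e3 : (d + 1) * r ^ 2 ≤ (d + 2) * ‖x‖ ^ 2 :=
        calc (d + 1) * r ^ 2 ≤ (d + 2) * θ ^ 2 * r ^ 2 := by gcongr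
          _ = (d + 2) * (θ * r) ^ 2 := by ring
          _ ≤ _ := by gcongr
      have e4 : 1 / 4 ≤ r ^ 2 := by nlinarith
      have e5 : T * A * (1 / 8) ≤ T * A * (2 * ‖x‖ ^ 2 - 1 / 8 - s * d) := by
        gcongr
        have : s * d = d * r ^ 2 - d * ‖x‖ ^ 2 := by rw [hs]; ring
        linarith
      linarith
  linarith

end HardyWeight

section Hardy

variable {E : Type*} [NormedAddCommGroup E] [InnerProductSpace ℝ E] [FiniteDimensional ℝ E]
  [MeasurableSpace E] [BorelSpace E]

lemma integral_fderiv_self {ι : Type*} [Fintype ι] (b : OrthonormalBasis ι ℝ E) {G : E → ℝ}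
    (hG : ContDiff ℝ 1 G) (hc : HasCompactSupport G) :
    ∫ x, fderiv ℝ G x x = -(Fintype.card ι * ∫ x, G x) := by
  have h1 : ∀ x, fderiv ℝ G x x = ∑ l, ⟪b l, x⟫ * fderiv ℝ G x (b l) := fun x => by
    conv_lhs => arg 2; rw [← b.sum_repr' x]
    simp
  have hcont : ∀ l, Continuous fun x => fderiv ℝ G x (b l) := fun l =>
    (hG.continuous_fderiv (by simp)).clm_apply continuous_const
  have hc' : ∀ l, HasCompactSupport fun x => fderiv ℝ G x (b l) := fun l =>
    hc.fderiv_apply (𝕜 := ℝ) (b l)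
  have hin : ∀ (l : ι) (x : E), HasFDerivAt (fun x : E => ⟪b l, x⟫)
      (innerSL ℝ (b l)) x := fun l x =>
    (innerSL ℝ (b l)).hasFDerivAt
  have h_int : ∀ l, Integrable fun x => ⟪b l, x⟫ * fderiv ℝ G x (b l) := fun l =>
    (Continuous.mul (by fun_prop) (hcont l)).integrable_of_hasCompactSupport (hc' l).mul_left
  have h2 : ∀ l, ∫ x, ⟪b l, x⟫ * fderiv ℝ G x (b l) = -∫ x, G x := fun l => by
    rw [integral_mul_fderiv_eq_neg_fderiv_mul_of_integrable]
    · congr 2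
      funext x
      rw [(hin l x).fderiv]
      simp
    · simp_rw [(hin l _).fderiv]
      exact (continuous_const.mul hG.continuous).integrable_of_hasCompactSupport hc.mul_left
    · exact h_int l
    · exact (Continuous.mul (by fun_prop) hG.continuous).integrable_of_hasCompactSupport hc.mul_left
    · exact fun x _ => (hin l x).differentiableAt
    · exact fun x _ => hG.differentiable (by simp) x
  simp_rw [h1]
  rw [integral_finsetSum _ fun l _ => h_int l]
  simp_rw [h2]
  simp

/-- The key integration by parts for Hardy's inequality. -/
lemma integral_hardyWeight_mul_eq {ι : Type*} [Fintype ι] (b : OrthonormalBasis ι ℝ E) {p : ℝ}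
    (hp : 1 < p) {r σ : ℝ} (hσ : 0 < σ) (hr : 0 < r) {h : E → ℝ} (hh : ContDiff ℝ (⊤ : ℕ∞) h) :
    Integrable (fun x => 2 * ‖x‖ ^ 2 * hardyWeight ((r ^ 2 - ‖x‖ ^ 2) / σ) * |h x| ^ p
      - (r ^ 2 - ‖x‖ ^ 2) * expNegInvGlue ((r ^ 2 - ‖x‖ ^ 2) / σ) *
        (p * |h x| ^ (p - 2) * h x * fderiv ℝ h x x + Fintype.card ι * |h x| ^ p)) ∧
    ∫ x, (2 * ‖x‖ ^ 2 * hardyWeight ((r ^ 2 - ‖x‖ ^ 2) / σ) * |h x| ^ p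
      - (r ^ 2 - ‖x‖ ^ 2) * expNegInvGlue ((r ^ 2 - ‖x‖ ^ 2) / σ) *
        (p * |h x| ^ (p - 2) * h x * fderiv ℝ h x x + Fintype.card ι * |h x| ^ p)) = 0 := by
  set Φ : E → ℝ := fun x => (r ^ 2 - ‖x‖ ^ 2) * expNegInvGlue ((r ^ 2 - ‖x‖ ^ 2) / σ) with hΦ
  have hs : ∀ x : E, HasFDerivAt (fun x : E => r ^ 2 - ‖x‖ ^ 2) (-(2 • innerSL ℝ x)) x := fun x =>
    (hasStrictFDerivAt_norm_sq x).hasFDerivAt.const_sub _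
  have hS : ∀ s : ℝ, HasDerivAt (fun s => s * expNegInvGlue (s / σ)) (hardyWeight (s / σ)) s := by
    intro s
    have h1 : HasDerivAt expNegInvGlue (deriv expNegInvGlue (s / σ)) (s / σ) :=
      ((expNegInvGlue.contDiff (n := ⊤)).differentiable (by simp) _).hasDerivAt
    have h2 := (hasDerivAt_id s).mul (h1.comp s ((hasDerivAt_id s).div_const σ))
    refine h2.congr_deriv ?_
    simp only [id, hardyWeight, Function.comp]
    ring
  have hΦd : ∀ x, HasFDerivAt Φ (hardyWeight ((r ^ 2 - ‖x‖ ^ 2) / σ) •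
      (-(2 • innerSL ℝ x) : E →L[ℝ] ℝ)) x := fun x => (hS _).comp_hasFDerivAt x (hs x)
  have hsc : ContDiff ℝ 1 fun x : E => r ^ 2 - ‖x‖ ^ 2 := contDiff_const.sub (contDiff_norm_sq ℝ)
  have hΦc : ContDiff ℝ 1 Φ :=
    hsc.mul ((expNegInvGlue.contDiff (n := 1)).comp (hsc.div_const σ))
  have hΦ0 : HasCompactSupport Φ := by
    refine HasCompactSupport.intro (isCompact_closedBall 0 r) fun x hx => ?_
    have hx' : r < ‖x‖ := by simpa using hx
    rw [hΦ]
    simp only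
    rw [expNegInvGlue.zero_of_nonpos, mul_zero]
    exact div_nonpos_of_nonpos_of_nonneg (by nlinarith) hσ.le
  have hp1 : ContDiff ℝ 1 fun x => |h x| ^ p := by
    have := (contDiff_norm_rpow (E := ℝ) hp).comp (hh.of_le (m := 1) (by simp))
    exact this
  have hpd : ∀ x, HasFDerivAt (fun x => |h x| ^ p) ((p * |h x| ^ (p - 2) * h x) • fderiv ℝ h x) x :=
    fun x => (hasDerivAt_abs_rpow (h x) hp).comp_hasFDerivAt x
      (hh.differentiable (by simp) x).hasFDerivAt
  have hG : ContDiff ℝ 1 fun x => Φ x * |h x| ^ p := hΦc.mul hp1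
  have hGc : HasCompactSupport fun x => Φ x * |h x| ^ p := hΦ0.mul_right
  have hGd : ∀ x, fderiv ℝ (fun x => Φ x * |h x| ^ p) x x =
      Φ x * (p * |h x| ^ (p - 2) * h x * fderiv ℝ h x x) -
        2 * ‖x‖ ^ 2 * hardyWeight ((r ^ 2 - ‖x‖ ^ 2) / σ) * |h x| ^ p := fun x => by
    have h1 : HasFDerivAt (fun x => Φ x * |h x| ^ p) _ x := (hΦd x).mul (hpd x)
    rw [h1.fderiv]
    simp
    ring
  have key := integral_fderiv_self b hG hGc
  have hi1 : Integrable fun x => fderiv ℝ (fun x => Φ x * |h x| ^ p) x x := by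
    refine Continuous.integrable_of_hasCompactSupport
      ((hG.continuous_fderiv (by simp)).clm_apply continuous_id) ?_
    exact (hGc.fderiv (𝕜 := ℝ)).mono fun x hx hx' => hx (by simp [hx'])
  have hi2 : Integrable fun x => Fintype.card ι * (Φ x * |h x| ^ p) :=
    (hG.continuous.integrable_of_hasCompactSupport hGc).const_mul _
  rw [← integral_const_mul, ← integral_neg] at key
  have h0 := integral_sub hi2.neg hi1
  have heq : (fun x => 2 * ‖x‖ ^ 2 * hardyWeight ((r ^ 2 - ‖x‖ ^ 2) / σ) * |h x| ^ p
      - (r ^ 2 - ‖x‖ ^ 2) * expNegInvGlue ((r ^ 2 - ‖x‖ ^ 2) / σ) *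
        (p * |h x| ^ (p - 2) * h x * fderiv ℝ h x x + Fintype.card ι * |h x| ^ p)) =
      fun x => (-fun x => Fintype.card ι * (Φ x * |h x| ^ p)) x -
        fderiv ℝ (fun x => Φ x * |h x| ^ p) x x := by
    funext x
    rw [hGd]
    simp only [Pi.neg_apply, hΦ]
    ring
  rw [heq]
  refine ⟨hi2.neg.sub hi1, h0.trans ?_⟩
  rw [key]
  exact sub_self _

/-- An interior form of Hardy's inequality, with constants that do not depend on the radii. -/
theorem lintegral_ball_rpow_le_hardy {ι : Type*} [Fintype ι] (b : OrthonormalBasis ι ℝ E) {p : ℝ}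
    (hp : 1 < p) : ∃ C : NNReal, ∀ (r' r : ℝ) (h : E → ℝ), 0 ≤ r' → r' < r → 1 / 2 ≤ r → r ≤ 1 →
    ContDiff ℝ (⊤ : ℕ∞) h →
    ∫⁻ x in Metric.ball 0 r', ‖h x‖ₑ ^ p ≤
      C * ((∫⁻ x in Metric.ball 0 r, ‖(r - ‖x‖) • fderiv ℝ h x‖ₑ ^ p) +
        ∫⁻ x in Metric.ball 0 ((1 - 1 / (2 * (Fintype.card ι + 2))) * r), ‖h x‖ₑ ^ p) := by
  set d : ℝ := (Fintype.card ι : ℝ) with hd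
  have hp0 : 0 ≤ p := by linarith
  set θ : ℝ := 1 - 1 / (2 * (d + 2))
  set c : ℝ := (1 / 8 : ℝ) ^ (1 - p) * (2 * p) ^ p with hc
  have hc0 : 0 ≤ c := by positivity
  have hd0 : 0 ≤ d := by positivity
  refine ⟨(8 * Real.exp 1 * (c + (d + 1))).toNNReal, fun r' r h hr'0 hr' hr hr1 hh => ?_⟩
  set σ := r ^ 2 - r' ^ 2
  have hσ : 0 < σ := by simp only [σ]; nlinarith
  obtain ⟨hI, hI0⟩ := integral_hardyWeight_mul_eq b hp hσ (by linarith) hh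
  set I : E → ℝ := fun x => 2 * ‖x‖ ^ 2 * hardyWeight ((r ^ 2 - ‖x‖ ^ 2) / σ) * |h x| ^ p
      - (r ^ 2 - ‖x‖ ^ 2) * expNegInvGlue ((r ^ 2 - ‖x‖ ^ 2) / σ) *
        (p * |h x| ^ (p - 2) * h x * fderiv ℝ h x x + d * |h x| ^ p) with hIdef
  set W : E → ℝ := fun x => hardyWeight ((r ^ 2 - ‖x‖ ^ 2) / σ) * |h x| ^ p / 8 with hW
  have hhc := hh.continuous
  have hWc : Continuous W := by
    refine ((continuous_hardyWeight.comp (by fun_prop)).mul ?_).div_const 8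
    exact (continuous_abs.comp hhc).rpow_const fun _ => Or.inr hp0
  have hout : ∀ x : E, r ≤ ‖x‖ → (r ^ 2 - ‖x‖ ^ 2) / σ ≤ 0 := fun x hx =>
    div_nonpos_of_nonpos_of_nonneg (by nlinarith) hσ.le
  have hWI : Integrable W := by
    refine hWc.integrable_of_hasCompactSupport
      (HasCompactSupport.intro (isCompact_closedBall 0 r) fun x hx => ?_)
    have hx' : r < ‖x‖ := by simpa using hx
    rw [hW]
    simp only
    rw [hardyWeight_of_nonpos (hout x hx'.le)]
    simp
  have hW0 : ∀ x, 0 ≤ W x := fun x => by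
    have := hardyWeight_nonneg ((r ^ 2 - ‖x‖ ^ 2) / σ)
    simp only [hW]
    positivity
  have hp0' : ∀ x : ℝ, ‖x‖ₑ ^ p = ENNReal.ofReal (|x| ^ p) := fun x => by
    rw [Real.enorm_eq_ofReal_abs, ENNReal.ofReal_rpow_of_nonneg (abs_nonneg _) hp0]
  set R : E → ℝ≥0∞ := fun x =>
    (Metric.ball 0 r).indicator
      (fun x => ENNReal.ofReal c * ‖(r - ‖x‖) • fderiv ℝ h x‖ₑ ^ p) x +
    (Metric.ball 0 (θ * r)).indicator (fun x => ENNReal.ofReal (d + 1) * ‖h x‖ₑ ^ p) x with hR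
  have key : ∀ x, ENNReal.ofReal (max (W x - I x) 0) ≤ R x := fun x => by
    rcases lt_or_ge ‖x‖ r with hx | hx
    · have h1 := hardyWeight_mul_le_of_pos (σ := σ) hd0 hp hr hr1 h hx
      have h2 : max (W x - I x) 0 ≤ c * ((r - ‖x‖) * ‖fderiv ℝ h x‖) ^ p +
          if ‖x‖ < θ * r then (d + 1) * |h x| ^ p else 0 := by
        have h3 : 0 ≤ r - ‖x‖ := by linarith
        refine max_le ?_ (by positivity)
        simp only [W, I]
        linarith
      refine (ENNReal.ofReal_le_ofReal h2).trans (ENNReal.ofReal_add_le.trans ?_)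
      refine add_le_add ?_ ?_
      · rw [Set.indicator_of_mem (by simpa using hx), ENNReal.ofReal_mul hc0,
          ← ofReal_norm, ENNReal.ofReal_rpow_of_nonneg (norm_nonneg _) hp0, norm_smul,
          Real.norm_of_nonneg (by linarith)]
      · split_ifs with hx2
        · rw [Set.indicator_of_mem (by simpa using hx2), hp0', ENNReal.ofReal_mul (by positivity)]
        · simp
    · have h1 : W x = 0 := by
        simp only [hW]
        rw [hardyWeight_of_nonpos (hout x hx)]
        simp
      have h2 : I x = 0 := by
        simp only [hIdef]
        rw [hardyWeight_of_nonpos (hout x hx), expNegInvGlue.zero_of_nonpos (hout x hx)]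
        simp
      rw [h1, h2]
      simp
  have step1 : ∫⁻ x, ENNReal.ofReal (W x) ≤ ∫⁻ x, R x := by
    calc ∫⁻ x, ENNReal.ofReal (W x) = ENNReal.ofReal (∫ x, W x) :=
          (ofReal_integral_eq_lintegral_ofReal hWI (.of_forall hW0)).symm
      _ = ENNReal.ofReal (∫ x, (W x - I x)) := by
          rw [integral_sub hWI hI, hI0, sub_zero]
      _ ≤ ENNReal.ofReal (∫ x, max (W x - I x) 0) := by
          refine ENNReal.ofReal_le_ofReal (integral_mono (hWI.sub hI) (hWI.sub hI).pos_part ?_)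
          exact fun x => le_max_left _ _
      _ = ∫⁻ x, ENNReal.ofReal (max (W x - I x) 0) :=
          ofReal_integral_eq_lintegral_ofReal (hWI.sub hI).pos_part
            (.of_forall fun x => le_max_right _ _)
      _ ≤ _ := lintegral_mono key
  have hDc : Continuous fun x => (r - ‖x‖) • fderiv ℝ h x :=
    (continuous_const.sub continuous_norm).smul (hh.continuous_fderiv (by simp))
  have step2 : ∫⁻ x, R x = ENNReal.ofReal c *
      (∫⁻ x in Metric.ball 0 r, ‖(r - ‖x‖) • fderiv ℝ h x‖ₑ ^ p) +
      ENNReal.ofReal (d + 1) * ∫⁻ x in Metric.ball 0 (θ * r), ‖h x‖ₑ ^ p := by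
    have m1 : Measurable fun x => ‖(r - ‖x‖) • fderiv ℝ h x‖ₑ ^ p :=
      hDc.enorm.measurable.pow_const p
    have m2 : Measurable fun x => ‖h x‖ₑ ^ p := hhc.enorm.measurable.pow_const p
    rw [hR, lintegral_add_left ((m1.const_mul _).indicator measurableSet_ball),
      lintegral_indicator measurableSet_ball, lintegral_indicator measurableSet_ball,
      lintegral_const_mul _ m1, lintegral_const_mul _ m2]
  have step3 : ∫⁻ x in Metric.ball 0 r', ‖h x‖ₑ ^ p ≤
      ENNReal.ofReal (8 * Real.exp 1) * ∫⁻ x, ENNReal.ofReal (W x) := by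
    rw [← lintegral_const_mul _ hWc.measurable.ennreal_ofReal]
    refine (setLIntegral_mono' measurableSet_ball fun x hx => ?_).trans
        (setLIntegral_le_lintegral _ _)
    have hx' : ‖x‖ < r' := by simpa using hx
    rw [hp0', ← ENNReal.ofReal_mul (by positivity)]
    refine ENNReal.ofReal_le_ofReal ?_
    have h1 : 1 ≤ (r ^ 2 - ‖x‖ ^ 2) / σ := by
      rw [one_le_div hσ]
      simp only [σ]
      nlinarith [norm_nonneg x]
    have h2 := exp_neg_one_le_hardyWeight h1
    have h3 : Real.exp 1 * Real.exp (-1) = 1 := by rw [← Real.exp_add]; simp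
    simp only [hW]
    calc |h x| ^ p = Real.exp 1 * Real.exp (-1) * |h x| ^ p := by rw [h3, one_mul]
      _ ≤ Real.exp 1 * hardyWeight ((r ^ 2 - ‖x‖ ^ 2) / σ) * |h x| ^ p := by gcongr
      _ = _ := by ring
  refine step3.trans ((mul_le_mul_right (step1.trans_eq step2) _).trans ?_)
  have h8 : (((8 * Real.exp 1 * (c + (d + 1))).toNNReal : NNReal) : ℝ≥0∞) =
      ENNReal.ofReal (8 * Real.exp 1) * ENNReal.ofReal (c + (d + 1)) := by
    rw [← ENNReal.ofReal_mul (by positivity)]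
    rfl
  rw [h8, mul_assoc]
  gcongr
  rw [mul_add]
  have hc1 : c ≤ c + (d + 1) := by linarith
  have hd1 : d + 1 ≤ c + (d + 1) := by linarith
  exact add_le_add (mul_le_mul_left (ENNReal.ofReal_le_ofReal hc1) _)
    (mul_le_mul_left (ENNReal.ofReal_le_ofReal hd1) _)

end Hardy

section Averages

variable {E : Type*} [NormedAddCommGroup E] [InnerProductSpace ℝ E] [FiniteDimensional ℝ E]
  [MeasurableSpace E] [BorelSpace E]

lemma setLIntegral_ball_comp_add_smul {F : E → ℝ≥0∞} (hF : Measurable F) (x : E) {s : ℝ}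
    (hs : 0 < s) :
    ∫⁻ z in Metric.ball 0 1, F (x + s • z) =
      ENNReal.ofReal (s ^ Module.finrank ℝ E)⁻¹ * ∫⁻ y in Metric.ball x s, F y := by
  have hm : Measurable ((Metric.ball x s).indicator F) := hF.indicator measurableSet_ball
  have hm' : Measurable fun y => (Metric.ball x s).indicator F (x + y) :=
    hm.comp (measurable_const_add x)
  have h1 : ∀ z : E, (Metric.ball x s).indicator F (x + s • z) =
      (Metric.ball 0 1).indicator (fun z => F (x + s • z)) z := fun z => by
    have : x + s • z ∈ Metric.ball x s ↔ z ∈ Metric.ball (0 : E) 1 := by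
      rw [Metric.mem_ball, dist_eq_norm, add_sub_cancel_left, norm_smul, Real.norm_of_nonneg hs.le,
        mem_ball_zero_iff]
      exact ⟨fun h => by nlinarith, fun h => by nlinarith⟩
    by_cases hz : z ∈ Metric.ball (0 : E) 1
    · rw [Set.indicator_of_mem hz, Set.indicator_of_mem (this.2 hz)]
    · rw [Set.indicator_of_notMem hz, Set.indicator_of_notMem (mt this.1 hz)]
  rw [← lintegral_indicator measurableSet_ball, ← lintegral_indicator measurableSet_ball,
    ← lintegral_add_left_eq_self ((Metric.ball x s).indicator F) x]
  simp_rw [← h1]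
  rw [← lintegral_map (f := fun y => (Metric.ball x s).indicator F (x + y))
      (g := fun z : E => s • z) hm' (measurable_const_smul s),
    Measure.map_addHaar_smul _ hs.ne', lintegral_smul_measure, abs_of_pos (by positivity)]
  rfl

lemma lintegral_ball_lintegral_comp_add_smul_le {F : E → ℝ≥0∞} (hF : Measurable F) (r : ℝ) :
    ∫⁻ x in Metric.ball 0 r, ∫⁻ z in Metric.ball 0 1, F (x + ((r - ‖x‖) / 2) • z) ≤
      3 ^ Module.finrank ℝ E * volume (Metric.ball (0 : E) 1) *
        ∫⁻ x in Metric.ball 0 r, F x := by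
  set d := Module.finrank ℝ E
  set S : Set (E × E) := {q | ‖q.1 - q.2‖ < r - ‖q.2‖} with hS
  have hSm : MeasurableSet S := by
    apply IsOpen.measurableSet
    exact isOpen_lt (by fun_prop) (by fun_prop)
  set G : E × E → ℝ≥0∞ := fun q => ENNReal.ofReal ((3 / (r - ‖q.2‖)) ^ d) * F q.2 with hG
  have hGm : Measurable G := by
    refine Measurable.mul ?_ (hF.comp measurable_snd)
    exact (by fun_prop : Measurable fun q : E × E => (3 / (r - ‖q.2‖)) ^ d).ennreal_ofReal
  calc _ ≤ ∫⁻ x in Metric.ball 0 r, ∫⁻ y in Metric.ball 0 r, S.indicator G (x, y) := by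
        refine setLIntegral_mono' measurableSet_ball fun x hx => ?_
        have hx' : ‖x‖ < r := by simpa using hx
        set s := (r - ‖x‖) / 2 with hs
        have hs0 : 0 < s := by rw [hs]; linarith
        rw [setLIntegral_ball_comp_add_smul hF x hs0, ← lintegral_const_mul _ hF,
          ← lintegral_indicator measurableSet_ball, ← lintegral_indicator measurableSet_ball]
        refine lintegral_mono fun y => ?_
        by_cases hy : y ∈ Metric.ball x s
        · have hy' : ‖x - y‖ < s := by rwa [mem_ball_iff_norm'] at hy
          have h1 := norm_sub_norm_le x y
          have h2 := norm_sub_norm_le y x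
          rw [norm_sub_rev] at h2
          have h3 : (x, y) ∈ S := by
            simp only [hS, Set.mem_ofPred_eq]
            linarith
          have h4 : y ∈ Metric.ball (0 : E) r := by
            rw [mem_ball_zero_iff]
            linarith
          rw [Set.indicator_of_mem hy, Set.indicator_of_mem h4, Set.indicator_of_mem h3]
          simp only [hG]
          gcongr
          rw [← inv_pow]
          have h5 : 0 < r - ‖y‖ := by linarith
          have h6 : s⁻¹ ≤ 3 / (r - ‖y‖) := by
            rw [inv_eq_one_div, div_le_div_iff₀ hs0 h5]
            linarith
          gcongr
        · rw [Set.indicator_of_notMem hy]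
          exact zero_le
    _ = ∫⁻ y in Metric.ball 0 r, ∫⁻ x in Metric.ball 0 r, S.indicator G (x, y) :=
        lintegral_lintegral_swap (hGm.indicator hSm).aemeasurable
    _ ≤ ∫⁻ y in Metric.ball 0 r, 3 ^ d * volume (Metric.ball (0 : E) 1) * F y := by
        refine setLIntegral_mono' measurableSet_ball fun y hy => ?_
        have hy' : ‖y‖ < r := by simpa using hy
        have hρ : 0 < r - ‖y‖ := by linarith
        have h1 : ∀ x, S.indicator G (x, y) = (Metric.ball y (r - ‖y‖)).indicator
            (fun _ => ENNReal.ofReal ((3 / (r - ‖y‖)) ^ d) * F y) x := fun x => by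
          by_cases hx : x ∈ Metric.ball y (r - ‖y‖)
          · have h3 : (x, y) ∈ S := by rwa [mem_ball_iff_norm] at hx
            rw [Set.indicator_of_mem hx, Set.indicator_of_mem h3]
          · have h3 : (x, y) ∉ S := by rwa [mem_ball_iff_norm] at hx
            rw [Set.indicator_of_notMem hx, Set.indicator_of_notMem h3]
        refine (setLIntegral_le_lintegral _ _).trans ?_
        simp_rw [h1]
        rw [lintegral_indicator measurableSet_ball, setLIntegral_const,
          Measure.addHaar_ball_of_pos _ _ hρ]
        have h2 : ENNReal.ofReal ((3 / (r - ‖y‖)) ^ d) * ENNReal.ofReal ((r - ‖y‖) ^ d) =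
            3 ^ d := by
          rw [← ENNReal.ofReal_mul (by positivity), ← mul_pow, div_mul_cancel₀ _ hρ.ne',
            ENNReal.ofReal_pow (by norm_num)]
          simp
        rw [← h2]
        apply le_of_eq
        ring
    _ = _ := lintegral_const_mul _ hF

/-- Averaging over balls whose radius is comparable to the distance to the boundary is bounded
in `L^p`. -/
theorem lintegral_average_le {p : ℝ} (hp : 1 < p) {ζ : E → ℝ} (hζ : Continuous ζ)
    (hζ0 : ∀ z, 1 ≤ ‖z‖ → ζ z = 0) : ∃ C : NNReal, ∀ (r : ℝ) (w : E → ℝ), Continuous w →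
    ∫⁻ x in Metric.ball 0 r, ‖∫ z, w (x + ((r - ‖x‖) / 2) • z) * ζ z‖ₑ ^ p ≤
      C * ∫⁻ x in Metric.ball 0 r, ‖w x‖ₑ ^ p := by
  have hp0 : 0 ≤ p := by linarith
  obtain ⟨M, hM⟩ := hζ.bounded_above_of_compact_support (hasCompactSupport_of_forall_one_le hζ0)
  set V := volume (Metric.ball (0 : E) 1)
  have hV : V ≠ ∞ := measure_ball_lt_top.ne
  set A : ℝ≥0∞ := ENNReal.ofReal M ^ p * V ^ (p - 1) * (3 ^ Module.finrank ℝ E * V)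
  have hA1 : ENNReal.ofReal M ^ p * V ^ (p - 1) ≠ ∞ :=
    ENNReal.mul_ne_top (ENNReal.rpow_ne_top_of_nonneg hp0 ENNReal.ofReal_ne_top)
      (ENNReal.rpow_ne_top_of_nonneg (by linarith) hV)
  have hA : A ≠ ∞ := ENNReal.mul_ne_top hA1 (ENNReal.mul_ne_top (by simp) hV)
  refine ⟨A.toNNReal, fun r w hw => ?_⟩
  rw [ENNReal.coe_toNNReal hA]
  have hF : Measurable fun x => ‖w x‖ₑ ^ p := hw.enorm.measurable.pow_const p
  have h1 : ∀ x, ‖∫ z, w (x + ((r - ‖x‖) / 2) • z) * ζ z‖ₑ ^ p ≤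
      ENNReal.ofReal M ^ p * V ^ (p - 1) *
      ∫⁻ z in Metric.ball 0 1, ‖w (x + ((r - ‖x‖) / 2) • z)‖ₑ ^ p := fun x => by
    have hwx : Continuous fun z => w (x + ((r - ‖x‖) / 2) • z) := by fun_prop
    calc _ ≤ (ENNReal.ofReal M * ∫⁻ z in Metric.ball 0 1, ‖w (x + ((r - ‖x‖) / 2) • z)‖ₑ) ^ p := by
          gcongr
          refine (enorm_integral_le_lintegral_enorm _).trans ?_
          rw [← lintegral_const_mul _ hwx.enorm.measurable, ← lintegral_indicator
              measurableSet_ball]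
          refine lintegral_mono fun z => ?_
          by_cases hz : z ∈ Metric.ball (0 : E) 1
          · rw [Set.indicator_of_mem hz, enorm_mul, mul_comm]
            gcongr
            rw [← ofReal_norm]
            exact ENNReal.ofReal_le_ofReal (hM z)
          · rw [Set.indicator_of_notMem hz, hζ0 z (by simpa using hz)]
            simp
      _ ≤ ENNReal.ofReal M ^ p * (V ^ (p - 1) *
          ∫⁻ z in Metric.ball 0 1, ‖w (x + ((r - ‖x‖) / 2) • z)‖ₑ ^ p) := by
          rw [ENNReal.mul_rpow_of_nonneg _ _ hp0]
          gcongr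
          refine (lintegral_rpow_le_rpow_mul_lintegral _ hp
              hwx.enorm.measurable.aemeasurable).trans_eq ?_
          rw [Measure.restrict_apply_univ]
      _ = _ := by rw [mul_assoc]
  calc _ ≤ ∫⁻ x in Metric.ball 0 r, ENNReal.ofReal M ^ p * V ^ (p - 1) *
      ∫⁻ z in Metric.ball 0 1, ‖w (x + ((r - ‖x‖) / 2) • z)‖ₑ ^ p := lintegral_mono h1
    _ = ENNReal.ofReal M ^ p * V ^ (p - 1) * ∫⁻ x in Metric.ball 0 r,
        ∫⁻ z in Metric.ball 0 1, ‖w (x + ((r - ‖x‖) / 2) • z)‖ₑ ^ p :=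
      lintegral_const_mul' _ _ hA1
    _ ≤ ENNReal.ofReal M ^ p * V ^ (p - 1) * (3 ^ Module.finrank ℝ E * V *
        ∫⁻ x in Metric.ball 0 r, ‖w x‖ₑ ^ p) := by
      gcongr
      exact lintegral_ball_lintegral_comp_add_smul_le hF r
    _ = _ := by simp only [A]; ring

end Averages

section LpBounds

variable {α : Type*} [MeasurableSpace α] {μ : Measure α} {p : ℝ}

lemma lintegral_enorm_add_rpow_le (hp : 1 ≤ p) {f g : α → ℝ} (hf : Measurable f) {A B : ℝ≥0∞}
    (hA : ∫⁻ x, ‖f x‖ₑ ^ p ∂μ ≤ A) (hB : ∫⁻ x, ‖g x‖ₑ ^ p ∂μ ≤ B) :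
    ∫⁻ x, ‖f x + g x‖ₑ ^ p ∂μ ≤ 2 ^ (p - 1) * (A + B) := by
  calc _ ≤ ∫⁻ x, 2 ^ (p - 1) * (‖f x‖ₑ ^ p + ‖g x‖ₑ ^ p) ∂μ := by
        refine lintegral_mono fun x => ?_
        calc ‖f x + g x‖ₑ ^ p ≤ (‖f x‖ₑ + ‖g x‖ₑ) ^ p := by
              gcongr
              exact enorm_add_le _ _
          _ ≤ _ := ENNReal.rpow_add_le_mul_rpow_add_rpow _ _ hp
    _ = 2 ^ (p - 1) * (∫⁻ x, ‖f x‖ₑ ^ p ∂μ + ∫⁻ x, ‖g x‖ₑ ^ p ∂μ) := by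
        rw [lintegral_const_mul' _ _ (ENNReal.rpow_ne_top_of_nonneg (by linarith) (by simp)),
          lintegral_add_left (hf.enorm.pow_const p)]
    _ ≤ _ := by gcongr

lemma lintegral_sum_rpow_le (hp : 1 ≤ p) {κ : Type*} (s : Finset κ) {f : κ → α → ℝ≥0∞}
    (hf : ∀ j, Measurable (f j)) {B : ℝ≥0∞} (hB : ∀ j, ∫⁻ x, f j x ^ p ∂μ ≤ B) :
    ∫⁻ x, (∑ j ∈ s, f j x) ^ p ∂μ ≤ (s.card : ℝ≥0∞) ^ p * B := by
  have hc : (s.card : ℝ≥0∞) ^ (p - 1) * s.card = (s.card : ℝ≥0∞) ^ p := by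
    rcases s.card.eq_zero_or_pos with h | h
    · simp [h, show 0 < p by linarith]
    · have h0 : (s.card : ℝ≥0∞) ≠ 0 := by exact_mod_cast h.ne'
      nth_rw 2 [← ENNReal.rpow_one (s.card : ℝ≥0∞)]
      rw [← ENNReal.rpow_add _ _ h0 (by simp), sub_add_cancel]
  calc _ ≤ ∫⁻ x, (s.card : ℝ≥0∞) ^ (p - 1) * ∑ j ∈ s, f j x ^ p ∂μ :=
        lintegral_mono fun x => ENNReal.rpow_sum_le_const_mul_sum_rpow s _ hp
    _ = (s.card : ℝ≥0∞) ^ (p - 1) * ∑ j ∈ s, ∫⁻ x, f j x ^ p ∂μ := by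
        rw [lintegral_const_mul' _ _ (ENNReal.rpow_ne_top_of_nonneg (by linarith) (by simp)),
          lintegral_finsetSum _ fun j _ => (hf j).pow_const p]
    _ ≤ (s.card : ℝ≥0∞) ^ (p - 1) * ∑ j ∈ s, B := by
        gcongr with j
        exact hB j
    _ = _ := by rw [Finset.sum_const, nsmul_eq_mul, ← mul_assoc, hc]

lemma lintegral_enorm_const_mul_rpow (hp : 0 ≤ p) (c : ℝ) (f : α → ℝ) :
    ∫⁻ x, ‖c * f x‖ₑ ^ p ∂μ = ‖c‖ₑ ^ p * ∫⁻ x, ‖f x‖ₑ ^ p ∂μ := by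
  simp_rw [enorm_mul, ENNReal.mul_rpow_of_nonneg _ _ hp]
  exact lintegral_const_mul' _ _ (ENNReal.rpow_ne_top_of_nonneg hp (by simp))

end LpBounds

section DirDeriv

variable {E : Type*} [NormedAddCommGroup E] [InnerProductSpace ℝ E] {ι : Type*} [Fintype ι]

lemma norm_fderiv_le_sum (b : OrthonormalBasis ι ℝ E) (f : E → ℝ) (x : E) :
    ‖fderiv ℝ f x‖ ≤ ∑ l, ‖dirDeriv (b l) f x‖ := by
  refine ContinuousLinearMap.opNorm_le_bound _ (Finset.sum_nonneg fun _ _ => norm_nonneg _) fun v =>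
      ?_
  conv_lhs => rw [← b.sum_repr' v]
  rw [map_sum, Finset.sum_mul]
  refine (norm_sum_le _ _).trans (Finset.sum_le_sum fun l _ => ?_)
  rw [map_smul, norm_smul, mul_comm]
  refine mul_le_mul_of_nonneg_left ?_ (norm_nonneg _)
  simpa [b.norm_eq_one l] using norm_inner_le_norm (𝕜 := ℝ) (b l) v

/-- A family with `∂ₗ Hᵢₖ = ∂ₖ Hᵢₗ` is determined, up to constants, by its symmetric part. -/
lemma dirDeriv_eq_of_swap (b : OrthonormalBasis ι ℝ E) {H : ι → ι → E → ℝ}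
    (hH : ∀ i k, ContDiff ℝ (⊤ : ℕ∞) (H i k))
    (hsw : ∀ i k l, dirDeriv (b l) (H i k) = dirDeriv (b k) (H i l)) (i k l : ι) (x : E) :
    dirDeriv (b l) (H i k) x = dirDeriv (b l) (fun x => (1 / 2) * (H i k x + H k i x)) x +
      dirDeriv (b k) (fun x => (1 / 2) * (H i l x + H l i x)) x -
      dirDeriv (b i) (fun x => (1 / 2) * (H k l x + H l k x)) x := by
  rw [dirDeriv_const_mul ((hH i k).add (hH k i)), dirDeriv_const_mul ((hH i l).add (hH l i)),
    dirDeriv_const_mul ((hH k l).add (hH l k)), dirDeriv_add (hH i k) (hH k i),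
    dirDeriv_add (hH i l) (hH l i), dirDeriv_add (hH k l) (hH l k), hsw i l k, hsw k i l, hsw l i k]
  ring

lemma dirDeriv_eq_zero_of_one_le {η : E → ℝ} (hη : ContDiff ℝ (⊤ : ℕ∞) η)
    (hη0 : ∀ z, 1 ≤ ‖z‖ → η z = 0) (a : E) {z : E} (hz : 1 ≤ ‖z‖) : dirDeriv a η z = 0 := by
  have h1 : ∀ t : ℝ, 1 < t → dirDeriv a η (t • z) = 0 := fun t ht => by
    have ho : IsOpen {y : E | 1 < ‖y‖} := isOpen_lt continuous_const continuous_norm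
    have hm : t • z ∈ {y : E | 1 < ‖y‖} := by
      change 1 < ‖t • z‖
      rw [norm_smul, Real.norm_of_nonneg (by linarith)]
      nlinarith
    rw [dirDeriv_congr_of_isOpen (g := fun _ => 0) ho (fun y hy => hη0 y (le_of_lt hy)) a hm]
    simp [dirDeriv]
  have hc : Continuous fun t : ℝ => dirDeriv a η (t • z) :=
    (hη.dirDeriv a).continuous.comp (by fun_prop)
  have h2 : Filter.Tendsto (fun t : ℝ => dirDeriv a η (t • z)) (nhdsWithin 1 (Set.Ioi 1))
      (nhds (dirDeriv a η ((1 : ℝ) • z))) := (hc.tendsto 1).mono_left nhdsWithin_le_nhds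
  rw [one_smul] at h2
  refine tendsto_nhds_unique h2 (tendsto_const_nhds.congr' ?_)
  filter_upwards [self_mem_nhdsWithin] with t ht using (h1 t ht).symm

end DirDeriv

section Harmonic

variable {E : Type*} [NormedAddCommGroup E] [InnerProductSpace ℝ E] [FiniteDimensional ℝ E]
  [MeasurableSpace E] [BorelSpace E] {ι : Type*} [Fintype ι]

lemma measurable_average {w ζ : E → ℝ} (hw : Continuous w) (hζ : Continuous ζ) (r : ℝ) :
    Measurable fun x => ∫ z, w (x + ((r - ‖x‖) / 2) • z) * ζ z := by
  have : Continuous fun q : E × E => w (q.1 + ((r - ‖q.1‖) / 2) • q.2) * ζ q.2 := by fun_prop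
  exact this.stronglyMeasurable.integral_prod_right.measurable

/-- A harmonic family with `∂ₗ Hᵢₖ = ∂ₖ Hᵢₗ` has its weighted derivative controlled by its
symmetric part. -/
lemma lintegral_ball_dirDeriv_le (b : OrthonormalBasis ι ℝ E) {p : ℝ} (hp : 1 < p) :
    ∃ C : NNReal, ∀ (r : ℝ) (H : ι → ι → E → ℝ) (B : ℝ≥0∞),
    (∀ i k, ContDiff ℝ (⊤ : ℕ∞) (H i k)) →
    (∀ i k l, dirDeriv (b l) (H i k) = dirDeriv (b k) (H i l)) →
    (∀ i k, ∀ x ∈ Metric.ball 0 r, ∑ l, dirDeriv (b l) (dirDeriv (b l) (H i k)) x = 0) →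
    (∀ i k, ∫⁻ x in Metric.ball 0 r, ‖(1 / 2) * (H i k x + H k i x)‖ₑ ^ p ≤ B) →
    ∀ i k l, ∫⁻ x in Metric.ball 0 r, ‖(r - ‖x‖) * dirDeriv (b l) (H i k) x‖ₑ ^ p ≤ C * B := by
  have hp0 : 0 ≤ p := by linarith
  obtain ⟨η, hη, hηc, hη0, hmv⟩ := exists_meanValue_kernel b
  have hdη : ∀ l, ContDiff ℝ (⊤ : ℕ∞) (dirDeriv (b l) η) := fun l => hη.dirDeriv (b l)
  have hav : ∀ l, ∃ C : NNReal, ∀ (r : ℝ) (w : E → ℝ), Continuous w →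
      ∫⁻ x in Metric.ball 0 r, ‖∫ z, w (x + ((r - ‖x‖) / 2) • z) * dirDeriv (b l) η z‖ₑ ^ p ≤
        C * ∫⁻ x in Metric.ball 0 r, ‖w x‖ₑ ^ p := fun l =>
    lintegral_average_le hp (hdη l).continuous fun z hz => dirDeriv_eq_zero_of_one_le hη hη0 _ hz
  choose C hC using hav
  set D : NNReal := ∑ l, C l with hD
  have hCD : ∀ l, C l ≤ D := fun l => Finset.single_le_sum (fun _ _ => zero_le) (Finset.mem_univ l)
  set K : ℝ≥0∞ := 2 ^ (p - 1) * (2 ^ (p - 1) * (‖(-2 : ℝ)‖ₑ ^ p * D + ‖(-2 : ℝ)‖ₑ ^ p * D) +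
    ‖(2 : ℝ)‖ₑ ^ p * D) with hK
  have hKt : K ≠ ∞ := by
    have h1 : ∀ c : ℝ, ‖c‖ₑ ^ p * (D : ℝ≥0∞) ≠ ∞ := fun c =>
      ENNReal.mul_ne_top (ENNReal.rpow_ne_top_of_nonneg hp0 (by simp)) (by simp)
    have h2 : (2 : ℝ≥0∞) ^ (p - 1) ≠ ∞ := ENNReal.rpow_ne_top_of_nonneg (by linarith) (by simp)
    exact ENNReal.mul_ne_top h2 (ENNReal.add_ne_top.2
      ⟨ENNReal.mul_ne_top h2 (ENNReal.add_ne_top.2 ⟨h1 _, h1 _⟩), h1 _⟩)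
  refine ⟨K.toNNReal, fun r H B hH hsw hharm hB i k l => ?_⟩
  rw [ENNReal.coe_toNNReal hKt]
  set ε : ι → ι → E → ℝ := fun i k x => (1 / 2) * (H i k x + H k i x) with hε
  have hεs : ∀ i k, ContDiff ℝ (⊤ : ℕ∞) (ε i k) := fun i k =>
    contDiff_const.mul ((hH i k).add (hH k i))
  set A : ι → ι → ι → E → ℝ := fun l i k x =>
    ∫ z, ε i k (x + ((r - ‖x‖) / 2) • z) * dirDeriv (b l) η z with hA
  have hAm : ∀ l i k, Measurable (A l i k) := fun l i k =>
    measurable_average (hεs i k).continuous (hdη l).continuous r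
  have hAb : ∀ l i k (c : ℝ), ∫⁻ x in Metric.ball 0 r, ‖c * A l i k x‖ₑ ^ p ≤
      ‖c‖ₑ ^ p * D * B := fun l i k c => by
    rw [lintegral_enorm_const_mul_rpow hp0, mul_assoc]
    gcongr
    refine (hC l r _ (hεs i k).continuous).trans ?_
    gcongr
    · exact hCD l
    · exact hB i k
  have hrep : ∀ x ∈ Metric.ball (0 : E) r, (r - ‖x‖) * dirDeriv (b l) (H i k) x =
      (-2 * A l i k x + -2 * A k i l x) + 2 * A i k l x := fun x hx => by
    have hx' : ‖x‖ < r := by simpa using hx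
    have hg : ContDiff ℝ (⊤ : ℕ∞) (dirDeriv (b l) (H i k)) := (hH i k).dirDeriv _
    have hharm' : ∀ y ∈ Metric.ball (0 : E) r,
        ∑ m, dirDeriv (b m) (dirDeriv (b m) (dirDeriv (b l) (H i k))) y = 0 := fun y hy => by
      have h1 : ∀ m, dirDeriv (b m) (dirDeriv (b m) (dirDeriv (b l) (H i k))) =
          dirDeriv (b l) (dirDeriv (b m) (dirDeriv (b m) (H i k))) := fun m => by
        rw [dirDeriv_comm (hH i k), dirDeriv_comm ((hH i k).dirDeriv _)]
      simp_rw [h1]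
      have h2 := congrFun (dirDeriv_sum Finset.univ
        (fun m => ((hH i k).dirDeriv (b m)).dirDeriv (b m)) (b l)) y
      rw [← h2, dirDeriv_congr_of_isOpen (g := fun _ => 0) Metric.isOpen_ball (hharm i k) _ hy]
      simp [dirDeriv]
    have hm := hmv _ hg r ((r - ‖x‖) / 2) x (by linarith) (by linarith) hharm'
    have hci : ∀ a i k, Integrable fun z =>
        dirDeriv (b a) (ε i k) (x + ((r - ‖x‖) / 2) • z) * η z := fun a i k =>
      (Continuous.mul (((hεs i k).dirDeriv (b a)).continuous.comp (by fun_prop))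
        hη.continuous).integrable_of_hasCompactSupport hηc.mul_left
    have hpt : ∀ z, dirDeriv (b l) (H i k) (x + ((r - ‖x‖) / 2) • z) * η z =
        dirDeriv (b l) (ε i k) (x + ((r - ‖x‖) / 2) • z) * η z +
        dirDeriv (b k) (ε i l) (x + ((r - ‖x‖) / 2) • z) * η z -
        dirDeriv (b i) (ε k l) (x + ((r - ‖x‖) / 2) • z) * η z := fun z => by
      rw [dirDeriv_eq_of_swap b hH hsw i k l]
      ring
    rw [← hm]
    simp_rw [hpt]
    have hi : Integrable fun z => dirDeriv (b l) (ε i k) (x + ((r - ‖x‖) / 2) • z) * η z +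
        dirDeriv (b k) (ε i l) (x + ((r - ‖x‖) / 2) • z) * η z := (hci l i k).add (hci k i l)
    rw [integral_sub hi (hci _ _ _),
      integral_add (hci _ _ _) (hci _ _ _)]
    have e1 := mul_integral_dirDeriv_comp_mul (hεs i k) hη hηc (b l) x ((r - ‖x‖) / 2)
    have e2 := mul_integral_dirDeriv_comp_mul (hεs i l) hη hηc (b k) x ((r - ‖x‖) / 2)
    have e3 := mul_integral_dirDeriv_comp_mul (hεs k l) hη hηc (b i) x ((r - ‖x‖) / 2)
    simp only [hA]
    linear_combination 2 * e1 + 2 * e2 - 2 * e3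
  rw [setLIntegral_congr_fun measurableSet_ball fun x hx => by rw [hrep x hx]]
  refine (lintegral_enorm_add_rpow_le hp.le (by fun_prop) (lintegral_enorm_add_rpow_le hp.le
    (by fun_prop) (hAb l i k (-2)) (hAb k i l (-2))) (hAb i k l 2)).trans_eq ?_
  rw [hK]
  ring

/-- Interior estimate for a harmonic function of the form `∂ₖ u - V`. -/
lemma lintegral_ball_harmonic_le (b : OrthonormalBasis ι ℝ E) {p : ℝ} (hp : 1 < p) {θ : ℝ}
    (hθ : θ < 1) :
    ∃ C : NNReal, ∀ (r : ℝ) (u V : E → ℝ) (k : ι) (B : ℝ≥0∞), 1 / 2 ≤ r →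
    ContDiff ℝ (⊤ : ℕ∞) u → ContDiff ℝ (⊤ : ℕ∞) V →
    (∀ x ∈ Metric.ball 0 r,
      ∑ l, dirDeriv (b l) (dirDeriv (b l) (fun x => dirDeriv (b k) u x - V x)) x = 0) →
    ∫⁻ x in Metric.ball 0 r, ‖u x‖ₑ ^ p ≤ B → ∫⁻ x in Metric.ball 0 r, ‖V x‖ₑ ^ p ≤ B →
    ∫⁻ x in Metric.ball 0 (θ * r), ‖dirDeriv (b k) u x - V x‖ₑ ^ p ≤ C * B := by
  have hp0 : 0 ≤ p := by linarith
  obtain ⟨η, hη, hηc, hη0, hmv⟩ := exists_meanValue_kernel b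
  have hdη : ∀ l, ContDiff ℝ (⊤ : ℕ∞) (dirDeriv (b l) η) := fun l => hη.dirDeriv (b l)
  have hav : ∀ l, ∃ C : NNReal, ∀ (r : ℝ) (w : E → ℝ), Continuous w →
      ∫⁻ x in Metric.ball 0 r, ‖∫ z, w (x + ((r - ‖x‖) / 2) • z) * dirDeriv (b l) η z‖ₑ ^ p ≤
        C * ∫⁻ x in Metric.ball 0 r, ‖w x‖ₑ ^ p := fun l =>
    lintegral_average_le hp (hdη l).continuous fun z hz => dirDeriv_eq_zero_of_one_le hη hη0 _ hz
  choose C hC using hav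
  obtain ⟨C₀, hC₀⟩ := lintegral_average_le hp hη.continuous hη0
  set D : NNReal := ∑ l, C l with hD
  have hCD : ∀ l, C l ≤ D := fun l => Finset.single_le_sum (fun _ _ => zero_le) (Finset.mem_univ l)
  set c : ℝ := 4 / (1 - θ) with hc
  have hc0 : 0 ≤ c := div_nonneg (by norm_num) (by linarith)
  set K : ℝ≥0∞ := 2 ^ (p - 1) * (‖c‖ₑ ^ p * D + C₀) with hK
  have hKt : K ≠ ∞ := by
    have h2 : (2 : ℝ≥0∞) ^ (p - 1) ≠ ∞ := ENNReal.rpow_ne_top_of_nonneg (by linarith) (by simp)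
    exact ENNReal.mul_ne_top h2 (ENNReal.add_ne_top.2
      ⟨ENNReal.mul_ne_top (ENNReal.rpow_ne_top_of_nonneg hp0 (by simp)) (by simp), by simp⟩)
  refine ⟨K.toNNReal, fun r u V k B hr hu hV hharm hBu hBV => ?_⟩
  rw [ENNReal.coe_toNNReal hKt]
  set Au : E → ℝ := fun x => ∫ z, u (x + ((r - ‖x‖) / 2) • z) * dirDeriv (b k) η z with hAu
  set AV : E → ℝ := fun x => ∫ z, V (x + ((r - ‖x‖) / 2) • z) * η z with hAV
  have hAum : Measurable Au := measurable_average hu.continuous (hdη k).continuous r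
  have hbound : ∀ x ∈ Metric.ball (0 : E) (θ * r), ‖dirDeriv (b k) u x - V x‖ₑ ≤
      ‖c * |Au x| + |AV x|‖ₑ := fun x hx => by
    have hx' : ‖x‖ < θ * r := by simpa using hx
    set s := (r - ‖x‖) / 2 with hs
    have hs0 : c⁻¹ ≤ s := by
      rw [hc, inv_div, hs]
      nlinarith
    have hcp : 0 < c := div_pos (by norm_num) (by linarith)
    have hsp : 0 < s := lt_of_lt_of_le (by positivity) hs0
    have hg : ContDiff ℝ (⊤ : ℕ∞) fun x => dirDeriv (b k) u x - V x := (hu.dirDeriv _).sub hV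
    have hm := hmv _ hg r s x hsp.le (by rw [hs]; nlinarith [norm_nonneg x]) hharm
    have i1 : Integrable fun z => dirDeriv (b k) u (x + s • z) * η z :=
      (Continuous.mul ((hu.dirDeriv (b k)).continuous.comp (by fun_prop))
        hη.continuous).integrable_of_hasCompactSupport hηc.mul_left
    have i2 : Integrable fun z => V (x + s • z) * η z :=
      (Continuous.mul (hV.continuous.comp (by fun_prop))
        hη.continuous).integrable_of_hasCompactSupport hηc.mul_left
    simp_rw [sub_mul] at hm
    rw [integral_sub i1 i2] at hm
    have e1 := mul_integral_dirDeriv_comp_mul hu hη hηc (b k) x s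
    have e2 : ∫ z, dirDeriv (b k) u (x + s • z) * η z = -(s⁻¹ * Au x) := by
      rw [hAu, ← mul_right_inj' hsp.ne', e1, mul_neg, ← mul_assoc, mul_inv_cancel₀ hsp.ne', one_mul]
    rw [← hm, e2, enorm_le_iff_norm_le, Real.norm_eq_abs, Real.norm_eq_abs]
    have h3 : s⁻¹ ≤ c := inv_le_of_inv_le₀ hcp hs0
    calc |-(s⁻¹ * Au x) - AV x| ≤ |-(s⁻¹ * Au x)| + |AV x| := abs_sub _ _
      _ = s⁻¹ * |Au x| + |AV x| := by rw [abs_neg, abs_mul, abs_of_pos (inv_pos.2 hsp)]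
      _ ≤ c * |Au x| + |AV x| := by gcongr
      _ ≤ _ := le_abs_self _
  have hab : ∀ t : ℝ, ‖|t|‖ₑ = ‖t‖ₑ := fun t => by simp [← ofReal_norm]
  calc _ ≤ ∫⁻ x in Metric.ball 0 (θ * r), ‖c * |Au x| + |AV x|‖ₑ ^ p :=
        setLIntegral_mono' measurableSet_ball fun x hx => ENNReal.rpow_le_rpow (hbound x hx) hp0
    _ ≤ ∫⁻ x in Metric.ball 0 r, ‖c * |Au x| + |AV x|‖ₑ ^ p :=
        lintegral_mono_set (Metric.ball_subset_ball (by nlinarith))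
    _ ≤ 2 ^ (p - 1) * (‖c‖ₑ ^ p * D * B + C₀ * B) := by
        refine lintegral_enorm_add_rpow_le hp.le (hAum.abs.const_mul c) ?_ ?_
        · rw [lintegral_enorm_const_mul_rpow hp0, mul_assoc]
          gcongr
          simp_rw [hab]
          refine (hC k r _ hu.continuous).trans ?_
          gcongr
          exact hCD k
        · simp_rw [hab]
          refine (hC₀ r _ hV.continuous).trans ?_
          gcongr
    _ = _ := by rw [hK]; ring

end Harmonic

section SymGrad

variable {E : Type*} [NormedAddCommGroup E] [InnerProductSpace ℝ E] {ι : Type*} [Fintype ι]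

/-- The components `(∂ⱼ uᵢ + ∂ᵢ uⱼ) / 2` of the symmetrized gradient. -/
noncomputable def symGrad (b : OrthonormalBasis ι ℝ E) (u : ι → E → ℝ) (i j : ι) (x : E) : ℝ :=
  (1 / 2) * (dirDeriv (b j) (u i) x + dirDeriv (b i) (u j) x)

lemma contDiff_symGrad (b : OrthonormalBasis ι ℝ E) {u : ι → E → ℝ}
    (hu : ∀ i, ContDiff ℝ (⊤ : ℕ∞) (u i)) (i j : ι) : ContDiff ℝ (⊤ : ℕ∞) (symGrad b u i j) :=
  contDiff_const.mul (((hu i).dirDeriv _).add ((hu j).dirDeriv _))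

end SymGrad

section Interior

variable {E : Type*} [NormedAddCommGroup E] [InnerProductSpace ℝ E] [FiniteDimensional ℝ E]
  [MeasurableSpace E] [BorelSpace E] {ι : Type*} [Fintype ι]

/-- Interior Korn inequality, given a field `V` which is curl-free in its second index and has the
same Laplacian as the gradient of `u`. -/
lemma lintegral_ball_dirDeriv_le_of_correction (b : OrthonormalBasis ι ℝ E) {p : ℝ} (hp : 1 < p) :
    ∃ C : NNReal, ∀ (r' r : ℝ) (u : ι → E → ℝ) (V : ι → ι → E → ℝ) (B : ℝ≥0∞),
    0 ≤ r' → r' < r → 1 / 2 ≤ r → r ≤ 1 →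
    (∀ i, ContDiff ℝ (⊤ : ℕ∞) (u i)) → (∀ i k, ContDiff ℝ (⊤ : ℕ∞) (V i k)) →
    (∀ i k l, dirDeriv (b l) (V i k) = dirDeriv (b k) (V i l)) →
    (∀ i k, ∀ x ∈ Metric.ball 0 r, ∑ l, dirDeriv (b l) (dirDeriv (b l) (V i k)) x =
      ∑ l, dirDeriv (b k) (dirDeriv (b l) (dirDeriv (b l) (u i))) x) →
    (∀ i, ∫⁻ x in Metric.ball 0 r, ‖u i x‖ₑ ^ p ≤ B) →
    (∀ i k, ∫⁻ x in Metric.ball 0 r, ‖V i k x‖ₑ ^ p ≤ B) →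
    (∀ i k, ∫⁻ x in Metric.ball 0 r, ‖symGrad b u i k x‖ₑ ^ p ≤ B) →
    ∀ i k, ∫⁻ x in Metric.ball 0 r', ‖dirDeriv (b k) (u i) x‖ₑ ^ p ≤ C * B := by
  have hp0 : 0 ≤ p := by linarith
  set d : ℝ := (Fintype.card ι : ℝ)
  have hd0 : 0 ≤ d := by positivity
  set θ : ℝ := 1 - 1 / (2 * (d + 2)) with hθ
  have hθ1 : θ < 1 := by
    rw [hθ]
    have : 0 < 1 / (2 * (d + 2)) := by positivity
    linarith
  obtain ⟨C₁, hC₁⟩ := lintegral_ball_rpow_le_hardy b hp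
  obtain ⟨C₂, hC₂⟩ := lintegral_ball_dirDeriv_le b hp
  obtain ⟨C₃, hC₃⟩ := lintegral_ball_harmonic_le b hp hθ1
  have h2 : (2 : ℝ≥0∞) ^ (p - 1) ≠ ∞ := ENNReal.rpow_ne_top_of_nonneg (by linarith) (by simp)
  set K₁ : ℝ≥0∞ := 2 ^ (p - 1) * (1 + ‖(-(1 / 2) : ℝ)‖ₑ ^ p * (2 ^ (p - 1) * (1 + 1))) with hK₁
  have hK₁t : K₁ ≠ ∞ := by
    refine ENNReal.mul_ne_top h2 (ENNReal.add_ne_top.2 ⟨by simp, ENNReal.mul_ne_top ?_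
      (ENNReal.mul_ne_top h2 (by simp))⟩)
    exact ENNReal.rpow_ne_top_of_nonneg hp0 (by simp)
  set n : ℝ≥0∞ := ((Finset.univ : Finset ι).card : ℝ≥0∞) ^ p with hn
  have hnt : n ≠ ∞ := ENNReal.rpow_ne_top_of_nonneg hp0 (by simp)
  set K : ℝ≥0∞ := 2 ^ (p - 1) * (C₁ * (n * (C₂ * K₁) + C₃) + 1) with hK
  have hKt : K ≠ ∞ := by
    refine ENNReal.mul_ne_top h2 (ENNReal.add_ne_top.2 ⟨ENNReal.mul_ne_top (by simp)
      (ENNReal.add_ne_top.2 ⟨?_, by simp⟩), by simp⟩)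
    exact ENNReal.mul_ne_top hnt (ENNReal.mul_ne_top (by simp) hK₁t)
  refine ⟨K.toNNReal, fun r' r u V B hr'0 hr' hr hr1 hu hV hsw hlap hBu hBV hBe i k => ?_⟩
  rw [ENNReal.coe_toNNReal hKt]
  set H : ι → ι → E → ℝ := fun i k x => dirDeriv (b k) (u i) x - V i k x with hH
  have hdu : ∀ i k, ContDiff ℝ (⊤ : ℕ∞) (dirDeriv (b k) (u i)) := fun i k => (hu i).dirDeriv _
  have hHs : ∀ i k, ContDiff ℝ (⊤ : ℕ∞) (H i k) := fun i k => (hdu i k).sub (hV i k)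
  have hHd : ∀ i k a, dirDeriv a (H i k) =
      fun x => dirDeriv a (dirDeriv (b k) (u i)) x - dirDeriv a (V i k) x := fun i k a =>
    dirDeriv_sub (hdu i k) (hV i k) a
  have hHsw : ∀ i k l, dirDeriv (b l) (H i k) = dirDeriv (b k) (H i l) := fun i k l => by
    rw [hHd, hHd, hsw i k l, dirDeriv_comm (hu i)]
  have hharm : ∀ i k, ∀ x ∈ Metric.ball (0 : E) r,
      ∑ l, dirDeriv (b l) (dirDeriv (b l) (H i k)) x = 0 := fun i k x hx => by
    simp_rw [hHd, dirDeriv_sub ((hdu i k).dirDeriv _) ((hV i k).dirDeriv _)]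
    rw [Finset.sum_sub_distrib, hlap i k x hx, sub_eq_zero]
    refine Finset.sum_congr rfl fun l _ => ?_
    rw [dirDeriv_comm (hu i) (b l) (b k), dirDeriv_comm (hdu i l) (b l) (b k)]
  have hε : ∀ i k, ∫⁻ x in Metric.ball 0 r, ‖(1 / 2) * (H i k x + H k i x)‖ₑ ^ p ≤ K₁ * B := by
    intro i k
    have h1 : ∀ x, (1 / 2) * (H i k x + H k i x) =
        symGrad b u i k x + -(1 / 2) * (V i k x + V k i x) := fun x => by
      simp only [hH, symGrad]
      ring
    simp_rw [h1]
    refine (lintegral_enorm_add_rpow_le hp.le (contDiff_symGrad b hu i k).continuous.measurable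
      (hBe i k) (B := ‖(-(1 / 2) : ℝ)‖ₑ ^ p * (2 ^ (p - 1) * (B + B))) ?_).trans_eq ?_
    · rw [lintegral_enorm_const_mul_rpow hp0]
      gcongr
      exact lintegral_enorm_add_rpow_le hp.le (hV i k).continuous.measurable (hBV i k) (hBV k i)
    · rw [hK₁]
      ring
  have hDH := hC₂ r H (K₁ * B) hHs hHsw hharm hε i k
  have hD : ∫⁻ x in Metric.ball 0 r, ‖(r - ‖x‖) • fderiv ℝ (H i k) x‖ₑ ^ p ≤
      n * (C₂ * (K₁ * B)) := by
    refine le_trans (lintegral_mono fun x => ?_) (lintegral_sum_rpow_le hp.le Finset.univ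
      (f := fun l x => ‖(r - ‖x‖) * dirDeriv (b l) (H i k) x‖ₑ) (fun l => ?_) hDH)
    · gcongr
      rw [enorm_smul]
      simp_rw [enorm_mul]
      rw [← Finset.mul_sum]
      gcongr
      simp_rw [← ofReal_norm]
      rw [← ENNReal.ofReal_sum_of_nonneg fun _ _ => norm_nonneg _]
      exact ENNReal.ofReal_le_ofReal (norm_fderiv_le_sum b _ x)
    · have := ((hHs i k).dirDeriv (b l)).continuous
      exact (Continuous.mul (by fun_prop) this).enorm.measurable
  have hin := hC₃ r (u i) (V i k) k B hr (hu i) (hV i k) (hharm i k) (hBu i) (hBV i k)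
  have hHb : ∫⁻ x in Metric.ball 0 r', ‖H i k x‖ₑ ^ p ≤ C₁ * (n * (C₂ * (K₁ * B)) + C₃ * B) :=
    (hC₁ r' r (H i k) hr'0 hr' hr hr1 (hHs i k)).trans (by gcongr)
  have hsplit : ∀ x, dirDeriv (b k) (u i) x = H i k x + V i k x := fun x => by simp [hH]
  simp_rw [hsplit]
  refine (lintegral_enorm_add_rpow_le hp.le (hHs i k).continuous.measurable hHb
    ((lintegral_mono_set (Metric.ball_subset_ball hr'.le)).trans (hBV i k))).trans_eq ?_
  rw [hK]
  ring

end Interior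

section Correction

variable {E : Type*} [NormedAddCommGroup E] [InnerProductSpace ℝ E] [FiniteDimensional ℝ E]
  [MeasurableSpace E] [BorelSpace E] {ι : Type*} [Fintype ι]

/-- A field, bounded in `L^p` by the symmetrized gradient of `u`, which is curl-free in its second
index and has the same Laplacian as the gradient of `u`. -/
lemma exists_correction (b : OrthonormalBasis ι ℝ E) {p : ℝ} (hp : 1 < p) :
    ∃ C : NNReal, ∀ (r : ℝ) (u : ι → E → ℝ) (B : ℝ≥0∞), 0 < r → r < 1 →
    (∀ i, ContDiff ℝ (⊤ : ℕ∞) (u i)) →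
    (∀ i k, ∫⁻ x in Metric.ball 0 1, ‖symGrad b u i k x‖ₑ ^ p ≤ B) →
    ∃ V : ι → ι → E → ℝ, (∀ i k, ContDiff ℝ (⊤ : ℕ∞) (V i k)) ∧
    (∀ i k l, dirDeriv (b l) (V i k) = dirDeriv (b k) (V i l)) ∧
    (∀ i k, ∀ x ∈ Metric.ball 0 r, ∑ l, dirDeriv (b l) (dirDeriv (b l) (V i k)) x =
      ∑ l, dirDeriv (b k) (dirDeriv (b l) (dirDeriv (b l) (u i))) x) ∧
    ∀ i k, ∫⁻ x, ‖V i k x‖ₑ ^ p ≤ C * B := by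
  have hp0 : 0 < p := by linarith
  obtain ⟨C, hC⟩ := lintegral_rieszPair_le (E := E) hp
  have h2 : (2 : ℝ≥0∞) ^ (p - 1) ≠ ∞ := ENNReal.rpow_ne_top_of_nonneg (by linarith) (by simp)
  set n : ℝ≥0∞ := ((Finset.univ : Finset ι).card : ℝ≥0∞) ^ p with hn
  have hnt : n ≠ ∞ := ENNReal.rpow_ne_top_of_nonneg hp0.le (by simp)
  set K : ℝ≥0∞ := n * (2 ^ (p - 1) * (‖(2 : ℝ)‖ₑ ^ p * C + ‖(-1 : ℝ)‖ₑ ^ p * C)) with hK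
  have hKt : K ≠ ∞ := by
    refine ENNReal.mul_ne_top hnt (ENNReal.mul_ne_top h2 (ENNReal.add_ne_top.2 ⟨?_, ?_⟩)) <;>
    exact ENNReal.mul_ne_top (ENNReal.rpow_ne_top_of_nonneg hp0.le (by simp)) (by simp)
  refine ⟨K.toNNReal, fun r u B hr0 hr1 hu hB => ?_⟩
  rw [ENNReal.coe_toNNReal hKt]
  let χ : ContDiffBump (0 : E) := ⟨r, 1, hr0, hr1⟩
  have hχ : ContDiff ℝ (⊤ : ℕ∞) χ := χ.contDiff
  set f : ι → ι → E → ℝ := fun i j x => χ x * symGrad b u i j x with hf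
  have he := contDiff_symGrad b hu
  have hfs : ∀ i j, ContDiff ℝ (⊤ : ℕ∞) (f i j) := fun i j => hχ.mul (he i j)
  have hfc : ∀ i j, HasCompactSupport (f i j) := fun i j => χ.hasCompactSupport.mul_right
  have hfn : ∀ i j, FourierNice (f i j) := fun i j =>
    fourierNice_of_hasCompactSupport (hfs i j) (hfc i j)
  have hfB : ∀ i j, ∫⁻ x, ‖f i j x‖ₑ ^ p ≤ B := fun i j => by
    refine le_trans ?_ (hB i j)
    rw [← lintegral_indicator measurableSet_ball]
    refine lintegral_mono fun x => ?_
    by_cases hx : x ∈ Metric.ball (0 : E) 1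
    · rw [Set.indicator_of_mem hx]
      simp only [hf]
      gcongr
      rw [enorm_le_iff_norm_le, norm_mul, Real.norm_of_nonneg χ.nonneg]
      exact mul_le_of_le_one_left (norm_nonneg _) χ.le_one
    · have h0 : χ x = 0 := χ.zero_of_le_dist (by simpa using hx)
      simp [hf, h0, hp0]
  have hfe : ∀ i j, ∀ x ∈ Metric.ball (0 : E) r, f i j x = symGrad b u i j x := fun i j x hx => by
    simp only [hf]
    rw [χ.one_of_mem_closedBall (Metric.ball_subset_closedBall hx), one_mul]
  have hR : ∀ i j k m, ContDiff ℝ (⊤ : ℕ∞) (rieszPair (b i) (b j) (f k m)) := fun i j k m =>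
    (hfn k m).contDiff_rieszPair _ _
  have hRB : ∀ i j k m, ∫⁻ x, ‖rieszPair (b i) (b j) (f k m) x‖ₑ ^ p ≤ C * B := fun i j k m => by
    obtain ⟨M, hM⟩ := (hfs k m).continuous.bounded_above_of_compact_support (hfc k m)
    refine (hC (b i) (b j) (f k m) (b.norm_eq_one i).le (b.norm_eq_one j).le (hfn k m)
      (hfs k m).continuous.measurable ⟨M, hM⟩).trans ?_
    gcongr
    exact hfB k m
  have hcomb : ∀ (a : E) (P Q : ι → E → ℝ), (∀ j, ContDiff ℝ (⊤ : ℕ∞) (P j)) →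
      (∀ j, ContDiff ℝ (⊤ : ℕ∞) (Q j)) →
      dirDeriv a (fun x => ∑ j, (2 * P j x + -1 * Q j x)) =
        fun x => ∑ j, (2 * dirDeriv a (P j) x + -1 * dirDeriv a (Q j) x) := fun a P Q hP hQ => by
    rw [dirDeriv_sum Finset.univ (f := fun j x => 2 * P j x + -1 * Q j x)
      fun j => (contDiff_const.mul (hP j)).add (contDiff_const.mul (hQ j))]
    funext x
    refine Finset.sum_congr rfl fun j _ => ?_
    rw [dirDeriv_add (contDiff_const.mul (hP j)) (contDiff_const.mul (hQ j)),
      dirDeriv_const_mul (hP j), dirDeriv_const_mul (hQ j)]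
  refine ⟨fun i k x => ∑ j, (2 * rieszPair (b j) (b k) (f i j) x +
    -1 * rieszPair (b i) (b k) (f j j) x), fun i k => ?_, fun i k l => ?_, fun i k x hx => ?_,
    fun i k => ?_⟩
  · exact ContDiff.sum fun j _ => (contDiff_const.mul (hR _ _ _ _)).add
      (contDiff_const.mul (hR _ _ _ _))
  · rw [hcomb _ _ _ (fun j => hR j k i j) (fun j => hR i k j j),
      hcomb _ _ _ (fun j => hR j l i j) (fun j => hR i l j j)]
    funext x
    refine Finset.sum_congr rfl fun j _ => ?_
    rw [(hfn i j).dirDeriv_rieszPair_swap, (hfn j j).dirDeriv_rieszPair_swap]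
  · have h1 : ∀ l, dirDeriv (b l) (dirDeriv (b l) (fun x =>
      ∑ j, (2 * rieszPair (b j) (b k) (f i j) x +
        -1 * rieszPair (b i) (b k) (f j j) x))) x =
        ∑ j, (2 * dirDeriv (b l) (dirDeriv (b l) (rieszPair (b j) (b k) (f i j))) x +
        -1 * dirDeriv (b l) (dirDeriv (b l) (rieszPair (b i) (b k) (f j j))) x) := fun l => by
      rw [hcomb _ _ _ (fun j => hR j k i j) (fun j => hR i k j j),
        hcomb _ _ _ (fun j => (hR j k i j).dirDeriv _) (fun j => (hR i k j j).dirDeriv _)]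
    simp_rw [h1]
    rw [Finset.sum_comm]
    refine Finset.sum_congr rfl fun j _ => ?_
    rw [Finset.sum_add_distrib, ← Finset.mul_sum, ← Finset.mul_sum,
      (hfn i j).sum_dirDeriv_dirDeriv_rieszPair b, (hfn j j).sum_dirDeriv_dirDeriv_rieszPair b]
    have h3 : ∀ i j m, dirDeriv (b k) (dirDeriv (b m) (f i j)) x =
        (1 / 2) * (dirDeriv (b k) (dirDeriv (b m) (dirDeriv (b j) (u i))) x +
          dirDeriv (b k) (dirDeriv (b m) (dirDeriv (b i) (u j))) x) := fun i j m => by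
      have ha := (hu i).dirDeriv (b j)
      have hb := (hu j).dirDeriv (b i)
      have e1 : dirDeriv (b m) (symGrad b u i j) = fun x => (1 / 2) *
          (dirDeriv (b m) (dirDeriv (b j) (u i)) x + dirDeriv (b m) (dirDeriv (b i) (u j)) x) := by
        change dirDeriv (b m) (fun x => (1 / 2) *
          (dirDeriv (b j) (u i) x + dirDeriv (b i) (u j) x)) = _
        rw [dirDeriv_const_mul (ha.add hb), dirDeriv_add ha hb]
      rw [dirDeriv_congr_of_isOpen Metric.isOpen_ball
        (fun y hy => dirDeriv_congr_of_isOpen Metric.isOpen_ball (hfe i j) (b m) hy) (b k) hx, e1,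
        dirDeriv_const_mul ((ha.dirDeriv _).add (hb.dirDeriv _)),
        dirDeriv_add (ha.dirDeriv _) (hb.dirDeriv _)]
    rw [h3, h3, dirDeriv_comm (hu j) (b i) (b j)]
    ring
  · have h1 : ∀ j, ∫⁻ x, ‖2 * rieszPair (b j) (b k) (f i j) x +
        -1 * rieszPair (b i) (b k) (f j j) x‖ₑ ^ p ≤
        2 ^ (p - 1) * (‖(2 : ℝ)‖ₑ ^ p * (C * B) + ‖(-1 : ℝ)‖ₑ ^ p * (C * B)) := fun j => by
      refine lintegral_enorm_add_rpow_le hp.le ((hR j k i j).continuous.measurable.const_mul 2) ?_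
          ?_
      · rw [lintegral_enorm_const_mul_rpow hp0.le]
        gcongr
        exact hRB j k i j
      · rw [lintegral_enorm_const_mul_rpow hp0.le]
        gcongr
        exact hRB i k j j
    refine (lintegral_mono fun x => ?_).trans ((lintegral_sum_rpow_le hp.le Finset.univ
      (fun j => ?_) h1).trans_eq ?_)
    · gcongr
      exact enorm_sum_le _ _
    · exact (((contDiff_const.mul (hR _ _ _ _)).add
        (contDiff_const.mul (hR _ _ _ _))).continuous).enorm.measurable
    · rw [hK]
      ring

/-- Korn's inequality on a ball slightly smaller than the unit ball, in terms of components. -/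
theorem lintegral_ball_dirDeriv_le_korn (b : OrthonormalBasis ι ℝ E) {p : ℝ} (hp : 1 < p) :
    ∃ C : NNReal, ∀ (r : ℝ) (u : ι → E → ℝ) (B : ℝ≥0∞), 0 ≤ r → r < 1 →
    (∀ i, ContDiff ℝ (⊤ : ℕ∞) (u i)) →
    (∀ i, ∫⁻ x in Metric.ball 0 1, ‖u i x‖ₑ ^ p ≤ B) →
    (∀ i k, ∫⁻ x in Metric.ball 0 1, ‖symGrad b u i k x‖ₑ ^ p ≤ B) →
    ∀ i k, ∫⁻ x in Metric.ball 0 r, ‖dirDeriv (b k) (u i) x‖ₑ ^ p ≤ C * B := by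
  obtain ⟨C₁, hC₁⟩ := exists_correction b hp
  obtain ⟨C₂, hC₂⟩ := lintegral_ball_dirDeriv_le_of_correction b hp
  refine ⟨C₂ * (C₁ + 1), fun r u B hr0 hr1 hu hBu hBe i k => ?_⟩
  have hsub : Metric.ball (0 : E) ((r + 1) / 2) ⊆ Metric.ball 0 1 :=
    Metric.ball_subset_ball (by linarith)
  obtain ⟨V, hV, hsw, hlap, hVB⟩ := hC₁ ((r + 1) / 2) u B (by linarith) (by linarith) hu hBe
  have hB1 : B ≤ (C₁ + 1) * B := le_mul_of_one_le_left' le_add_self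
  have hB2 : C₁ * B ≤ (C₁ + 1) * B := mul_le_mul_left le_self_add _
  refine (hC₂ r ((r + 1) / 2) u V ((C₁ + 1) * B) hr0 (by linarith) (by linarith) (by linarith) hu hV
    hsw hlap (fun i => ?_) (fun i k => ?_) (fun i k => ?_) i k).trans_eq ?_
  · exact (lintegral_mono_set hsub).trans ((hBu i).trans hB1)
  · exact (setLIntegral_le_lintegral _ _).trans ((hVB i k).trans hB2)
  · exact (lintegral_mono_set hsub).trans ((hBe i k).trans hB1)
  · push_cast
    ring

end Correction

section Matrices

variable {d : ℕ}

lemma frob_nonneg (M : Matrix (Fin d) (Fin d) ℝ) : 0 ≤ frob M := Real.sqrt_nonneg _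

lemma continuous_frob : Continuous (frob (d := d)) :=
  Real.continuous_sqrt.comp (continuous_finsetSum _ fun i _ => continuous_finsetSum _ fun j _ =>
    (continuous_id.matrix_elem i j).pow 2)

lemma abs_apply_le_frob (M : Matrix (Fin d) (Fin d) ℝ) (i j : Fin d) : |M i j| ≤ frob M := by
  refine Real.abs_le_sqrt ?_
  refine (Finset.single_le_sum (f := fun j => M i j ^ 2) (fun j _ => sq_nonneg _)
    (Finset.mem_univ j)).trans ?_
  exact Finset.single_le_sum (f := fun i => ∑ j, M i j ^ 2)
    (fun i _ => Finset.sum_nonneg fun j _ => sq_nonneg _) (Finset.mem_univ i)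

lemma frob_le_sum_abs (M : Matrix (Fin d) (Fin d) ℝ) : frob M ≤
    ∑ q : Fin d × Fin d, |M q.1 q.2| := by
  refine (Real.sqrt_le_left (Finset.sum_nonneg fun _ _ => abs_nonneg _)).2 ?_
  rw [← Fintype.sum_prod_type' (f := fun i j => M i j ^ 2)]
  simpa only [sq_abs] using Finset.sum_sq_le_sq_sum_of_nonneg (s := Finset.univ)
    (f := fun q : Fin d × Fin d => |M q.1 q.2|) fun _ _ => abs_nonneg _

lemma enorm_frob_le_sum (M : Matrix (Fin d) (Fin d) ℝ) :
    ‖frob M‖ₑ ≤ ∑ q : Fin d × Fin d, ‖M q.1 q.2‖ₑ := by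
  simp_rw [← ofReal_norm, Real.norm_eq_abs]
  rw [← ENNReal.ofReal_sum_of_nonneg fun _ _ => abs_nonneg _, abs_of_nonneg (frob_nonneg M)]
  exact ENNReal.ofReal_le_ofReal (frob_le_sum_abs M)

variable {u : EuclideanSpace ℝ (Fin d) → EuclideanSpace ℝ (Fin d)}

lemma continuous_jacob (hu : ContDiff ℝ (⊤ : ℕ∞) u) : Continuous (jacob u) := by
  refine continuous_matrix fun i j => ?_
  exact (EuclideanSpace.proj i).continuous.comp
    ((hu.continuous_fderiv (by simp)).clm_apply continuous_const)

lemma dirDeriv_apply_eq_jacob (hu : ContDiff ℝ (⊤ : ℕ∞) u) (x : EuclideanSpace ℝ (Fin d))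
    (i j : Fin d) :
    dirDeriv (EuclideanSpace.basisFun (Fin d) ℝ j) (fun y => u y i) x = jacob u x i j := by
  have h := ((EuclideanSpace.proj i : EuclideanSpace ℝ (Fin d) →L[ℝ] ℝ).hasFDerivAt.comp x
    (hu.differentiable (by simp) x).hasFDerivAt).fderiv
  have e : fderiv ℝ (fun y => u y i) x =
    (EuclideanSpace.proj i : EuclideanSpace ℝ (Fin d) →L[ℝ] ℝ).comp (fderiv ℝ u x) := h
  rw [dirDeriv, e, EuclideanSpace.basisFun_apply]
  rfl

lemma symGrad_apply_eq (hu : ContDiff ℝ (⊤ : ℕ∞) u) (x : EuclideanSpace ℝ (Fin d)) (i j : Fin d) :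
    symGrad (EuclideanSpace.basisFun (Fin d) ℝ) (fun i y => u y i) i j x =
      ((1 / 2 : ℝ) • (jacob u x + (jacob u x).transpose)) i j := by
  rw [symGrad, dirDeriv_apply_eq_jacob hu, dirDeriv_apply_eq_jacob hu]
  rfl

end Matrices

lemma lintegral_ball_le_of_forall_lt {E : Type*} [SeminormedAddCommGroup E] [MeasurableSpace E]
    {μ : Measure E} {f : E → ℝ≥0∞} {K : ℝ≥0∞}
    (h : ∀ r : ℝ, 0 ≤ r → r < 1 → ∫⁻ x in Metric.ball 0 r, f x ∂μ ≤ K) :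
    ∫⁻ x in Metric.ball 0 1, f x ∂μ ≤ K := by
  obtain ⟨r, hr, hr1, hrt⟩ := exists_seq_strictMono_tendsto' (zero_lt_one (α := ℝ))
  have e : Metric.ball (0 : E) 1 = ⋃ n, Metric.ball 0 (r n) := by
    ext x
    simp only [Metric.mem_ball, Set.mem_iUnion]
    refine ⟨fun hx => ((hrt.eventually_const_lt hx).exists), ?_⟩
    rintro ⟨n, hn⟩
    exact hn.trans (hr1 n).2
  rw [e, setLIntegral_iUnion_of_directed]
  · exact iSup_le fun n => h _ (hr1 n).1.le (hr1 n).2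
  · exact Monotone.directed_le fun m n hmn => Metric.ball_subset_ball (hr.monotone hmn)

/-- Korn's inequality in terms of lower integrals. -/
theorem lintegral_frob_jacob_le (d : ℕ) {p : ℝ} (hp : 1 < p) :
    ∃ C : NNReal, ∀ u : EuclideanSpace ℝ (Fin d) → EuclideanSpace ℝ (Fin d),
    ContDiff ℝ (⊤ : ℕ∞) u →
    ∫⁻ x in Metric.ball (0 : EuclideanSpace ℝ (Fin d)) 1, ‖frob (jacob u x)‖ₑ ^ p ≤
      C * ((∫⁻ x in Metric.ball (0 : EuclideanSpace ℝ (Fin d)) 1, ‖u x‖ₑ ^ p) +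
        ∫⁻ x in Metric.ball (0 : EuclideanSpace ℝ (Fin d)) 1,
          ‖frob ((1 / 2 : ℝ) • (jacob u x + (jacob u x).transpose))‖ₑ ^ p) := by
  have hp0 : 0 < p := by linarith
  obtain ⟨C, hC⟩ := lintegral_ball_dirDeriv_le_korn (EuclideanSpace.basisFun (Fin d) ℝ) hp
  set n : ℝ≥0∞ := ((Finset.univ : Finset (Fin d × Fin d)).card : ℝ≥0∞) ^ p with hn
  have hnt : n ≠ ∞ := ENNReal.rpow_ne_top_of_nonneg hp0.le (ENNReal.natCast_ne_top _)
  refine ⟨n.toNNReal * C, fun u hu => ?_⟩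
  set B := (∫⁻ x in Metric.ball (0 : EuclideanSpace ℝ (Fin d)) 1, ‖u x‖ₑ ^ p) +
        ∫⁻ x in Metric.ball (0 : EuclideanSpace ℝ (Fin d)) 1,
          ‖frob ((1 / 2 : ℝ) • (jacob u x + (jacob u x).transpose))‖ₑ ^ p with hB
  have hui : ∀ i, ContDiff ℝ (⊤ : ℕ∞) fun x => u x i := fun i =>
    (EuclideanSpace.proj i : EuclideanSpace ℝ (Fin d) →L[ℝ] ℝ).contDiff.comp hu
  have hcomp : ∀ q : Fin d × Fin d, ∫⁻ x in Metric.ball (0 : EuclideanSpace ℝ (Fin d)) 1,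
      ‖jacob u x q.1 q.2‖ₑ ^ p ≤ C * B := fun q => by
    refine lintegral_ball_le_of_forall_lt fun r hr0 hr1 => ?_
    refine Eq.trans_le ?_ (hC r (fun i x => u x i) B hr0 hr1 hui (fun i => ?_) (fun i k => ?_)
      q.1 q.2)
    · simp_rw [dirDeriv_apply_eq_jacob hu]
    · refine (lintegral_mono fun x => ?_).trans le_self_add
      gcongr
      rw [enorm_le_iff_norm_le]
      exact PiLp.norm_apply_le _ _
    · refine (lintegral_mono fun x => ?_).trans le_add_self
      gcongr
      rw [enorm_le_iff_norm_le, symGrad_apply_eq hu, Real.norm_eq_abs,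
        Real.norm_of_nonneg (frob_nonneg _)]
      exact abs_apply_le_frob _ _ _
  refine (lintegral_mono fun x => ?_).trans ((lintegral_sum_rpow_le hp.le Finset.univ
    (f := fun (q : Fin d × Fin d) x => ‖jacob u x q.1 q.2‖ₑ) (fun q => ?_) hcomp).trans_eq ?_)
  · gcongr
    exact enorm_frob_le_sum _
  · exact ((continuous_jacob hu).matrix_elem q.1 q.2).enorm.measurable
  · rw [ENNReal.coe_mul, ENNReal.coe_toNNReal hnt, mul_assoc]

/-- The passage from integrals to lower integrals for continuous functions on a ball. -/
lemma lintegral_ball_enorm_rpow_eq {E F : Type*} [NormedAddCommGroup E] [NormedSpace ℝ E]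
    [FiniteDimensional ℝ E] [MeasurableSpace E] [BorelSpace E] (μ : Measure E)
    [IsFiniteMeasureOnCompacts μ] [NormedAddCommGroup F]
    {f : E → F} (hf : Continuous f) {p : ℝ} (hp : 0 < p) (x : E) (r : ℝ) :
    ∫⁻ y in Metric.ball x r, ‖f y‖ₑ ^ p ∂μ =
      ENNReal.ofReal (∫ y in Metric.ball x r, ‖f y‖ ^ p ∂μ) := by
  have hc : Continuous fun y => ‖f y‖ ^ p := hf.norm.rpow_const fun _ => Or.inr hp.le
  rw [ofReal_integral_eq_lintegral_ofReal]
  · simp_rw [← ENNReal.ofReal_rpow_of_nonneg (norm_nonneg _) hp.le, ofReal_norm]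
  · exact (hc.continuousOn.integrableOn_compact (isCompact_closedBall x r)).mono_set
      Metric.ball_subset_closedBall
  · exact Filter.Eventually.of_forall fun y => by positivity

end

/-- Korn's inequality for `p ∈ (1, ∞)`: there is `C > 0` such that for every smooth
`u : ℝ^d → ℝ^d`,
`∫_{B₁} |Du|^p ≤ C (∫_{B₁} |u|^p + ∫_{B₁} |𝓔u|^p)`, where `𝓔u = (Du + Duᵀ)/2`. -/
theorem korn_inequality {d : ℕ} (hd : 1 ≤ d) (p : ℝ) (hp : 1 < p) :
    ∃ C > 0, ∀ u : EuclideanSpace ℝ (Fin d) → EuclideanSpace ℝ (Fin d), ContDiff ℝ (⊤ : ℕ∞) u →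
      ∫ x in Metric.ball (0 : EuclideanSpace ℝ (Fin d)) 1, (frob (jacob u x)) ^ p
        ≤ C * ((∫ x in Metric.ball (0 : EuclideanSpace ℝ (Fin d)) 1, ‖u x‖ ^ p)
             + ∫ x in Metric.ball (0 : EuclideanSpace ℝ (Fin d)) 1,
                 (frob ((1 / 2 : ℝ) • (jacob u x + (jacob u x).transpose))) ^ p) := by
  have hp0 : 0 < p := by linarith
  obtain ⟨C, hC⟩ := lintegral_frob_jacob_le d hp
  refine ⟨C + 1, by positivity, fun u hu => ?_⟩
  have hJ := continuous_jacob hu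
  have hE : Continuous fun x => (1 / 2 : ℝ) • (jacob u x + (jacob u x).transpose) :=
    (hJ.add hJ.matrix_transpose).const_smul (1 / 2 : ℝ)
  have h := hC u hu
  rw [lintegral_ball_enorm_rpow_eq _ (continuous_frob.comp' hJ) hp0,
    lintegral_ball_enorm_rpow_eq _ hu.continuous hp0,
    lintegral_ball_enorm_rpow_eq _ (continuous_frob.comp' hE) hp0] at h
  simp only [Real.norm_of_nonneg (frob_nonneg _)] at h
  have h1 : 0 ≤ ∫ x in Metric.ball (0 : EuclideanSpace ℝ (Fin d)) 1, ‖u x‖ ^ p :=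
    integral_nonneg fun x => by positivity
  have h2 : 0 ≤ ∫ x in Metric.ball (0 : EuclideanSpace ℝ (Fin d)) 1,
      (frob ((1 / 2 : ℝ) • (jacob u x + (jacob u x).transpose))) ^ p :=
    integral_nonneg fun x => Real.rpow_nonneg (frob_nonneg _) _
  rw [← ENNReal.ofReal_add h1 h2, ← ENNReal.ofReal_coe_nnreal,
    ← ENNReal.ofReal_mul C.coe_nonneg,
    ENNReal.ofReal_le_ofReal_iff (mul_nonneg C.coe_nonneg (add_nonneg h1 h2))] at h
  linarith
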